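/- Let q be a prime power, let K be a finite separable extension of F_q(t), let O_K be the integral closure of F_q[t] in K, let S be a finite set of places of K containing all infinite places, and let A = O_{K,S} = {x ∈ K : v_p(x) ≥ 0 for all places p of K not in S}. If the unit group A^× is infinite, then the abelianization of SL₂(A) is a finite group in which every element has order dividing 6. -/

import Mathlib

open IsDedekindDomain Polynomial

namespace SLTwo
open Matrix

local notation "SL2" A => Matrix.SpecialLinearGroup (Fin 2) A

section basic
variable {A : Type*} [CommRing A]

/-- The matrix with given rows `(a, b)` and `(c, d)`. -/
def mk (a b c d : A) (h : a * d - b * c = 1) : SL2 A :=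
  ⟨!![a, b; c, d], by rw [Matrix.det_fin_two_of]; exact h⟩

theorem exists_mk (M : SL2 A) : ∃ a b c d h, M = mk (A := A) a b c d h := by
  refine ⟨M.1 0 0, M.1 0 1, M.1 1 0, M.1 1 1, ?_, ?_⟩
  · have := M.2
    rwa [Matrix.det_fin_two] at this
  · apply Subtype.ext
    exact Matrix.eta_fin_two M.1

theorem mk_congr {a b c d a' b' c' d' : A} {h} {h'} (h1 : a = a') (h2 : b = b') (h3 : c = c')
    (h4 : d = d') : mk a b c d h = mk a' b' c' d' h' := by
  subst h1 h2 h3 h4; rfl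

theorem mk_mul (a b c d a' b' c' d' : A) (h h') :
    mk a b c d h * mk a' b' c' d' h' =
      mk (a * a' + b * c') (a * b' + b * d') (c * a' + d * c') (c * b' + d * d')
        (by linear_combination (a' * d' - b' * c') * h + h') := by
  apply Subtype.ext
  change !![a, b; c, d] * !![a', b'; c', d'] = _
  rw [Matrix.mul_fin_two]
  rfl

theorem mk_inv (a b c d : A) (h) :
    (mk a b c d h)⁻¹ = mk d (-b) (-c) a (by linear_combination h) := by
  rw [inv_eq_iff_mul_eq_one, mk_mul]
  apply Subtype.ext
  ext i j
  fin_cases i <;> fin_cases j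
  · simp [mk]; linear_combination h
  · simp [mk]; ring
  · simp [mk]; ring
  · simp [mk]; linear_combination h

theorem one_eq_mk : (1 : SL2 A) = mk 1 0 0 1 (by ring) := by
  apply Subtype.ext
  ext i j
  fin_cases i <;> fin_cases j <;> simp [mk]

/-- Upper elementary matrices. -/
def U (r : A) : SL2 A := mk 1 r 0 1 (by ring)
/-- Lower elementary matrices. -/
def L (r : A) : SL2 A := mk 1 0 r 1 (by ring)
/-- The diagonal matrix of a unit. -/
def T (u : Aˣ) : SL2 A := mk u 0 0 (u⁻¹ : Aˣ) (by simp)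

theorem T_zpow_aux (u v : Aˣ) : T u * T v = T (u * v) := by
  simp only [T, mk_mul]
  apply mk_congr <;> simp [mul_comm]

/-- `T` as a homomorphism. -/
def THom : Aˣ →* SL2 A where
  toFun := T
  map_one' := by simp only [T, one_eq_mk]; apply mk_congr <;> simp
  map_mul' u v := (T_zpow_aux u v).symm

/-- The principal congruence subgroup of level `y`. -/
def Gam (y : A) : Subgroup (SL2 A) where
  carrier := {M | y ∣ M.1 0 0 - 1 ∧ y ∣ M.1 0 1 ∧ y ∣ M.1 1 0 ∧ y ∣ M.1 1 1 - 1}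
  one_mem' := by simp
  mul_mem' := by
    intro M N hM hN
    obtain ⟨a, b, c, d, h, rfl⟩ := exists_mk M
    obtain ⟨a', b', c', d', h', rfl⟩ := exists_mk N
    rw [mk_mul]
    change y ∣ a - 1 ∧ y ∣ b ∧ y ∣ c ∧ y ∣ d - 1 at hM
    change y ∣ a' - 1 ∧ y ∣ b' ∧ y ∣ c' ∧ y ∣ d' - 1 at hN
    change y ∣ (a * a' + b * c') - 1 ∧ y ∣ a * b' + b * d' ∧ y ∣ c * a' + d * c' ∧
      y ∣ (c * b' + d * d') - 1
    obtain ⟨⟨p, hp⟩, ⟨q, hq⟩, ⟨r, hr⟩, ⟨s, hs⟩⟩ := hM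
    obtain ⟨⟨p', hp'⟩, ⟨q', hq'⟩, ⟨r', hr'⟩, ⟨s', hs'⟩⟩ := hN
    subst hq hr hq' hr'
    refine ⟨⟨p * a' + p' + y * q * r', ?_⟩, ⟨a * q' + q * d', by ring⟩,
      ⟨r * a' + d * r', by ring⟩, ⟨y * r * q' + s * d' + s', ?_⟩⟩
    · linear_combination a' * hp + hp'
    · linear_combination d' * hs + hs'
  inv_mem' := by
    intro M hM
    obtain ⟨a, b, c, d, h, rfl⟩ := exists_mk M
    rw [mk_inv]
    change y ∣ a - 1 ∧ y ∣ b ∧ y ∣ c ∧ y ∣ d - 1 at hM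
    change y ∣ d - 1 ∧ y ∣ -b ∧ y ∣ -c ∧ y ∣ a - 1
    rw [dvd_neg, dvd_neg]
    exact ⟨hM.2.2.2, hM.2.1, hM.2.2.1, hM.1⟩

theorem mk_mem_Gam {y a b c d : A} {h} :
    mk a b c d h ∈ Gam y ↔ y ∣ a - 1 ∧ y ∣ b ∧ y ∣ c ∧ y ∣ d - 1 := Iff.rfl

theorem Gam_normal (y : A) : (Gam y).Normal where
  conj_mem := by
    intro M hM N
    obtain ⟨a, b, c, d, h, rfl⟩ := exists_mk M
    obtain ⟨a', b', c', d', h', rfl⟩ := exists_mk N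
    rw [mk_inv, mk_mul, mk_mul, mk_mem_Gam]
    rw [mk_mem_Gam] at hM
    obtain ⟨⟨p, hp⟩, ⟨q, hq⟩, ⟨r, hr⟩, ⟨s, hs⟩⟩ := hM
    obtain rfl : a = 1 + y * p := by linear_combination hp
    obtain rfl : d = 1 + y * s := by linear_combination hs
    subst hq hr
    refine ⟨⟨d' * (a' * p + b' * r) - c' * (a' * q + b' * s), ?_⟩,
      ⟨-b' * (a' * p + b' * r) + a' * (a' * q + b' * s), by ring⟩,
      ⟨d' * (c' * p + d' * r) - c' * (c' * q + d' * s), by ring⟩,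
      ⟨-b' * (c' * p + d' * r) + a' * (c' * q + d' * s), ?_⟩⟩ <;> linear_combination h'

theorem Gam_mono {y z : A} (h : z ∣ y) : Gam y ≤ Gam z := fun _ hM =>
  ⟨h.trans hM.1, h.trans hM.2.1, h.trans hM.2.2.1, h.trans hM.2.2.2⟩

end basic

section stab
variable {A : Type*} [CommRing A] [IsDomain A]

theorem cancel_left {X M N : Matrix (Fin 2) (Fin 2) A} (hX : X.det ≠ 0) (h : X * M = X * N) :
    M = N := by
  have := congrArg (fun Z => X.adjugate * Z) h
  simp only [← Matrix.mul_assoc, Matrix.adjugate_mul, Matrix.smul_mul, Matrix.one_mul] at this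
  ext i j
  have h2 := congrFun (congrFun this i) j
  simp only [Matrix.smul_apply, smul_eq_mul] at h2
  exact mul_left_cancel₀ hX h2

/-- Pairs `(M, N)` with `N = X⁻¹ M X`. -/
def Rel (X : Matrix (Fin 2) (Fin 2) A) (M N : SL2 A) : Prop := M.1 * X = X * N.1

theorem Rel.mul {X : Matrix (Fin 2) (Fin 2) A} {M N M' N' : SL2 A} (h : Rel X M N)
    (h' : Rel X M' N') : Rel X (M * M') (N * N') := by
  unfold Rel at *
  rw [Matrix.SpecialLinearGroup.coe_mul, Matrix.SpecialLinearGroup.coe_mul, Matrix.mul_assoc, h',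
    ← Matrix.mul_assoc, h, Matrix.mul_assoc]

theorem Rel.inv {X : Matrix (Fin 2) (Fin 2) A} {M N : SL2 A} (h : Rel X M N) :
    Rel X M⁻¹ N⁻¹ := by
  unfold Rel at *
  have h1 : (M⁻¹).1 * M.1 = 1 := by
    rw [← Matrix.SpecialLinearGroup.coe_mul]; simp
  have h2 : N.1 * (N⁻¹).1 = 1 := by
    rw [← Matrix.SpecialLinearGroup.coe_mul]; simp
  calc (M⁻¹).1 * X = (M⁻¹).1 * (X * N.1) * (N⁻¹).1 := by
        rw [Matrix.mul_assoc, Matrix.mul_assoc, h2, Matrix.mul_one]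
    _ = X * (N⁻¹).1 := by rw [← h, ← Matrix.mul_assoc, h1, Matrix.one_mul]

theorem Rel.right_unique {X : Matrix (Fin 2) (Fin 2) A} (hX : X.det ≠ 0) {M N N' : SL2 A}
    (h : Rel X M N) (h' : Rel X M N') : N = N' := by
  apply Subtype.ext
  exact cancel_left hX (h.symm.trans h')

theorem rel_mk {x1 x2 x3 x4 a b c d a' b' c' d' : A} {h h'} :
    Rel !![x1, x2; x3, x4] (mk a b c d h) (mk a' b' c' d' h') ↔
      (a * x1 + b * x3 = x1 * a' + x2 * c' ∧ a * x2 + b * x4 = x1 * b' + x2 * d') ∧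
      (c * x1 + d * x3 = x3 * a' + x4 * c' ∧ c * x2 + d * x4 = x3 * b' + x4 * d') := by
  unfold Rel
  change !![a, b; c, d] * _ = _ * !![a', b'; c', d'] ↔ _
  rw [Matrix.mul_fin_two, Matrix.mul_fin_two]
  constructor
  · intro h
    have h00 := congrFun (congrFun h 0) 0
    have h01 := congrFun (congrFun h 0) 1
    have h10 := congrFun (congrFun h 1) 0
    have h11 := congrFun (congrFun h 1) 1
    simp at h00 h01 h10 h11
    exact ⟨⟨h00, h01⟩, h10, h11⟩
  · rintro ⟨⟨h1, h2⟩, h3, h4⟩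
    rw [h1, h2, h3, h4]

end stab
end SLTwo

namespace SLTwo
open Matrix

section conj
variable {A : Type*} [CommRing A]

theorem T_conj (u : Aˣ) (a b c d : A) (h) :
    T u * mk a b c d h * (T u)⁻¹ = mk a (u ^ 2 * b) ((u⁻¹ : Aˣ) ^ 2 * c) d
      (by linear_combination h - b * c * ((u : A) * (u⁻¹ : Aˣ) + 1) * u.mul_inv) := by
  simp only [T, mk_inv, mk_mul]
  apply mk_congr
  · linear_combination a * u.mul_inv
  · ring
  · ring
  · linear_combination d * u.mul_inv

theorem T_conj_U (u : Aˣ) (r : A) : T u * U r * (T u)⁻¹ = U (u ^ 2 * r) := by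
  rw [U, T_conj]
  apply mk_congr <;> simp

theorem U_mul (r s : A) : U r * U s = U (r + s) := by
  simp only [U, mk_mul]
  apply mk_congr <;> ring

theorem mul_L (a b c d t : A) (h) : mk a b c d h * L t =
    mk (a + t * b) b (c + t * d) d (by linear_combination h) := by
  simp only [L, mk_mul]
  apply mk_congr <;> ring

theorem mul_U (a b c d t : A) (h) : mk a b c d h * U t =
    mk a (b + t * a) c (d + t * c) (by linear_combination h) := by
  simp only [U, mk_mul]
  apply mk_congr <;> ring

theorem L_mk (a b c d t : A) (h) : L t * mk a b c d h =
    mk a b (c + t * a) (d + t * b) (by linear_combination h) := by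
  simp only [L, mk_mul]
  apply mk_congr <;> ring

theorem U_mk (a b c d t : A) (h) : U t * mk a b c d h =
    mk (a + t * c) (b + t * d) c d (by linear_combination h) := by
  simp only [U, mk_mul]
  apply mk_congr <;> ring

theorem same_row (a b c d c' d' : A) (h h') :
    mk a b c' d' h' = L (c' * d - d' * c) * mk a b c d h := by
  rw [L_mk]
  apply mk_congr rfl rfl
  · linear_combination -c' * h + c * h'
  · linear_combination -d' * h + d * h'

/-- The matrix `e • L (1 / e)`. -/
def XL (e : A) : Matrix (Fin 2) (Fin 2) A := !![e, 0; 1, e]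

theorem rel_XL_L (e r : A) : Rel (XL e) (L r) (L r) := by
  unfold Rel XL L
  change !![1, 0; r, 1] * _ = _ * !![1, 0; r, 1]
  rw [Matrix.mul_fin_two, Matrix.mul_fin_two]
  congr 3 <;> ring_nf

theorem det_XL [IsDomain A] {e : A} (he : e ≠ 0) : (XL e).det ≠ 0 := by
  rw [XL, Matrix.det_fin_two_of]
  simpa using he

end conj

section main
variable {A : Type*} [CommRing A] [IsDomain A] {Q : Type*} [CommGroup Q]
  (φ : (Matrix.SpecialLinearGroup (Fin 2) A) →* Q)

theorem exists_rel {e y : A} (hy : e ^ 2 ∣ y) {M : Matrix.SpecialLinearGroup (Fin 2) A}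
    (hM : M ∈ Gam y) : ∃ N, Rel (XL e) M N := by
  have hM := Gam_mono hy hM
  obtain ⟨a, b, c, d, h, rfl⟩ := exists_mk M
  rw [mk_mem_Gam] at hM
  obtain ⟨⟨p, hp⟩, ⟨q, hq⟩, ⟨r, hr⟩, ⟨s, hs⟩⟩ := hM
  obtain rfl : a = 1 + e ^ 2 * p := by linear_combination hp
  obtain rfl : d = 1 + e ^ 2 * s := by linear_combination hs
  subst hq hr
  refine ⟨mk (1 + e ^ 2 * p + e * q) (e ^ 2 * q) (e ^ 2 * r + e * (s - p) - q)
    (1 + e ^ 2 * s - e * q) (by linear_combination h), ?_⟩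
  rw [XL, rel_mk]
  refine ⟨⟨?_, ?_⟩, ?_, ?_⟩ <;> ring

variable {φ}

theorem phi_same_row (hL : ∀ r, φ (L r) = 1) {a b c d c' d' : A} {h h'} :
    φ (mk a b c' d' h') = φ (mk a b c d h) := by
  rw [same_row a b c d c' d' h h', map_mul, hL, one_mul]

theorem rel_same_row (hL : ∀ r, φ (L r) = 1) {e : A} (he : e ≠ 0) {a b c d c' d' : A} {h h'}
    {N N' : Matrix.SpecialLinearGroup (Fin 2) A}
    (hN : Rel (XL e) (mk a b c d h) N) (hN' : Rel (XL e) (mk a b c' d' h') N') :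
    φ N = φ N' := by
  rw [same_row a b c d c' d' h h'] at hN'
  have := (rel_XL_L e (c' * d - d' * c)).mul hN
  rw [hN'.right_unique (det_XL he) this, map_mul, hL, one_mul]

theorem rel_U {e z r : A} {v : Aˣ} (hv : (v : A) ^ 2 - 1 = e ^ 2 * z) :
    ∃ N, Rel (XL e) (U ((v ^ 2 - 1) * e ^ 2 * r)) N ∧ φ N = 1 := by
  -- `U` of this argument is a commutator inside the group of stabilising matrices
  have hT : Rel (XL e) (T v) (mk v 0 (-((v⁻¹ : Aˣ) : A) * e * z) (v⁻¹ : Aˣ) (by simp)) := by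
    rw [T, XL, rel_mk]
    refine ⟨⟨by ring, by ring⟩, ?_, by ring⟩
    linear_combination (-((v⁻¹ : Aˣ) : A)) * hv + (v : A) * v.mul_inv
  have hU1 : ∃ N, Rel (XL e) (U (e ^ 2 * r)) N :=
    exists_rel (dvd_refl _) (by
      rw [U, mk_mem_Gam]; simp)
  obtain ⟨N, hN⟩ := hU1
  have h := (((hT.mul hN).mul hT.inv).mul hN.inv)
  have heq : U (((v : A) ^ 2 - 1) * e ^ 2 * r) =
      T v * U (e ^ 2 * r) * (T v)⁻¹ * (U (e ^ 2 * r))⁻¹ := by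
    rw [T_conj_U, eq_mul_inv_iff_mul_eq, U_mul]
    congr 1; ring
  rw [heq]
  refine ⟨_, h, ?_⟩
  rw [map_mul, map_mul, map_mul, map_inv, map_inv]
  rw [mul_comm (φ _) (φ N), mul_assoc (φ N), mul_inv_cancel, mul_one, mul_inv_cancel]

/-- One comparison step: the twisted homomorphism is invariant under conjugation by `T v`
when some `a + t y b` divides `v ^ 2 - 1`. -/
theorem rel_T_conj_step (hL : ∀ r, φ (L r) = 1) {e z : A} {u1 : Aˣ} (he : e ≠ 0)
    (hv : (u1 : A) ^ 2 - 1 = e ^ 2 * z)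
    {y : A} (hy : y = (u1 ^ 2 - 1) * e ^ 2) {a b c d t : A} {h} {v : Aˣ}
    (hM : mk a b c d h ∈ Gam y) (hdvd : a + t * y * b ∣ (v : A) ^ 2 - 1)
    {N N' : Matrix.SpecialLinearGroup (Fin 2) A}
    (hN : Rel (XL e) (mk a b c d h) N)
    (hN' : Rel (XL e) (T v * mk a b c d h * (T v)⁻¹) N') : φ N = φ N' := by
  obtain ⟨κ, hκ⟩ := hdvd
  rw [mk_mem_Gam] at hM
  obtain ⟨-, ⟨b1, rfl⟩, -, -⟩ := hM
  obtain ⟨N1, hN1, hφ⟩ := rel_U (φ := φ) (r := κ * b1) hv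
  have h1 := (hN.mul (rel_XL_L e (t * y))).mul hN1
  have h2 := hN'.mul (rel_XL_L e ((v⁻¹ : Aˣ) ^ 2 * t * y))
  rw [T_conj, mul_L] at h2
  rw [mul_L, mul_U] at h1
  have hrow : mk (a + (v⁻¹ : Aˣ) ^ 2 * t * y * ((v : A) ^ 2 * (y * b1))) ((v : A) ^ 2 * (y * b1))
      ((v⁻¹ : Aˣ) ^ 2 * c + (v⁻¹ : Aˣ) ^ 2 * t * y * d) d (by
        linear_combination h - y * b1 * c * ((v : A) * (v⁻¹ : Aˣ) + 1) * v.mul_inv) =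
      mk (a + t * y * (y * b1)) (y * b1 + (u1 ^ 2 - 1) * e ^ 2 * (κ * b1) * (a + t * y * (y * b1)))
      ((v⁻¹ : Aˣ) ^ 2 * c + (v⁻¹ : Aˣ) ^ 2 * t * y * d) d (by
        rw [← hy]
        linear_combination h - y * b1 * c * ((v : A) * (v⁻¹ : Aˣ) + 1) * v.mul_inv
          + (c + t * y * d) * (v⁻¹ : Aˣ) ^ 2 * y * b1 * hκ
            -t * y * d * y * b1 * ((v : A) * (v⁻¹ : Aˣ) + 1) * v.mul_inv) := by
    apply mk_congr
    · linear_combination t * y * y * b1 * ((v : A) * (v⁻¹ : Aˣ) + 1) * v.mul_inv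
    · rw [← hy]
      linear_combination y * b1 * hκ
    · rfl
    · rfl
  rw [hrow] at h2
  have h3 := rel_same_row hL he h1 h2
  simpa [hL, hφ] using h3

end main
end SLTwo

namespace SLTwo
open Matrix

theorem one_mem_of_forall_prime (P : AddSubgroup ℤ)
    (h : ∀ l : ℕ, l.Prime → ∃ k : ℕ, ¬ l ∣ k ∧ (k : ℤ) ∈ P) : (1 : ℤ) ∈ P := by
  obtain ⟨g, hg⟩ := Int.subgroup_cyclic P
  by_cases h1 : g.natAbs = 1
  · rw [hg, ← AddSubgroup.zmultiples_eq_closure, Int.mem_zmultiples_iff]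
    rcases Int.natAbs_eq g with h2 | h2 <;> rw [h2, h1] <;> simp
  · obtain ⟨l, hl, hlg⟩ := Nat.exists_prime_and_dvd h1
    obtain ⟨k, hk, hkP⟩ := h l hl
    rw [hg, ← AddSubgroup.zmultiples_eq_closure, Int.mem_zmultiples_iff] at hkP
    exact absurd (hlg.trans (by simpa using Int.natAbs_dvd_natAbs.mpr hkP)) hk

section main
variable {A : Type*} [CommRing A] [IsDomain A] {Q : Type*} [CommGroup Q]
  {φ : (Matrix.SpecialLinearGroup (Fin 2) A) →* Q}

theorem T_mul (u v : Aˣ) : T (u * v) = T u * T v := (T_zpow_aux u v).symm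

theorem rel_T_conj_aux (hL : ∀ r, φ (L r) = 1)
    {u : Aˣ} {m : ℕ}
    (hNT : ∀ a B : A, IsCoprime a B → B ≠ 0 → ∀ l : ℕ, l.Prime →
      ∃ (t : A) (k : ℕ), ¬ l ∣ k ∧ a + t * B ∣ (u : A) ^ (m * k) - 1)
    {e z : A} {u1 : Aˣ} (he : e ≠ 0) (hv : (u1 : A) ^ 2 - 1 = e ^ 2 * z)
    {y : A} (hy : y = (u1 ^ 2 - 1) * e ^ 2) (hy0 : y ≠ 0) {a b c d : A} {h}
    (hM : mk a b c d h ∈ Gam y) (hb : b ≠ 0)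
    {N N' : Matrix.SpecialLinearGroup (Fin 2) A}
    (hN : Rel (XL e) (mk a b c d h) N)
    (hN' : Rel (XL e) (T (u ^ m) * mk a b c d h * (T (u ^ m))⁻¹) N') : φ N = φ N' := by
  have hey : e ^ 2 ∣ y := ⟨_, hy.trans (mul_comm _ _)⟩
  have hmem : ∀ v : Aˣ, T v * mk a b c d h * (T v)⁻¹ ∈ Gam y := fun v =>
    (Gam_normal y).conj_mem _ hM _
  choose F hF using fun v : Aˣ => exists_rel hey (hmem v)
  have hFu : ∀ (v : Aˣ) N, Rel (XL e) (T v * mk a b c d h * (T v)⁻¹) N → N = F v :=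
    fun v N hN => hN.right_unique (det_XL he) (hF v)
  let P : AddSubgroup ℤ :=
    { carrier := {p | ∀ j : ℤ, φ (F (u ^ (j + m * p))) = φ (F (u ^ j))}
      zero_mem' := by intro j; simp
      add_mem' := by
        intro p q hp hq j
        have := hq (j + m * p)
        rw [hp j] at this
        rw [← this]; congr 3; ring
      neg_mem' := by
        intro p hp j
        have := hp (j + m * (-p))
        rw [← this]; congr 3; ring }
  have h1 : (1 : ℤ) ∈ P := by
    apply one_mem_of_forall_prime
    intro l hl
    have hM' := hM
    rw [mk_mem_Gam] at hM'
    obtain ⟨⟨p, hp⟩, -⟩ := hM'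
    have hcop : IsCoprime a (y * b) := by
      refine IsCoprime.mul_right ⟨1, -p, by linear_combination hp⟩ ⟨d, -c, by linear_combination h⟩
    obtain ⟨t, k, hk, hdvd⟩ := hNT a (y * b) hcop (mul_ne_zero hy0 hb) l hl
    refine ⟨k, hk, ?_⟩
    intro j
    have hj := hmem (u ^ j)
    rw [T_conj] at hj
    have hw : ((u ^ j)⁻¹ : Aˣ) * ((u ^ j : Aˣ) : A) = 1 := by simp
    have h3 := hF (u ^ j)
    rw [T_conj] at h3
    refine (rel_T_conj_step hL he hv hy (t := t * ((u ^ j)⁻¹ : Aˣ) ^ 2) (v := u ^ (m * k)) hj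
      ?_ h3 ?_).symm
    · have : a + t * (((u ^ j)⁻¹ : Aˣ) : A) ^ 2 * y * (((u ^ j : Aˣ) : A) ^ 2 * b) =
          a + t * (y * b) := by
        linear_combination t * y * b * ((((u ^ j)⁻¹ : Aˣ) : A) * ((u ^ j : Aˣ) : A) + 1) * hw
      rw [this]
      refine hdvd.trans ⟨(u : A) ^ (m * k) + 1, ?_⟩
      push_cast
      ring
    · have h4 := hF (u ^ (j + m * (k : ℤ)))
      have h5 : u ^ (j + m * (k : ℤ)) = u ^ (m * k) * u ^ j := by
        rw [_root_.zpow_add, mul_comm]; norm_cast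
      rw [h5] at h4 ⊢
      rw [← T_conj, ]
      convert h4 using 1
      rw [T_mul]
      group
      exact h
  have h2 := h1 0
  have e0 : u ^ (0 : ℤ) = 1 := by simp
  have e1 : u ^ (0 + (m : ℤ) * 1) = u ^ m := by simp
  rw [e0, e1] at h2
  rw [hFu (u ^ m) N' hN', h2, hFu 1 N]
  convert hN using 1
  have : (T (1 : Aˣ) : Matrix.SpecialLinearGroup (Fin 2) A) = 1 := THom.map_one
  rw [this]; simp

theorem rel_T_conj (hL : ∀ r, φ (L r) = 1)
    {u : Aˣ} {m : ℕ}
    (hNT : ∀ a B : A, IsCoprime a B → B ≠ 0 → ∀ l : ℕ, l.Prime →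
      ∃ (t : A) (k : ℕ), ¬ l ∣ k ∧ a + t * B ∣ (u : A) ^ (m * k) - 1)
    {e z : A} {u1 : Aˣ} (he : e ≠ 0) (hv : (u1 : A) ^ 2 - 1 = e ^ 2 * z)
    {y : A} (hy : y = (u1 ^ 2 - 1) * e ^ 2) (hy0 : y ≠ 0)
    {M N N' : Matrix.SpecialLinearGroup (Fin 2) A} (hM : M ∈ Gam y)
    (hN : Rel (XL e) M N)
    (hN' : Rel (XL e) (T (u ^ m) * M * (T (u ^ m))⁻¹) N') : φ N = φ N' := by
  obtain ⟨a, b, c, d, h, rfl⟩ := exists_mk M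
  by_cases hb : b = 0
  · subst hb
    obtain ⟨N1, hN1, h1⟩ := rel_U (φ := φ) (r := 1) hv
    obtain ⟨N2, hN2, h2⟩ := rel_U (φ := φ) (r := ((u ^ m : Aˣ) : A) ^ 2) hv
    rw [← hy] at hN1 hN2
    have ha : a ≠ 0 := by rintro rfl; simp at h
    have h3 := hN.mul hN1
    have h4 := hN'.mul hN2
    have h5 : T (u ^ m) * mk a 0 c d h * (T (u ^ m))⁻¹ * U (y * ((u ^ m : Aˣ) : A) ^ 2) =
        T (u ^ m) * (mk a 0 c d h * U (y * 1)) * (T (u ^ m))⁻¹ := by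
      have : U (y * ((u ^ m : Aˣ) : A) ^ 2) = T (u ^ m) * U (y * 1) * (T (u ^ m))⁻¹ := by
        rw [T_conj_U]; congr 1; ring
      rw [this]; group
    rw [h5] at h4
    have hU1 : U (y * 1) ∈ Gam y := by rw [U, mk_mem_Gam]; simp
    have hM2 := (Gam y).mul_mem hM hU1
    rw [mul_U] at h3 h4 hM2
    have := rel_T_conj_aux hL hNT he hv hy hy0 hM2 (by simpa using ⟨hy0, ha⟩) h3 h4
    simpa [h1, h2] using this
  · exact rel_T_conj_aux hL hNT he hv hy hy0 hM hb hN hN'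

theorem rel_XL_T_conj {V e y p q r s : A} (v : Aˣ) (hV : V = (v : A) ^ 2 - 1) (h h') :
    Rel (XL e) (T v * mk (1 + y * e ^ 2 * p - y * e * q) (y * e ^ 2 * q)
      (y * e ^ 2 * r + y * e * (p - s) - y * q) (1 + y * e ^ 2 * s + y * e * q) h * (T v)⁻¹)
      (T v * mk (1 + y * e ^ 2 * p + y * e * V * q) (y * e ^ 2 * q)
      (y * e ^ 2 * r + y * e * V * (s - p) - y * V ^ 2 * q) (1 + y * e ^ 2 * s - y * e * V * q)
      h' * (T v)⁻¹) := by
  rw [T_conj, T_conj, XL, rel_mk]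
  have hi := v.mul_inv
  subst hV
  refine ⟨⟨?_, ?_⟩, ?_, ?_⟩
  · ring
  · ring
  · linear_combination e * (y * e * (p - s) - y * q * (2 - v ^ 2)) * ((v : A) * (v⁻¹ : Aˣ) + 1) * hi
  · ring

/-- Invariance of `φ` under conjugation by `L (1 / x)` on a deep congruence subgroup. -/
theorem exists_level_L (hL : ∀ r, φ (L r) = 1)
    {u : Aˣ} {m : ℕ}
    (hNT : ∀ a B : A, IsCoprime a B → B ≠ 0 → ∀ l : ℕ, l.Prime →
      ∃ (t : A) (k : ℕ), ¬ l ∣ k ∧ a + t * B ∣ (u : A) ^ (m * k) - 1)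
    (hm : 0 < m) (hu : ∀ n : ℕ, 0 < n → u ^ n ≠ 1)
    (hfin : ∀ a : A, a ≠ 0 → Finite (A ⧸ Ideal.span {a})) {x : A} (hx : x ≠ 0) :
    ∃ y : A, y ≠ 0 ∧ ∀ M N : Matrix.SpecialLinearGroup (Fin 2) A, M ∈ Gam y → Rel (XL x) M N →
      φ N = φ M := by
  have hpow : ∀ n : ℕ, 0 < n → (u : A) ^ n - 1 ≠ 0 := by
    intro n hn h
    refine hu n hn (Units.ext ?_)
    push_cast
    linear_combination h
  obtain ⟨V, hV⟩ : ∃ V : A, V = (u : A) ^ (2 * m) - 1 := ⟨_, rfl⟩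
  have hV0 : V ≠ 0 := hV ▸ hpow _ (by omega)
  obtain ⟨e, he⟩ : ∃ e : A, e = V * x := ⟨_, rfl⟩
  have he0 : e ≠ 0 := he ▸ mul_ne_zero hV0 hx
  have : Finite (A ⧸ Ideal.span {e ^ 2}) := hfin _ (pow_ne_zero 2 he0)
  obtain ⟨n, hn, hn1⟩ : ∃ n : ℕ, 0 < n ∧ e ^ 2 ∣ (u : A) ^ n - 1 := by
    have : Finite (A ⧸ Ideal.span {e ^ 2})ˣ := inferInstance
    let w : (A ⧸ Ideal.span {e ^ 2})ˣ := Units.map (Ideal.Quotient.mk _).toMonoidHom u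
    refine ⟨orderOf w, orderOf_pos w, ?_⟩
    rw [← Ideal.mem_span_singleton, ← Ideal.Quotient.eq_zero_iff_mem, map_sub, map_pow, map_one]
    have := congrArg Units.val (pow_orderOf_eq_one w)
    rw [sub_eq_zero]
    rwa [Units.val_pow_eq_pow_val, Units.val_one] at this
  obtain ⟨z, hz⟩ : e ^ 2 ∣ ((u ^ n : Aˣ) : A) ^ 2 - 1 := by
    refine hn1.trans ⟨(u : A) ^ n + 1, ?_⟩
    push_cast; ring
  have hy0 : ((u ^ n : Aˣ) : A) ^ 2 - 1 ≠ 0 := by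
    have := hpow (n * 2) (by omega)
    rw [pow_mul] at this
    simpa using this
  obtain ⟨y, hy⟩ : ∃ y : A, y = (((u ^ n : Aˣ) : A) ^ 2 - 1) * e ^ 2 := ⟨_, rfl⟩
  have hy1 : y ≠ 0 := hy ▸ mul_ne_zero hy0 (pow_ne_zero 2 he0)
  refine ⟨y * e ^ 2, mul_ne_zero hy1 (pow_ne_zero 2 he0), ?_⟩
  intro M N hM hN
  obtain ⟨a, b, c, d, h, rfl⟩ := exists_mk M
  rw [mk_mem_Gam] at hM
  obtain ⟨⟨p, hp⟩, ⟨q, rfl⟩, ⟨r, rfl⟩, ⟨s, hs⟩⟩ := hM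
  obtain rfl : a = 1 + y * e ^ 2 * p := by linear_combination hp
  obtain rfl : d = 1 + y * e ^ 2 * s := by linear_combination hs
  -- the conjugate of `M` by `L (-1 / e)`
  let M0 := mk (1 + y * e ^ 2 * p - y * e * q) (y * e ^ 2 * q)
    (y * e ^ 2 * r + y * e * (p - s) - y * q) (1 + y * e ^ 2 * s + y * e * q)
    (by linear_combination h)
  have hM0 : M0 ∈ Gam y := by
    rw [mk_mem_Gam]
    exact ⟨⟨e ^ 2 * p - e * q, by ring⟩, ⟨e ^ 2 * q, by ring⟩,
      ⟨e ^ 2 * r + e * (p - s) - q, by ring⟩, ⟨e ^ 2 * s + e * q, by ring⟩⟩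
  have hR0 : Rel (XL e) M0 (mk _ _ _ _ h) := by
    rw [XL, rel_mk]
    refine ⟨⟨?_, ?_⟩, ?_, ?_⟩ <;> ring
  have hN2 : N = mk (1 + y * e ^ 2 * p + y * e * V * q) (y * e ^ 2 * q)
      (y * e ^ 2 * r + y * e * V * (s - p) - y * V ^ 2 * q) (1 + y * e ^ 2 * s - y * e * V * q)
      (by linear_combination h) := by
    refine hN.right_unique (det_XL hx) ?_
    rw [XL, rel_mk, he]
    refine ⟨⟨?_, ?_⟩, ?_, ?_⟩ <;> ring
  have hR1 : Rel (XL e) (T (u ^ m) * M0 * (T (u ^ m))⁻¹) (T (u ^ m) * N * (T (u ^ m))⁻¹) := by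
    rw [hN2]
    refine rel_XL_T_conj _ ?_ _ _
    rw [hV]; push_cast; ring
  have := rel_T_conj hL hNT he0 hz hy hy1 hM0 hR0 hR1
  rw [this]
  simp only [map_mul, map_inv]
  rw [mul_comm (φ (T _)), mul_assoc, mul_inv_cancel, mul_one]

end main
end SLTwo

namespace SLTwo
open Matrix

section fin
variable {A : Type*} [CommRing A]

/-- Stable range one for the finite quotient `A / y`. -/
theorem exists_unit_mod {y : A} (hy : Finite (A ⧸ Ideal.span {y})) {a c : A} (h : IsCoprime a c) :
    ∃ t g : A, y ∣ g * (a + t * c) - 1 := by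
  let π := Ideal.Quotient.mk (Ideal.span {y})
  obtain ⟨n, hn, hidem⟩ : ∃ n : ℕ, 0 < n ∧ IsIdempotentElem (π a ^ n) := by
    obtain ⟨i, j, hij, h⟩ := Finite.exists_ne_map_eq_of_infinite (fun n : ℕ => π a ^ n)
    wlog hlt : i < j generalizing i j
    · exact this j i hij.symm h.symm (by omega)
    refine ⟨(j - i) * (i + 1), Nat.mul_pos (by omega) (by omega), ?_⟩
    have h0 : ∀ k, i ≤ k → π a ^ (k + (j - i)) = π a ^ k := by
      intro k hk
      obtain ⟨l, rfl⟩ := Nat.exists_eq_add_of_le hk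
      have : i + l + (j - i) = j + l := by omega
      rw [this, pow_add, pow_add]
      rw [← h]
    have h1 : ∀ r k, i ≤ k → π a ^ (k + (j - i) * r) = π a ^ k := by
      intro r
      induction r with
      | zero => simp
      | succ r ih =>
        intro k hk
        rw [mul_add, mul_one, ← add_assoc, h0 _ (by omega), ih k hk]
    unfold IsIdempotentElem
    rw [← pow_add, h1]
    calc i ≤ 1 * (i + 1) := by omega
      _ ≤ _ := Nat.mul_le_mul_right _ (by omega)
  obtain ⟨t, ht⟩ := Ideal.Quotient.mk_surjective (1 - π a ^ n)
  have hunit : IsUnit (π a + (1 - π a ^ n) * π c) := by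
    by_contra hnu
    obtain ⟨m, hm, hmem⟩ := exists_max_ideal_of_mem_nonunits hnu
    have hp := hm.isPrime
    have hor : π a ^ n ∈ m ∨ 1 - π a ^ n ∈ m := by
      refine hp.mem_or_mem ?_
      have : π a ^ n * (1 - π a ^ n) = 0 := by rw [mul_sub, hidem.eq]; simp
      rw [this]; exact m.zero_mem
    have hone : ¬ (π a ^ n ∈ m ∧ 1 - π a ^ n ∈ m) := by
      rintro ⟨h1, h2⟩
      exact hp.ne_top ((Ideal.eq_top_iff_one _).mpr (by simpa using m.add_mem h1 h2))
    rcases hor with h1 | h1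
    · have ha := hp.mem_of_pow_mem n h1
      have h2 : (1 - π a ^ n) * π c ∈ m := by simpa using m.sub_mem hmem ha
      rcases hp.mem_or_mem h2 with h3 | h3
      · exact hone ⟨h1, h3⟩
      · obtain ⟨p, q, hpq⟩ := h
        apply hp.ne_top
        rw [Ideal.eq_top_iff_one]
        have : (1 : A ⧸ Ideal.span {y}) = π p * π a + π q * π c := by
          rw [← map_mul, ← map_mul, ← map_add, hpq, map_one]
        rw [this]
        exact m.add_mem (m.mul_mem_left _ ha) (m.mul_mem_left _ h3)
    · have : π a ∈ m := by
        simpa using m.sub_mem hmem (m.mul_mem_right (π c) h1)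
      exact hone ⟨m.pow_mem_of_mem this n hn, h1⟩
  obtain ⟨g', hg'⟩ := isUnit_iff_exists_inv'.mp hunit
  obtain ⟨g, rfl⟩ := Ideal.Quotient.mk_surjective g'
  refine ⟨t, g, ?_⟩
  rw [← Ideal.mem_span_singleton, ← Ideal.Quotient.eq_zero_iff_mem]
  rw [map_sub, map_mul, map_add, map_mul, ht, map_one]
  rw [sub_eq_zero]; exact hg'

end fin

section main
variable {A : Type*} [CommRing A] [IsDomain A] {Q : Type*} [CommGroup Q]
  {φ : (Matrix.SpecialLinearGroup (Fin 2) A) →* Q}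

/-- Conjugation by this matrix is conjugation by `diag (1 / x, x)`. -/
def XD (x : A) : Matrix (Fin 2) (Fin 2) A := !![1, 0; 0, x ^ 2]

theorem rel_XD {x a b c d : A} (h h') : Rel (XD x) (mk a b (x ^ 2 * c) d h)
    (mk a (x ^ 2 * b) c d h') := by
  rw [XD, rel_mk]
  refine ⟨⟨?_, ?_⟩, ?_, ?_⟩ <;> ring

theorem det_XD {x : A} (hx : x ≠ 0) : (XD x).det ≠ 0 := by
  rw [XD, Matrix.det_fin_two_of]
  simpa using hx

/-- The two ways of restricting `φ` to `Γ₀(x²)` agree on `M`. -/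
def Agree (φ : (Matrix.SpecialLinearGroup (Fin 2) A) →* Q) (x : A)
    (M : Matrix.SpecialLinearGroup (Fin 2) A) : Prop := ∀ N, Rel (XD x) M N → φ N = φ M

theorem agree_of_mul {x : A} {E E' M : Matrix.SpecialLinearGroup (Fin 2) A}
    (hE : Rel (XD x) E E') (h1 : φ E = 1) (h2 : φ E' = 1) (h : Agree φ x (E * M)) :
    Agree φ x M := by
  intro N hN
  have := h _ (hE.mul hN)
  simpa [h1, h2] using this

theorem agree_of_U (hU : ∀ r, φ (U r) = 1) {x a b c d : A} {h} (t : A)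
    (H : Agree φ x (mk (a + t * c) (b + t * d) c d (by linear_combination h))) :
    Agree φ x (mk a b c d h) := by
  rw [← U_mk (h := h)] at H
  refine agree_of_mul (E' := U (x ^ 2 * t)) ?_ (hU _) (hU _) H
  have := rel_XD (x := x) (a := 1) (b := t) (c := 0) (d := 1) (by ring) (by ring)
  convert this using 1
  · rw [U]; apply mk_congr <;> simp
  · rfl

theorem agree_of_L (hL : ∀ r, φ (L r) = 1) {x a b c d : A} {h} (t : A)
    (H : Agree φ x (mk a b (c + x ^ 2 * t * a) (d + x ^ 2 * t * b) (by linear_combination h))) :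
    Agree φ x (mk a b c d h) := by
  rw [← L_mk (h := h)] at H
  refine agree_of_mul (E' := L t) ?_ (hL _) (hL _) H
  have := rel_XD (x := x) (a := 1) (b := 0) (c := t) (d := 1) (by ring) (by ring)
  convert this using 1
  rw [L]; apply mk_congr <;> simp

theorem exists_level_D (hU : ∀ r, φ (U r) = 1)
    {x y : A} (hx : x ≠ 0) (hy : y ≠ 0)
    (hy' : ∀ M N : Matrix.SpecialLinearGroup (Fin 2) A, M ∈ Gam y → Rel (XL x) M N → φ N = φ M) :
    ∃ y : A, y ≠ 0 ∧ ∀ M ∈ Gam y, Agree φ x M := by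
  refine ⟨y * x ^ 2, mul_ne_zero hy (pow_ne_zero 2 hx), ?_⟩
  intro M hM N hN
  obtain ⟨a, b, C, d, h, rfl⟩ := exists_mk M
  rw [mk_mem_Gam] at hM
  obtain ⟨⟨p, hp⟩, ⟨q, hq⟩, ⟨r, hr⟩, ⟨s, hs⟩⟩ := hM
  have hyb : y ∣ b := ⟨x ^ 2 * q, by rw [hq]; ring⟩
  obtain ⟨c, hyc⟩ : ∃ c', c' = y * r := ⟨_, rfl⟩
  obtain rfl : C = x ^ 2 * c := by rw [hr, hyc]; ring
  replace hyc : y ∣ c := ⟨r, hyc⟩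
  have hya : y ∣ a - 1 := ⟨x ^ 2 * p, by rw [hp]; ring⟩
  have hyd : y ∣ d - 1 := ⟨x ^ 2 * s, by rw [hs]; ring⟩
  have h' : a * d - x ^ 2 * b * c = 1 := by linear_combination h
  rw [hN.right_unique (det_XD hx) (rel_XD h h')]
  let M3 := mk (a - x * c) (-x ^ 2 * c + x * a - x * d + x ^ 2 * b) c (d + x * c)
    (by linear_combination h)
  let M1 := mk d (-(x ^ 2 * c)) (-b) a (by linear_combination h)
  have e1 : mk a (x ^ 2 * b) c d h' = U x * M3 * (U x)⁻¹ := by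
    rw [eq_mul_inv_iff_mul_eq]
    simp only [M3, U, mk_mul]
    apply mk_congr <;> ring
  let w : Matrix.SpecialLinearGroup (Fin 2) A := mk 0 (-1) 1 0 (by ring)
  have e2 : M1 = w * mk a b (x ^ 2 * c) d h * w⁻¹ := by
    rw [eq_mul_inv_iff_mul_eq]
    simp only [M1, w, mk_mul]
    apply mk_congr <;> ring
  have hM1 : M1 ∈ Gam y := by
    rw [mk_mem_Gam]
    exact ⟨hyd, (hyc.mul_left _).neg_right, hyb.neg_right, hya⟩
  have h3 : φ M3 = φ (U x * M1 * (U x)⁻¹) := by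
    apply hy' _ _ ((Gam_normal y).conj_mem _ hM1 _)
    simp only [M3, M1, U, mk_mul, mk_inv, XL, rel_mk]
    refine ⟨⟨?_, ?_⟩, ?_, ?_⟩ <;> ring
  rw [e1]
  simp only [map_mul, map_inv, hU, one_mul, inv_one, mul_one] at h3 ⊢
  rw [h3, e2]
  simp only [map_mul, map_inv]
  rw [mul_comm (φ w), mul_assoc, mul_inv_cancel, mul_one]

theorem agree_Gam_one_aux (hU : ∀ r, φ (U r) = 1) (hL : ∀ r, φ (L r) = 1) {x y : A}
    (hy' : ∀ M ∈ Gam y, Agree φ x M) {a b c d g : A} {h1}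
    (ha1 : x ^ 2 ∣ a - 1) (hg : y ∣ g * a - 1) : Agree φ x (mk a b (x ^ 2 * c) d h1) := by
  apply agree_of_L hL (g * (1 - c))
  obtain ⟨k, hk⟩ := hg
  obtain ⟨z, hz⟩ := ha1
  apply agree_of_U hU (-z)
  apply agree_of_L hL (-(c + g * (1 - c) * a))
  obtain ⟨k2, hk2⟩ : ∃ k2, a + -z * (x ^ 2 * c + x ^ 2 * (g * (1 - c)) * a) = 1 + y * k2 :=
    ⟨-z * x ^ 2 * (1 - c) * k, by linear_combination hz - z * x ^ 2 * (1 - c) * hk⟩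
  obtain ⟨a2, ha2⟩ : ∃ a2, a + -z * (x ^ 2 * c + x ^ 2 * (g * (1 - c)) * a) = a2 := ⟨_, rfl⟩
  simp only [ha2]
  rw [ha2] at hk2
  apply agree_of_U hU (-(b + -z * (d + x ^ 2 * (g * (1 - c)) * b)))
  apply hy'
  rw [mk_mem_Gam]
  have hc3 : y ∣ x ^ 2 * c + x ^ 2 * (g * (1 - c)) * a + x ^ 2 * -(c + g * (1 - c) * a) * a2 :=
    ⟨-x ^ 2 * (c + g * (1 - c) * a) * k2, by
      linear_combination (-x ^ 2 * (c + g * (1 - c) * a)) * hk2⟩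
  obtain ⟨b3, hb3⟩ : ∃ b3, b + -z * (d + x ^ 2 * (g * (1 - c)) * b) = b3 := ⟨_, rfl⟩
  rw [hb3]
  obtain ⟨c3, hc3'⟩ : ∃ c3, x ^ 2 * c + x ^ 2 * (g * (1 - c)) * a +
    x ^ 2 * -(c + g * (1 - c) * a) * a2 = c3 := ⟨_, rfl⟩
  obtain ⟨d3, hd3⟩ : ∃ d3, d + x ^ 2 * (g * (1 - c)) * b +
    x ^ 2 * -(c + g * (1 - c) * a) * b3 = d3 := ⟨_, rfl⟩
  have hdet : a2 * d3 - b3 * c3 = 1 := by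
    rw [← ha2, ← hd3, ← hc3', ← ha2, ← hb3]
    linear_combination h1
  rw [hc3'] at hc3 ⊢
  rw [hd3]
  obtain ⟨k3, rfl⟩ := hc3
  have hd4 : y ∣ d3 - 1 := ⟨b3 * k3 - k2 * d3, by linear_combination hdet - d3 * hk2⟩
  obtain ⟨k4, hk4⟩ := hd4
  exact ⟨⟨k2 - b3 * k3, by linear_combination hk2⟩, ⟨-b3 * k4, by linear_combination (-b3) * hk4⟩,
    ⟨k3, rfl⟩, ⟨k4, hk4⟩⟩

theorem agree_Gam_one (hU : ∀ r, φ (U r) = 1) (hL : ∀ r, φ (L r) = 1) {x y : A}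
    (hyfin : Finite (A ⧸ Ideal.span {y}))
    (hy' : ∀ M ∈ Gam y, Agree φ x M) {a b c d : A} {h}
    (ha : x ^ 2 ∣ a - 1) : Agree φ x (mk a b (x ^ 2 * c) d h) := by
  obtain ⟨t, g, hg⟩ := exists_unit_mod hyfin (a := a) (c := x ^ 2 * c)
    ⟨d, -b, by linear_combination h⟩
  apply agree_of_U hU t
  have ha1 : x ^ 2 ∣ (a + t * (x ^ 2 * c)) - 1 := by
    obtain ⟨k, hk⟩ := ha
    exact ⟨k + t * c, by linear_combination hk⟩
  exact agree_Gam_one_aux hU hL hy' ha1 hg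

theorem phi_mk_one (hU : ∀ r, φ (U r) = 1) (hL : ∀ r, φ (L r) = 1) {a c d : A} {h} :
    φ (mk a 1 c d h) = 1 := by
  have e : mk a 1 c d h = U 1 * L (-1) * U 1 * mk (-c) (-d) a 1 (by linear_combination h) := by
    simp only [U, L, mk_mul]
    apply mk_congr <;> ring
  have e2 : mk (-c) (-d) a 1 (by linear_combination h) = U (-d) * L a := by
    simp only [U, L, mk_mul]
    apply mk_congr <;> first | linear_combination h | ring
  rw [e, e2]
  simp [hU, hL]

/-- The multiplicativity of the symbol, one variable being a square. -/
theorem phi_mul_square (hU : ∀ r, φ (U r) = 1) (hL : ∀ r, φ (L r) = 1)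
    {u : Aˣ} {m : ℕ}
    (hNT : ∀ a B : A, IsCoprime a B → B ≠ 0 → ∀ l : ℕ, l.Prime →
      ∃ (t : A) (k : ℕ), ¬ l ∣ k ∧ a + t * B ∣ (u : A) ^ (m * k) - 1)
    (hm : 0 < m) (hu : ∀ n : ℕ, 0 < n → u ^ n ≠ 1)
    (hfin : ∀ a : A, a ≠ 0 → Finite (A ⧸ Ideal.span {a})) {x : A} (hx : x ≠ 0)
    {a b c d c' d' : A} (h : a * d - b * (x ^ 2 * c) = 1) (h' : a * d' - 1 * (x ^ 2 * c') = 1) :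
    φ (mk a (x ^ 2 * b) c d (by linear_combination h)) =
      φ (mk a (x ^ 2 * 1) c' d' (by linear_combination h')) * φ (mk a b (x ^ 2 * c) d h) := by
  obtain ⟨y0, hy0, hy0'⟩ := exists_level_L hL hNT hm hu hfin hx
  obtain ⟨y, hy, hy'⟩ := exists_level_D hU hx hy0 hy0'
  have hA : Agree φ x (mk a b (x ^ 2 * c) d h * (mk a 1 (x ^ 2 * c') d' h')⁻¹) := by
    have e : mk a b (x ^ 2 * c) d h * (mk a 1 (x ^ 2 * c') d' h')⁻¹ =
        mk (a * d' - x ^ 2 * c' * b) (b * a - a) (x ^ 2 * (c * d' - c' * d))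
          (d * a - x ^ 2 * c) (by
            linear_combination (a * d' - x ^ 2 * c') * h + h') := by
      simp only [mk_inv, mk_mul]
      apply mk_congr <;> ring
    rw [e]
    exact agree_Gam_one hU hL (hfin y hy) hy' ⟨c' * (1 - b), by linear_combination h'⟩
  have hR := (rel_XD h (by linear_combination h)).mul
    (rel_XD (x := x) h' (by linear_combination h')).inv
  have := hA _ hR
  simp only [map_mul, map_inv, phi_mk_one hU hL, inv_one, mul_one] at this
  rw [mul_inv_eq_iff_eq_mul] at this
  rw [this, mul_comm]
  simp only [mul_one]

end main
end SLTwo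

namespace SLTwo
open Matrix

section main
variable {A : Type*} [CommRing A] [IsDomain A] {Q : Type*} [CommGroup Q]
  {φ : (Matrix.SpecialLinearGroup (Fin 2) A) →* Q}

open Classical in
/-- The Mennicke-type symbol attached to `φ`. -/
noncomputable def beta (φ : (Matrix.SpecialLinearGroup (Fin 2) A) →* Q) (a b : A) : Q :=
  if h : ∃ M : Matrix.SpecialLinearGroup (Fin 2) A, M.1 0 0 = a ∧ M.1 0 1 = b then
    φ h.choose else 1

theorem phi_eq_beta (hL : ∀ r, φ (L r) = 1) {a b c d : A} (h) :
    φ (mk a b c d h) = beta φ a b := by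
  have hex : ∃ M : Matrix.SpecialLinearGroup (Fin 2) A, M.1 0 0 = a ∧ M.1 0 1 = b :=
    ⟨mk a b c d h, rfl, rfl⟩
  rw [beta, dif_pos hex]
  obtain ⟨a', b', c', d', h', hM⟩ := exists_mk hex.choose
  have hs := hex.choose_spec
  rw [hM] at hs ⊢
  obtain rfl : a' = a := hs.1
  obtain rfl : b' = b := hs.2
  exact phi_same_row hL

theorem beta_add_left (hL : ∀ r, φ (L r) = 1) {a b : A} (h : IsCoprime a b)
    (t : A) : beta φ (a + t * b) b = beta φ a b := by
  obtain ⟨p, q, hpq⟩ := h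
  have h1 : a * p - b * (-q) = 1 := by linear_combination hpq
  rw [← phi_eq_beta hL h1, ← mul_one (φ _), ← hL t, ← map_mul, mul_L, phi_eq_beta hL]

theorem beta_add_right (hU : ∀ r, φ (U r) = 1) (hL : ∀ r, φ (L r) = 1) {a b : A}
    (h : IsCoprime a b) (t : A) : beta φ a (b + t * a) = beta φ a b := by
  obtain ⟨p, q, hpq⟩ := h
  have h1 : a * p - b * (-q) = 1 := by linear_combination hpq
  rw [← phi_eq_beta hL h1, ← mul_one (φ _), ← hU t, ← map_mul, mul_U, phi_eq_beta hL]

theorem beta_one (hU : ∀ r, φ (U r) = 1) (hL : ∀ r, φ (L r) = 1) (a : A) : beta φ a 1 = 1 := by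
  rw [← phi_mk_one hU hL (a := a) (c := -1) (d := 0) (h := by ring), phi_eq_beta hL]

theorem beta_unit (hU : ∀ r, φ (U r) = 1) (hL : ∀ r, φ (L r) = 1) {a : A} (ha : IsUnit a)
    (b : A) : beta φ a b = 1 := by
  obtain ⟨g, hg⟩ := isUnit_iff_exists_inv'.mp ha
  have := beta_add_right hU hL (isCoprime_one_right (x := a)) ((b - 1) * g)
  rw [beta_one hU hL, mul_assoc, hg] at this
  rw [← this]; congr 1; ring

theorem beta_mul (hU : ∀ r, φ (U r) = 1) (hL : ∀ r, φ (L r) = 1)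
    {u : Aˣ} {m : ℕ}
    (hNT : ∀ a B : A, IsCoprime a B → B ≠ 0 → ∀ l : ℕ, l.Prime →
      ∃ (t : A) (k : ℕ), ¬ l ∣ k ∧ a + t * B ∣ (u : A) ^ (m * k) - 1)
    (hm : 0 < m) (hu : ∀ n : ℕ, 0 < n → u ^ n ≠ 1)
    (hfin : ∀ a : A, a ≠ 0 → Finite (A ⧸ Ideal.span {a})) {x a b : A}
    (hx : IsCoprime a x) (hb : IsCoprime a b) :
    beta φ a (x ^ 2 * b) = beta φ a (x ^ 2) * beta φ a b := by
  by_cases hx0 : x = 0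
  · subst hx0
    rw [isCoprime_zero_right] at hx
    simp [beta_unit hU hL hx]
  have h1 : IsCoprime a (x ^ 2 * b) := IsCoprime.mul_right (IsCoprime.pow_right hx) hb
  have h2 : IsCoprime a (x ^ 2) := IsCoprime.pow_right hx
  obtain ⟨p, q, hpq⟩ := h1
  obtain ⟨p', q', hpq'⟩ := h2
  have := phi_mul_square hU hL hNT hm hu hfin hx0 (a := a) (b := b) (c := -q) (d := p)
    (c' := -q') (d' := p') (by linear_combination hpq) (by linear_combination hpq')
  simp only [phi_eq_beta hL, mul_one] at this
  exact this

theorem beta_pow (hU : ∀ r, φ (U r) = 1) (hL : ∀ r, φ (L r) = 1)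
    {u : Aˣ} {m : ℕ}
    (hNT : ∀ a B : A, IsCoprime a B → B ≠ 0 → ∀ l : ℕ, l.Prime →
      ∃ (t : A) (k : ℕ), ¬ l ∣ k ∧ a + t * B ∣ (u : A) ^ (m * k) - 1)
    (hm : 0 < m) (hu : ∀ n : ℕ, 0 < n → u ^ n ≠ 1)
    (hfin : ∀ a : A, a ≠ 0 → Finite (A ⧸ Ideal.span {a})) {x a : A}
    (hx : IsCoprime a x) (n : ℕ) :
    beta φ a ((x ^ n) ^ 2) = beta φ a (x ^ 2) ^ n := by
  induction n with
  | zero => simp [beta_one hU hL]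
  | succ n ih =>
    rw [pow_succ' (beta φ a (x ^ 2)), ← ih,
      ← beta_mul hU hL hNT hm hu hfin hx (IsCoprime.pow_right (IsCoprime.pow_right hx))]
    congr 1; ring

theorem eq_one_of_forall_prime (g : Q)
    (h : ∀ l : ℕ, l.Prime → ∃ k : ℕ, ¬ l ∣ k ∧ g ^ k = 1) : g = 1 := by
  by_contra hg
  rw [← orderOf_eq_one_iff] at hg
  obtain ⟨l, hl, hlg⟩ := Nat.exists_prime_and_dvd hg
  obtain ⟨k, hk, hkg⟩ := h l hl
  exact hk (hlg.trans (orderOf_dvd_of_pow_eq_one hkg))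

/-- A homomorphism from `SL₂` to a commutative group that kills elementary matrices is trivial. -/
theorem phi_trivial (hU : ∀ r, φ (U r) = 1) (hL : ∀ r, φ (L r) = 1)
    {u : Aˣ} {m : ℕ}
    (hNT : ∀ a B : A, IsCoprime a B → B ≠ 0 → ∀ l : ℕ, l.Prime →
      ∃ (t : A) (k : ℕ), ¬ l ∣ k ∧ a + t * B ∣ (u : A) ^ (m * k) - 1)
    (hm : 0 < m) (hu : ∀ n : ℕ, 0 < n → u ^ n ≠ 1)
    (hfin : ∀ a : A, a ≠ 0 → Finite (A ⧸ Ideal.span {a}))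
    (hNT2 : ∀ a x : A, IsCoprime a x → ∀ l : ℕ, l.Prime →
      ∃ (s t : A) (k : ℕ), ¬ l ∣ k ∧ a + t * (x + s * a) ^ 2 ∣ (x + s * a) ^ k - 1) :
    φ = 1 := by
  have hsq : ∀ a c : A, IsCoprime a c → beta φ a (c ^ 2) = 1 := by
    intro a c hac
    apply eq_one_of_forall_prime
    intro l hl
    obtain ⟨s, t, k, hk, hdvd⟩ := hNT2 a c hac l hl
    refine ⟨k, hk, ?_⟩
    have h1 : IsCoprime a (c + s * a) := by
      have := hac.add_mul_left_right s
      rwa [mul_comm a s] at this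
    have e1 : beta φ a (c ^ 2) = beta φ a ((c + s * a) ^ 2) := by
      rw [← beta_add_right hU hL (IsCoprime.pow_right hac) (2 * c * s + s ^ 2 * a)]
      congr 1; ring
    have h2 : IsCoprime a ((c + s * a) ^ 2) := IsCoprime.pow_right h1
    have h3 : IsCoprime (a + t * (c + s * a) ^ 2) (c + s * a) := by
      have := (h1.symm.add_mul_left_right (t * (c + s * a))).symm
      convert this using 1; ring
    rw [e1, ← beta_add_left hL h2 t, ← beta_pow hU hL hNT hm hu hfin h3]
    obtain ⟨κ, hκ⟩ := hdvd
    generalize a + t * (c + s * a) ^ 2 = a' at *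
    have h4 : (c + s * a) ^ k = 1 + κ * a' := by linear_combination hκ
    have h5 : ((c + s * a) ^ k) ^ 2 = 1 + (2 * κ + κ ^ 2 * a') * a' := by rw [h4]; ring
    rw [h5, beta_add_right hU hL isCoprime_one_right, beta_one hU hL]
  ext M
  obtain ⟨a, b, c, d, h, rfl⟩ := exists_mk M
  rw [phi_eq_beta hL]
  have hab : IsCoprime a b := ⟨d, -c, by linear_combination h⟩
  obtain ⟨s, t, k, hk, hdvd⟩ := hNT2 a b hab 2 Nat.prime_two
  have h1 : IsCoprime a (b + s * a) := by
    have := hab.add_mul_left_right s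
    rwa [mul_comm a s] at this
  rw [← beta_add_right hU hL hab s]
  generalize b + s * a = b' at *
  have h3 : IsCoprime (a + t * b' ^ 2) b' := by
    have := (h1.symm.add_mul_left_right (t * b')).symm
    convert this using 1; ring
  have e1 : beta φ a b' = beta φ (a + t * b' ^ 2) b' := by
    rw [← beta_add_left hL h1 (t * b')]
    congr 1; ring
  rw [e1]
  generalize a + t * b' ^ 2 = a' at *
  obtain ⟨n, rfl⟩ : Odd k := by rwa [← Nat.not_even_iff_odd, even_iff_two_dvd]
  obtain ⟨κ, hκ⟩ := hdvd
  have := hsq a' (b' ^ (n + 1)) (IsCoprime.pow_right h3)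
  have e2 : (b' ^ (n + 1)) ^ 2 = b' + (κ * b') * a' := by
    linear_combination b' * hκ
  rw [e2, beta_add_right hU hL h3] at this
  simpa using this

/-- The abelianization of `SL₂ (A)` when homomorphisms killing elementary matrices are trivial. -/
theorem abelianization_of_trivial {A : Type} [CommRing A] [IsDomain A] {p : ℕ} [Fact p.Prime] [CharP A p] {u : Aˣ}
    (hu : (u : A) ^ 2 - 1 ≠ 0)
    (hfin : ∀ a : A, a ≠ 0 → Finite (A ⧸ Ideal.span {a}))
    (htriv : ∀ (Q : Type) [CommGroup Q] (φ : (Matrix.SpecialLinearGroup (Fin 2) A) →* Q),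
      (∀ r, φ (U r) = 1) → (∀ r, φ (L r) = 1) → φ = 1) :
    Finite (Abelianization (Matrix.SpecialLinearGroup (Fin 2) A)) ∧
      ∀ x : Abelianization (Matrix.SpecialLinearGroup (Fin 2) A), x ^ 6 = 1 := by
  let V := Abelianization (Matrix.SpecialLinearGroup (Fin 2) A)
  let ψ : Multiplicative A →* V :=
    { toFun := fun r => Abelianization.of (U r.toAdd)
      map_one' := by
        have : (U (0 : A)) = 1 := by rw [U, one_eq_mk]
        simp [this]
      map_mul' := fun r s => by rw [← map_mul, U_mul]; rfl }
  have hψ : ∀ r, ψ (Multiplicative.ofAdd r) = Abelianization.of (U r) := fun r => rfl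
  have hconj : ∀ (M N : Matrix.SpecialLinearGroup (Fin 2) A),
      Abelianization.of (N * M * N⁻¹) = Abelianization.of M := by
    intro M N
    rw [map_mul, map_mul, map_inv, mul_comm (Abelianization.of N), mul_inv_cancel_right]
  have hLU : ∀ r : A, Abelianization.of (L r) = ψ (Multiplicative.ofAdd (-r)) := by
    intro r
    rw [hψ, ← hconj _ (mk 0 1 (-1) 0 (by ring))]
    congr 1
    simp only [L, U, mk_inv, mk_mul]
    apply mk_congr <;> ring
  have hsurj : Function.Surjective ψ := by
    have h1 := htriv (V ⧸ ψ.range) ((QuotientGroup.mk' ψ.range).comp Abelianization.of)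
      (fun r => by
        simp only [MonoidHom.comp_apply, QuotientGroup.mk'_apply, QuotientGroup.eq_one_iff]
        exact ⟨_, hψ r⟩)
      (fun r => by
        simp only [MonoidHom.comp_apply, QuotientGroup.mk'_apply, QuotientGroup.eq_one_iff]
        exact ⟨_, (hLU r).symm⟩)
    intro x
    obtain ⟨M, rfl⟩ := QuotientGroup.mk_surjective x
    have := DFunLike.congr_fun h1 M
    simp only [MonoidHom.comp_apply, QuotientGroup.mk'_apply, MonoidHom.one_apply,
      QuotientGroup.eq_one_iff] at this
    exact this
  have hker : ∀ (v : Aˣ) (r : A), ψ (Multiplicative.ofAdd (((v : A) ^ 2 - 1) * r)) = 1 := by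
    intro v r
    have h1 := hconj (U r) (T v)
    rw [T_conj_U, ← hψ, ← hψ] at h1
    have : ((v : A) ^ 2 - 1) * r = v ^ 2 * r - r := by ring
    rw [this, ofAdd_sub, _root_.map_div, h1, div_self']
  have hadd : ∀ a b : A, ψ (Multiplicative.ofAdd (a + b)) =
      ψ (Multiplicative.ofAdd a) * ψ (Multiplicative.ofAdd b) := fun a b => by
    rw [ofAdd_add, map_mul]
  constructor
  · have := hfin _ hu
    let f : A ⧸ Ideal.span {(u : A) ^ 2 - 1} → V := fun z =>
      Quotient.liftOn' z (fun a => ψ (Multiplicative.ofAdd a)) (by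
        intro a b hab
        rw [Submodule.quotientRel_def, Ideal.mem_span_singleton] at hab
        obtain ⟨r, hr⟩ := hab
        have : a = b + ((u : A) ^ 2 - 1) * r := by rw [← hr]; ring
        simp only [this, hadd, hker, mul_one])
    refine Finite.of_surjective f ?_
    intro x
    obtain ⟨a, rfl⟩ := hsurj x
    exact ⟨Ideal.Quotient.mk _ a.toAdd, rfl⟩
  · intro x
    obtain ⟨a, rfl⟩ := hsurj x
    rw [← map_pow]
    by_cases h6 : p ∣ 6
    · have : a ^ 6 = Multiplicative.ofAdd ((6 : ℕ) * a.toAdd) := by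
        rw [← nsmul_eq_mul]; rfl
      rw [this, (CharP.cast_eq_zero_iff A p 6).mpr h6, zero_mul]
      simp
    · have hp : p.Prime := Fact.out
      have hunit : ∀ n : ℕ, ¬ p ∣ n → IsUnit (n : A) := by
        intro n hn
        have hc : IsCoprime (n : ℤ) (p : ℤ) :=
          Nat.isCoprime_iff_coprime.mpr ((hp.coprime_iff_not_dvd.mpr hn).symm)
        obtain ⟨r, s, hrs⟩ := hc
        refine isUnit_iff_exists_inv'.mpr ⟨(r : A), ?_⟩
        have := congrArg (Int.cast (R := A)) hrs
        push_cast at this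
        simpa using this
      obtain ⟨v, hv⟩ := hunit 2 (fun h => h6 (h.trans ⟨3, rfl⟩))
      obtain ⟨g, hg⟩ := isUnit_iff_exists_inv.mp (hunit 3 (fun h => h6 (h.trans ⟨2, rfl⟩)))
      have h1 := hker v (g * (a ^ 6).toAdd)
      have h2 : ((v : A) ^ 2 - 1) * (g * (a ^ 6).toAdd) = (a ^ 6).toAdd := by
        rw [hv]
        push_cast at hg ⊢
        linear_combination (a ^ 6).toAdd * hg
      rw [h2] at h1
      exact h1

end main
end SLTwo

namespace AbsPNT

open Finset

section formal
variable {P : Type*} {deg : P → ℕ}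

theorem le_degree_of_mem {s : Multiset P} {p : P} (h : p ∈ s) : deg p ≤ (s.map deg).sum :=
  Multiset.single_le_sum (by simp) _ (Multiset.mem_map_of_mem deg h)

/-- The effective divisors of degree `m`. -/
noncomputable def divs (hfin : ∀ m, {s : Multiset P | (s.map deg).sum = m}.Finite) (m : ℕ) : Finset (Multiset P) := (hfin m).toFinset

variable (hfin : ∀ m, {s : Multiset P | (s.map deg).sum = m}.Finite)

theorem mem_divs {m : ℕ} {s : Multiset P} : s ∈ divs hfin m ↔ (s.map deg).sum = m := by
  simp [divs]

theorem finite_le (hfin : ∀ m, {s : Multiset P | (s.map deg).sum = m}.Finite) (m : ℕ) : {p : P | deg p ≤ m}.Finite := by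
  have h1 : {s : Multiset P | (s.map deg).sum ≤ m}.Finite := by
    have : {s : Multiset P | (s.map deg).sum ≤ m} =
        ⋃ i ∈ Finset.range (m + 1), {s : Multiset P | (s.map deg).sum = i} := by
      ext s; simp
    rw [this]
    exact Set.Finite.biUnion (Finset.finite_toSet _) (fun i _ => hfin i)
  refine Set.Finite.of_finite_image (f := fun p => ({p} : Multiset P))
    (h1.subset ?_) (fun a _ b _ h => Multiset.singleton_inj.mp h)
  rintro _ ⟨p, hp, rfl⟩
  simpa using hp

/-- The primes of degree at most `m`. -/
noncomputable def primesLE (m : ℕ) : Finset P := (finite_le hfin m).toFinset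

theorem mem_primesLE {m : ℕ} {p : P} : p ∈ primesLE hfin m ↔ deg p ≤ m := by
  simp [primesLE]

/-- The coefficients of the Dirichlet series of the multiplicative function extending `f`. -/
noncomputable def aSeq (f : P → ℂ) (m : ℕ) : ℂ := ∑ s ∈ divs hfin m, (s.map f).prod

/-- The coefficients of its logarithmic derivative. -/
noncomputable def sSeq (f : P → ℂ) (j : ℕ) : ℂ :=
  ∑ p ∈ primesLE hfin j, ∑ i ∈ Icc 1 j, if i * deg p = j then (deg p : ℂ) * f p ^ i else 0

theorem sSeq_eq (hdeg : ∀ p, 0 < deg p) (f : P → ℂ) {j m : ℕ} (hjm : j ≤ m) :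
    sSeq hfin f j = ∑ p ∈ primesLE hfin m, ∑ i ∈ Icc 1 m,
      if i * deg p = j then (deg p : ℂ) * f p ^ i else 0 := by
  classical
  rw [sSeq]
  refine Finset.sum_subset_zero_on_sdiff ?_ ?_ ?_
  · intro p hp
    rw [mem_primesLE] at *; omega
  · intro p hp
    rw [Finset.mem_sdiff, mem_primesLE, mem_primesLE] at hp
    refine Finset.sum_eq_zero fun i hi => if_neg ?_
    rw [Finset.mem_Icc] at hi
    have := Nat.le_mul_of_pos_left (deg p) (show 0 < i by omega)
    omega
  · intro p hp
    refine Finset.sum_subset_zero_on_sdiff ?_ ?_ (fun _ _ => rfl)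
    · intro i hi; rw [Finset.mem_Icc] at *; omega
    · intro i hi
      refine if_neg ?_
      rw [Finset.mem_sdiff, Finset.mem_Icc, Finset.mem_Icc] at hi
      have := Nat.le_mul_of_pos_right i (hdeg p)
      omega

theorem sum_count [DecidableEq P] (f : P → ℂ) {m i : ℕ} (p : P) :
    (∑ s ∈ divs hfin m, if i ≤ s.count p then (s.map f).prod else 0) =
      if i * deg p ≤ m then f p ^ i * aSeq hfin f (m - i * deg p) else 0 := by
  split_ifs with h
  · rw [← Finset.sum_filter, aSeq, Finset.mul_sum]
    symm
    refine Finset.sum_bij' (fun t _ => t + Multiset.replicate i p)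
      (fun s _ => s - Multiset.replicate i p) ?_ ?_ ?_ ?_ ?_
    · intro t ht
      rw [mem_divs] at ht
      simp [mem_divs, ht, Nat.sub_add_cancel h]
    · intro s hs
      simp only [Finset.mem_filter, mem_divs, Multiset.le_count_iff_replicate_le] at hs
      obtain ⟨t, rfl⟩ := Multiset.le_iff_exists_add.mp hs.2
      simp only [Multiset.map_add, Multiset.sum_add, Multiset.map_replicate,
        Multiset.sum_replicate, smul_eq_mul] at hs
      rw [add_tsub_cancel_left, mem_divs]; omega
    · intro t ht; simp
    · intro s hs
      simp only [Finset.mem_filter, Multiset.le_count_iff_replicate_le] at hs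
      exact tsub_add_cancel_of_le hs.2
    · intro t ht
      simp [mul_comm]
  · refine Finset.sum_eq_zero fun s hs => if_neg fun h2 => h ?_
    rw [Multiset.le_count_iff_replicate_le] at h2
    rw [mem_divs] at hs
    obtain ⟨t, rfl⟩ := Multiset.le_iff_exists_add.mp h2
    simp only [Multiset.map_add, Multiset.sum_add, Multiset.map_replicate,
        Multiset.sum_replicate, smul_eq_mul] at hs
    omega

theorem degree_eq [DecidableEq P] (hdeg : ∀ p, 0 < deg p) {m : ℕ} {s : Multiset P}
    (hs : (s.map deg).sum = m) :
    (m : ℂ) = ∑ p ∈ primesLE hfin m, ∑ i ∈ Icc 1 m, if i ≤ s.count p then (deg p : ℂ) else 0 := by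
  have h1 : ∀ p ∈ primesLE hfin m, (∑ i ∈ Icc 1 m, if i ≤ s.count p then (deg p : ℂ) else 0) =
      (s.count p : ℂ) * deg p := by
    intro p _
    rw [← Finset.sum_filter, Finset.sum_const, nsmul_eq_mul]
    congr 2
    have hle : s.count p ≤ m := by
      have := Multiset.le_count_iff_replicate_le.mp (le_refl (s.count p))
      obtain ⟨t, ht⟩ := Multiset.le_iff_exists_add.mp this
      rw [ht] at hs
      simp only [Multiset.map_add, Multiset.sum_add, Multiset.map_replicate,
        Multiset.sum_replicate, smul_eq_mul] at hs
      have := Nat.le_mul_of_pos_right (s.count p) (hdeg p)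
      omega
    have : (Icc 1 m).filter (fun i => i ≤ s.count p) = Icc 1 (s.count p) := by
      ext i; simp; omega
    rw [this]; simp
  rw [Finset.sum_congr rfl h1]
  have h2 := Finset.sum_multiset_map_count s deg
  have h3 : (m : ℂ) = ∑ p ∈ s.toFinset, (s.count p : ℂ) * deg p := by
    rw [← hs, h2]; push_cast; simp
  rw [h3]
  refine Finset.sum_subset_zero_on_sdiff ?_ ?_ (fun _ _ => rfl)
  · intro p hp
    rw [mem_primesLE, ← hs]
    exact le_degree_of_mem (Multiset.mem_toFinset.mp hp)
  · intro p hp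
    rw [Finset.mem_sdiff, Multiset.mem_toFinset] at hp
    rw [Multiset.count_eq_zero_of_notMem hp.2]; simp

theorem mul_aSeq (hdeg : ∀ p, 0 < deg p) (f : P → ℂ) (m : ℕ) :
    (m : ℂ) * aSeq hfin f m = ∑ x ∈ antidiagonal m, sSeq hfin f x.1 * aSeq hfin f x.2 := by
  classical
  have h1 : (m : ℂ) * aSeq hfin f m = ∑ p ∈ primesLE hfin m, ∑ i ∈ Icc 1 m,
      if i * deg p ≤ m then (deg p : ℂ) * f p ^ i * aSeq hfin f (m - i * deg p) else 0 := by
    have h2 : (m : ℂ) * aSeq hfin f m = ∑ s ∈ divs hfin m, ∑ p ∈ primesLE hfin m, ∑ i ∈ Icc 1 m,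
        (deg p : ℂ) * if i ≤ s.count p then (s.map f).prod else 0 := by
      rw [aSeq, Finset.mul_sum]
      refine Finset.sum_congr rfl fun s hs => ?_
      rw [mem_divs] at hs
      nth_rewrite 1 [degree_eq hfin hdeg hs]
      simp only [Finset.sum_mul, ite_mul, zero_mul, mul_ite, mul_zero]
    rw [h2, Finset.sum_comm]
    refine Finset.sum_congr rfl fun p _ => ?_
    rw [Finset.sum_comm]
    refine Finset.sum_congr rfl fun i _ => ?_
    rw [← Finset.mul_sum, sum_count]
    split_ifs <;> ring
  rw [h1, Finset.Nat.sum_antidiagonal_eq_sum_range_succ_mk]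
  have h3 : ∀ j ∈ range m.succ, sSeq hfin f j * aSeq hfin f (m - j) =
      ∑ p ∈ primesLE hfin m, ∑ i ∈ Icc 1 m,
        if i * deg p = j then (deg p : ℂ) * f p ^ i * aSeq hfin f (m - i * deg p) else 0 := by
    intro j hj
    rw [sSeq_eq hfin hdeg f (show j ≤ m by simpa [Nat.lt_succ_iff] using hj)]
    simp only [Finset.sum_mul, ite_mul, zero_mul]
    refine Finset.sum_congr rfl fun p _ => Finset.sum_congr rfl fun i _ => ?_
    split_ifs with h
    · rw [h]
    · rfl
  rw [Nat.succ_eq_add_one] at h3 ⊢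
  have h4 := Finset.sum_congr (Eq.refl (range (m + 1))) h3
  rw [h4, Finset.sum_comm (s := range (m + 1))]
  refine Finset.sum_congr rfl fun p _ => ?_
  rw [Finset.sum_comm]
  refine Finset.sum_congr rfl fun i _ => ?_
  rw [Finset.sum_ite_eq]
  simp

theorem aSeq_zero (hdeg : ∀ p, 0 < deg p) (f : P → ℂ) : aSeq hfin f 0 = 1 := by
  have : divs hfin 0 = {0} := by
    ext s
    rw [mem_divs, Finset.mem_singleton]
    constructor
    · intro h
      refine Multiset.eq_zero_of_forall_notMem fun p hp => ?_
      have := le_degree_of_mem (deg := deg) hp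
      have := hdeg p
      omega
    · rintro rfl; simp
  simp [aSeq, this]

theorem sSeq_zero (f : P → ℂ) : sSeq hfin f 0 = 0 := by
  simp [sSeq]

end formal
end AbsPNT

namespace AbsPNT

open Finset Filter Topology

section analytic

/-- The value at `x` of a power series. -/
noncomputable def ev (φ : PowerSeries ℂ) (x : ℝ) : ℂ := ∑' m, PowerSeries.coeff m φ * (x : ℂ) ^ m

/-- Absolute convergence of a power series at `x`. -/
def Conv (φ : PowerSeries ℂ) (x : ℝ) : Prop :=
  Summable fun m => ‖PowerSeries.coeff m φ * (x : ℂ) ^ m‖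

theorem conv_coe (p : ℂ[X]) (x : ℝ) : Conv (p : PowerSeries ℂ) x := by
  refine summable_of_hasFiniteSupport (p.support.finite_toSet.subset fun m hm => ?_)
  rw [Function.mem_support] at hm
  simp only [Polynomial.coeff_coe] at hm
  rw [Finset.mem_coe, Polynomial.mem_support_iff]
  intro h; simp [h] at hm

theorem ev_coe (p : ℂ[X]) (x : ℝ) : ev (p : PowerSeries ℂ) x = p.eval (x : ℂ) := by
  rw [ev, Polynomial.eval_eq_sum, Polynomial.sum, tsum_eq_sum (s := p.support)]
  · simp
  · intro m hm
    rw [Polynomial.notMem_support_iff] at hm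
    simp [hm]

theorem conv_mul {φ ψ : PowerSeries ℂ} {x : ℝ} (h1 : Conv φ x) (h2 : Conv ψ x) :
    Conv (φ * ψ) x := by
  have := summable_norm_sum_mul_antidiagonal_of_summable_norm h1 h2
  refine this.congr fun m => ?_
  rw [PowerSeries.coeff_mul, Finset.sum_mul]
  congr 1
  refine Finset.sum_congr rfl fun y hy => ?_
  rw [← Finset.HasAntidiagonal.mem_antidiagonal.mp hy, pow_add]; ring

theorem ev_mul {φ ψ : PowerSeries ℂ} {x : ℝ} (h1 : Conv φ x) (h2 : Conv ψ x) :
    ev (φ * ψ) x = ev φ x * ev ψ x := by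
  rw [ev, ev, ev, tsum_mul_tsum_eq_tsum_sum_antidiagonal_of_summable_norm h1 h2]
  congr 1; ext m
  rw [PowerSeries.coeff_mul, Finset.sum_mul]
  refine Finset.sum_congr rfl fun y hy => ?_
  rw [← Finset.HasAntidiagonal.mem_antidiagonal.mp hy, pow_add]; ring

theorem conv_of_bound {φ : PowerSeries ℂ} {K : ℝ} (h : ∀ m : ℕ, ‖PowerSeries.coeff m φ‖ ≤ K * (m + 1))
    {x : ℝ} (hx0 : 0 ≤ x) (hx1 : x < 1) : Conv φ x := by
  have h1 : Summable fun m : ℕ => K * ((m : ℝ) ^ 1 * x ^ m + x ^ m) := by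
    refine Summable.mul_left _ (Summable.add ?_ (summable_geometric_of_lt_one hx0 hx1))
    exact summable_pow_mul_geometric_of_norm_lt_one 1 (by rwa [Real.norm_of_nonneg hx0])
  refine Summable.of_nonneg_of_le (fun m => norm_nonneg _) (fun m => ?_) h1
  rw [norm_mul, norm_pow, Complex.norm_real, Real.norm_of_nonneg hx0]
  calc _ ≤ (K * (m + 1)) * x ^ m := by gcongr; exact h m
    _ = _ := by ring

variable {a s : ℕ → ℂ} {N m0 : ℕ}

/-- The numerator of the rational function with eventually periodic coefficients `a`. -/
noncomputable def numer (a : ℕ → ℂ) (N m0 : ℕ) : ℂ[X] :=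
  PowerSeries.trunc (m0 + N) ((1 - PowerSeries.X ^ N) * PowerSeries.mk a)

theorem coeff_one_sub_mul (a : ℕ → ℂ) (N m : ℕ) :
    PowerSeries.coeff m ((1 - PowerSeries.X ^ N) * PowerSeries.mk a) =
      a m - if N ≤ m then a (m - N) else 0 := by
  rw [sub_mul, one_mul, map_sub, PowerSeries.coeff_mk, PowerSeries.coeff_X_pow_mul']
  simp

theorem numer_coe (hper : ∀ m, m0 ≤ m → a (m + N) = a m) :
    (numer a N m0 : PowerSeries ℂ) = (1 - PowerSeries.X ^ N) * PowerSeries.mk a := by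
  ext m
  rw [Polynomial.coeff_coe, numer, PowerSeries.coeff_trunc]
  split_ifs with h
  · rfl
  · rw [coeff_one_sub_mul, if_pos (by omega)]
    have := hper (m - N) (by omega)
    rw [Nat.sub_add_cancel (by omega)] at this
    rw [this, sub_self]

theorem numer_eval_one (a : ℕ → ℂ) (N m0 : ℕ) :
    (numer a N m0).eval 1 = ∑ i ∈ range N, a (m0 + i) := by
  have h1 : (numer a N m0).natDegree < m0 + N ∨ numer a N m0 = 0 := by
    rcases Nat.eq_zero_or_pos (m0 + N) with h | h
    · right; rw [numer, h]; simp
    · left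
      obtain ⟨n, hn⟩ := Nat.exists_eq_add_of_lt h
      rw [numer, hn, zero_add]; exact PowerSeries.natDegree_trunc_lt _ _
  have h2 : (numer a N m0).eval 1 = ∑ m ∈ range (m0 + N), (numer a N m0).coeff m := by
    rcases h1 with h1 | h1
    · rw [Polynomial.eval_eq_sum_range' h1]; simp
    · simp [h1]
  rw [h2]
  have h3 : ∀ m ∈ range (m0 + N), (numer a N m0).coeff m = a m - if N ≤ m then a (m - N) else 0 := by
    intro m hm
    rw [numer, PowerSeries.coeff_trunc, if_pos (by simpa using hm), coeff_one_sub_mul]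
  rw [Finset.sum_congr rfl h3, Finset.sum_sub_distrib]
  have h4 : (∑ m ∈ range (m0 + N), if N ≤ m then a (m - N) else 0) = ∑ m ∈ range m0, a m := by
    rw [add_comm m0 N, Finset.sum_range_add, Finset.sum_eq_zero, zero_add]
    · simp
    · intro m hm
      rw [if_neg (by simpa using hm)]
  rw [h4, Finset.sum_range_add]; ring

theorem numer_ne_zero (hN : 0 < N) (ha0 : a 0 = 1) : numer a N m0 ≠ 0 := by
  intro h
  have := congrArg (fun p => p.coeff 0) h
  simp only [numer, PowerSeries.coeff_trunc, if_pos (show 0 < m0 + N by omega), coeff_one_sub_mul,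
    if_neg (show ¬ N ≤ 0 by omega), ha0] at this
  simp at this

theorem logDeriv_identity (hper : ∀ m, m0 ≤ m → a (m + N) = a m)
    (hs : ∀ m : ℕ, (m : ℂ) * a m = ∑ x ∈ antidiagonal m, s x.1 * a x.2) (hN : 0 < N) :
    (((1 - X ^ N) * numer a N m0 : ℂ[X]) : PowerSeries ℂ) * PowerSeries.mk s =
      ((X * derivative (numer a N m0) * (1 - X ^ N) + (N : ℂ[X]) * X ^ N * numer a N m0 : ℂ[X]) :
        PowerSeries ℂ) := by
  have h1 : PowerSeries.X * PowerSeries.derivative (R := ℂ) (PowerSeries.mk a) =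
      PowerSeries.mk s * PowerSeries.mk a := by
    ext m
    have e0 : PowerSeries.coeff m (PowerSeries.mk s * PowerSeries.mk a) = (m : ℂ) * a m := by
      rw [PowerSeries.coeff_mul, hs m]
      refine Finset.sum_congr rfl fun y _ => ?_
      rw [PowerSeries.coeff_mk, PowerSeries.coeff_mk]
    rw [e0]
    cases m with
    | zero => rw [PowerSeries.coeff_zero_X_mul]; simp
    | succ n => rw [PowerSeries.coeff_succ_X_mul]; simp [PowerSeries.coeff_derivative, mul_comm]
  have h2 : ((derivative (numer a N m0) : ℂ[X]) : PowerSeries ℂ) =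
      PowerSeries.derivative (R := ℂ) ((1 - PowerSeries.X ^ N) * PowerSeries.mk a) := by
    rw [← numer_coe hper, PowerSeries.derivative_coe]
  obtain ⟨n, rfl⟩ : ∃ n, N = n + 1 := ⟨N - 1, by omega⟩
  push_cast
  rw [h2, numer_coe hper]
  simp only [Derivation.leibniz, map_sub, Derivation.leibniz_pow, smul_eq_mul,
    PowerSeries.derivative_X]
  have e1 : (PowerSeries.derivative (R := ℂ)) (1 : PowerSeries ℂ) = 0 := by simp
  rw [e1]
  simp only [nsmul_eq_mul, Nat.add_sub_cancel]
  push_cast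
  have e2 : ((n : ℂ[X]) : PowerSeries ℂ) = n := map_natCast (Polynomial.coeToPowerSeries.ringHom (R := ℂ)) n
  rw [e2]
  linear_combination (-(1 - PowerSeries.X ^ (n+1)) ^ 2) * h1

theorem tendsto_residue (hper : ∀ m, m0 ≤ m → a (m + N) = a m)
    (hs : ∀ m : ℕ, (m : ℂ) * a m = ∑ x ∈ antidiagonal m, s x.1 * a x.2) (hN : 0 < N)
    (ha0 : a 0 = 1) (hconv : ∀ x : ℝ, 0 ≤ x → x < 1 → Conv (PowerSeries.mk s) x) :
    Tendsto (fun x : ℝ => ((1 - x : ℝ) : ℂ) * ev (PowerSeries.mk s) x) (𝓝[<] 1)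
      (𝓝 (1 - ((numer a N m0).rootMultiplicity 1 : ℂ))) := by
  obtain ⟨R, hR, hR1⟩ := Polynomial.exists_eq_pow_rootMultiplicity_mul_and_not_dvd (numer a N m0)
    (numer_ne_zero hN ha0) 1
  set o := (numer a N m0).rootMultiplicity 1 with ho
  set E : ℂ[X] := ∑ i ∈ range N, X ^ i with hE
  have hE1 : (1 - X ^ N : ℂ[X]) = -((X - C 1) * E) := by
    rw [hE, map_one, mul_geom_sum]; ring
  have hEe : E.eval 1 = N := by simp [hE, Polynomial.eval_finsetSum]
  have hRe : R.eval 1 ≠ 0 := fun h => hR1 (Polynomial.dvd_iff_isRoot.mpr h)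
  have hD : (X - C 1) * derivative (numer a N m0) =
      (X - C 1) ^ o * ((o : ℂ[X]) * R + (X - C 1) * derivative R) := by
    rw [hR]
    rcases Nat.eq_zero_or_pos o with h | h
    · rw [h]; simp
    · obtain ⟨n, hn⟩ : ∃ n, o = n + 1 := ⟨o - 1, by omega⟩
      rw [hn, derivative_mul, derivative_X_sub_C_pow]
      simp only [Nat.add_sub_cancel, map_natCast]
      ring
  have hid := logDeriv_identity hper hs hN
  have key : ∀ x : ℝ, 0 ≤ x → x < 1 → ((1 - x : ℝ) : ℂ) * ev (PowerSeries.mk s) x *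
      (E * R).eval (x : ℂ) =
      ((N : ℂ[X]) * X ^ N * R - X * E * ((o : ℂ[X]) * R + (X - C 1) * derivative R)).eval (x : ℂ) := by
    intro x hx0 hx1
    have h1 := congrArg (fun φ => ev φ x) hid
    beta_reduce at h1
    rw [ev_mul (conv_coe _ _) (hconv x hx0 hx1), ev_coe, ev_coe] at h1
    have hxne : ((x : ℂ) - 1) ≠ 0 := by
      rw [sub_ne_zero]; exact_mod_cast hx1.ne
    have e1 : ((1 - X ^ N) * numer a N m0 : ℂ[X]) = (X - C 1) ^ o * (-(X - C 1) * (E * R)) := by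
      rw [hE1, hR]; ring
    have e2 : (X * derivative (numer a N m0) * (1 - X ^ N) + (N : ℂ[X]) * X ^ N * numer a N m0 : ℂ[X]) =
        (X - C 1) ^ o * ((N : ℂ[X]) * X ^ N * R - X * E * ((o : ℂ[X]) * R + (X - C 1) * derivative R)) := by
      rw [hE1]
      linear_combination (-(X * E)) * hD + (N : ℂ[X]) * X ^ N * hR
    rw [e1, e2, eval_mul, eval_mul (p := (X - C 1) ^ o), mul_assoc] at h1
    have h2 := mul_left_cancel₀ (by simpa using pow_ne_zero o hxne) h1
    rw [← h2]
    simp only [eval_mul, eval_neg, eval_sub, eval_X, eval_C]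
    push_cast; ring
  have hcont : ∀ p : ℂ[X], Tendsto (fun x : ℝ => p.eval (x : ℂ)) (𝓝[<] 1) (𝓝 (p.eval 1)) := by
    intro p
    have : Continuous fun x : ℝ => p.eval (x : ℂ) := p.continuous.comp Complex.continuous_ofReal
    have h := (this.tendsto 1).mono_left (nhdsWithin_le_nhds (s := Set.Iio 1))
    simpa using h
  have hERe : (E * R).eval 1 ≠ 0 := by
    rw [eval_mul, hEe]; exact mul_ne_zero (by exact_mod_cast hN.ne') hRe
  have hlim := (hcont ((N : ℂ[X]) * X ^ N * R -
    X * E * ((o : ℂ[X]) * R + (X - C 1) * derivative R))).div (hcont (E * R)) hERe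
  have hval : ((N : ℂ[X]) * X ^ N * R - X * E * ((o : ℂ[X]) * R + (X - C 1) * derivative R)).eval 1 /
      (E * R).eval 1 = 1 - (o : ℂ) := by
    rw [div_eq_iff hERe]
    simp only [eval_mul, eval_sub, eval_add, eval_X, eval_C, eval_pow, hEe, eval_natCast]
    ring
  rw [hval] at hlim
  refine hlim.congr' ?_
  have h0 : ∀ᶠ x : ℝ in 𝓝[<] 1, 0 ≤ x :=
    (eventually_ge_nhds (show (0 : ℝ) < 1 by norm_num)).filter_mono nhdsWithin_le_nhds
  have h1 : ∀ᶠ x : ℝ in 𝓝[<] 1, x < 1 := eventually_mem_nhdsWithin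
  have h2 : ∀ᶠ x : ℝ in 𝓝[<] 1, (E * R).eval (x : ℂ) ≠ 0 := (hcont _).eventually_ne hERe
  filter_upwards [h0, h1, h2] with x hx0 hx1 hx2
  rw [Pi.div_apply, ← key x hx0 hx1, mul_div_cancel_right₀ _ hx2]

theorem rootMultiplicity_eq_zero_iff (hN : 0 < N) (ha0 : a 0 = 1) :
    (numer a N m0).rootMultiplicity 1 = 0 ↔ ∑ i ∈ range N, a (m0 + i) ≠ 0 := by
  rw [← numer_eval_one, ← not_iff_not, not_not, ← ne_eq, ← Nat.pos_iff_ne_zero,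
    Polynomial.rootMultiplicity_pos (numer_ne_zero hN ha0), IsRoot.def]

end analytic
end AbsPNT

namespace AbsPNT

open Finset Filter Topology

/-- Effective divisors with a degree and a class, equidistributed in the classes
of a finite group. -/
structure ClassData (P G : Type*) [AddCommGroup G] where
  /-- the degree of a prime -/
  deg : P → ℕ
  /-- the class of a prime -/
  cl : P → G
  /-- the size of the constant field -/
  q : ℝ
  /-- the density of a class -/
  C : ℝ
  /-- the period -/
  N : ℕ
  /-- the bound beyond which the count is exact -/
  m0 : ℕ
  /-- the degree of a class -/
  δ : G → ZMod N
  deg_pos : ∀ p, 0 < deg p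
  one_lt_q : 1 < q
  C_pos : 0 < C
  N_pos : 0 < N
  hfin : ∀ m, {s : Multiset P | (s.map deg).sum = m}.Finite
  count : ∀ m, m0 ≤ m → ∀ g, ({s : Multiset P | (s.map deg).sum = m ∧ (s.map cl).sum = g}.ncard : ℝ) =
    if (m : ZMod N) = δ g then C * q ^ m else 0

namespace ClassData

variable {P G : Type*} [AddCommGroup G] (D : ClassData P G)

/-- The local factor of a character at a prime. -/
noncomputable def f (χ : AddChar G ℂ) (p : P) : ℂ := χ (D.cl p) * ((D.q : ℂ)⁻¹) ^ D.deg p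

/-- The coefficients of the `L`-series of a character. -/
noncomputable def a (χ : AddChar G ℂ) (m : ℕ) : ℂ := aSeq D.hfin (D.f χ) m

/-- The coefficients of its logarithmic derivative. -/
noncomputable def s (χ : AddChar G ℂ) (m : ℕ) : ℂ := sSeq D.hfin (D.f χ) m

theorem prod_f (χ : AddChar G ℂ) (t : Multiset P) :
    (t.map (D.f χ)).prod = χ (t.map D.cl).sum * ((D.q : ℂ)⁻¹) ^ (t.map D.deg).sum := by
  induction t using Multiset.induction with
  | empty => simp
  | cons p t ih =>
    simp only [Multiset.map_cons, Multiset.prod_cons, Multiset.sum_cons, ih, f,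
      AddChar.map_add_eq_mul, pow_add]
    ring

theorem q_ne : (D.q : ℂ) ≠ 0 := by
  have := D.one_lt_q
  exact_mod_cast (by linarith : D.q ≠ 0)

theorem s_eq (χ : AddChar G ℂ) (j : ℕ) : D.s χ j =
    ∑ p ∈ primesLE D.hfin j, ∑ i ∈ Icc 1 j, if i * D.deg p = j then
      ((D.deg p * (D.q⁻¹) ^ j : ℝ) : ℂ) * χ (i • D.cl p) else 0 := by
  rw [s, sSeq]
  refine Finset.sum_congr rfl fun p _ => Finset.sum_congr rfl fun i _ => ?_
  split_ifs with h
  · rw [f, mul_pow, ← pow_mul, mul_comm (D.deg p), h, AddChar.map_nsmul_eq_pow]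
    push_cast; ring
  · rfl

variable [Fintype G]

theorem a_eq (χ : AddChar G ℂ) {m : ℕ} (hm : D.m0 ≤ m) :
    D.a χ m = (D.C : ℂ) * ∑ g, if (m : ZMod D.N) = D.δ g then χ g else 0 := by
  classical
  have h1 : D.a χ m = ∑ g, ∑ t ∈ (divs D.hfin m).filter (fun t => (t.map D.cl).sum = g),
      χ g * ((D.q : ℂ)⁻¹) ^ m := by
    rw [a, aSeq, ← Finset.sum_fiberwise _ (fun t : Multiset P => (t.map D.cl).sum)]
    refine Finset.sum_congr rfl fun g _ => Finset.sum_congr rfl fun t ht => ?_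
    rw [Finset.mem_filter, mem_divs] at ht
    rw [prod_f, ht.1, ht.2]
  rw [h1, Finset.mul_sum]
  refine Finset.sum_congr rfl fun g _ => ?_
  have h2 : (((divs D.hfin m).filter (fun t => (t.map D.cl).sum = g)).card : ℝ) =
      if (m : ZMod D.N) = D.δ g then D.C * D.q ^ m else 0 := by
    rw [← D.count m hm g, ← Set.ncard_coe_finset]
    congr 2
    ext t
    simp [mem_divs]
  have h3 : (((divs D.hfin m).filter (fun t => (t.map D.cl).sum = g)).card : ℂ) =
      if (m : ZMod D.N) = D.δ g then D.C * (D.q : ℂ) ^ m else 0 := by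
    rw [← Complex.ofReal_natCast, h2]
    split_ifs <;> push_cast <;> rfl
  rw [Finset.sum_const, nsmul_eq_mul, h3]
  split_ifs
  · have := D.q_ne
    rw [mul_comm (χ g), ← mul_assoc, inv_pow, mul_assoc (D.C : ℂ),
      mul_inv_cancel₀ (pow_ne_zero _ this), mul_one]
  · simp

theorem a_per (χ : AddChar G ℂ) (m : ℕ) (hm : D.m0 ≤ m) : D.a χ (m + D.N) = D.a χ m := by
  rw [a_eq D χ hm, a_eq D χ (by omega)]; simp

theorem a_sum (χ : AddChar G ℂ) :
    ∑ i ∈ range D.N, D.a χ (D.m0 + i) = (D.C : ℂ) * ∑ g, χ g := by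
  have : NeZero D.N := ⟨D.N_pos.ne'⟩
  rw [Finset.sum_congr rfl fun i _ => D.a_eq χ (Nat.le_add_right D.m0 i), ← Finset.mul_sum,
    Finset.sum_comm]
  congr 1
  refine Finset.sum_congr rfl fun g _ => ?_
  rw [Finset.sum_eq_single (D.δ g - (D.m0 : ZMod D.N)).val]
  · rw [if_pos]; push_cast; rw [ZMod.natCast_zmod_val]; ring
  · intro i hi hne
    refine if_neg fun h => hne ?_
    rw [← h]
    push_cast
    rw [add_sub_cancel_left, ZMod.val_natCast, Nat.mod_eq_of_lt (by simpa using hi)]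
  · intro h
    exact absurd (by simpa using ZMod.val_lt _) h

theorem a_zero (χ : AddChar G ℂ) : D.a χ 0 = 1 := aSeq_zero _ D.deg_pos _

theorem mul_a (χ : AddChar G ℂ) (m : ℕ) :
    (m : ℂ) * D.a χ m = ∑ x ∈ antidiagonal m, D.s χ x.1 * D.a χ x.2 := mul_aSeq _ D.deg_pos _ _

theorem a_bound (χ : AddChar G ℂ) : ∃ K : ℝ, 0 ≤ K ∧ ∀ m, ‖D.a χ m‖ ≤ K := by
  refine ⟨(∑ m ∈ range (D.m0), ‖D.a χ m‖) + D.C * Fintype.card G, ?_, fun m => ?_⟩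
  · have := D.C_pos
    positivity
  have h0 : 0 ≤ ∑ m ∈ range (D.m0), ‖D.a χ m‖ := by positivity
  rcases lt_or_ge m D.m0 with h | h
  · have h1 := Finset.single_le_sum (f := fun m => ‖D.a χ m‖) (fun i _ => norm_nonneg _)
      (Finset.mem_range.mpr h)
    have : 0 ≤ D.C * Fintype.card G := by have := D.C_pos; positivity
    beta_reduce at h1
    linarith
  · rw [a_eq D χ h, norm_mul, Complex.norm_real, Real.norm_of_nonneg D.C_pos.le]
    have : ‖∑ g, if (m : ZMod D.N) = D.δ g then χ g else 0‖ ≤ Fintype.card G := by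
      refine (norm_sum_le _ _).trans ?_
      rw [Fintype.card, Finset.cast_card]
      refine Finset.sum_le_sum fun g _ => ?_
      split_ifs
      · rw [AddChar.norm_apply]
      · simp
    have := mul_le_mul_of_nonneg_left this D.C_pos.le
    linarith

/-- The coefficients of the logarithmic derivative of the zeta function. -/
noncomputable def σ (j : ℕ) : ℝ := ∑ p ∈ primesLE D.hfin j, ∑ i ∈ Icc 1 j, if i * D.deg p = j then
      (D.deg p * (D.q⁻¹) ^ j : ℝ) else 0

theorem s_zero_char (j : ℕ) : D.s 0 j = (D.σ j : ℂ) := by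
  rw [s_eq, σ]; push_cast
  refine Finset.sum_congr rfl fun p _ => Finset.sum_congr rfl fun i _ => ?_
  split_ifs <;> simp

theorem term_nonneg (p : P) (j : ℕ) : 0 ≤ (D.deg p * (D.q⁻¹) ^ j : ℝ) := by
  have := D.one_lt_q; positivity

theorem norm_s_le (χ : AddChar G ℂ) (j : ℕ) : ‖D.s χ j‖ ≤ D.σ j := by
  rw [s_eq, σ]
  refine norm_sum_le_of_le _ fun p _ => norm_sum_le_of_le _ fun i _ => ?_
  split_ifs
  · rw [norm_mul, AddChar.norm_apply, mul_one, Complex.norm_real,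
      Real.norm_of_nonneg (D.term_nonneg _ _)]
  · simp

open ComplexOrder

theorem a_zero_char_nonneg (m : ℕ) : 0 ≤ D.a 0 m := by
  rw [a, aSeq]
  refine Finset.sum_nonneg fun t _ => ?_
  rw [prod_f, AddChar.zero_apply, one_mul]
  have : 0 ≤ (D.q : ℂ)⁻¹ := by
    rw [← Complex.ofReal_inv]
    have := D.one_lt_q
    exact Complex.zero_le_real.mpr (by positivity)
  exact pow_nonneg this _

theorem σ_nonneg (j : ℕ) : 0 ≤ D.σ j := by
  refine Finset.sum_nonneg fun p _ => Finset.sum_nonneg fun i _ => ?_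
  split_ifs
  · exact D.term_nonneg _ _
  · rfl

theorem σ_bound : ∃ K : ℝ, ∀ m : ℕ, D.σ m ≤ K * (m + 1) := by
  obtain ⟨K, hK0, hK⟩ := D.a_bound 0
  refine ⟨K, fun m => ?_⟩
  have hmem : (m, 0) ∈ antidiagonal m := HasAntidiagonal.mem_antidiagonal.mpr (add_zero m)
  have hnn : ∀ x ∈ antidiagonal m, 0 ≤ D.s 0 x.1 * D.a 0 x.2 := fun x _ => by
    refine mul_nonneg ?_ (D.a_zero_char_nonneg _)
    rw [s_zero_char]; exact Complex.zero_le_real.mpr (D.σ_nonneg _)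
  have h1 := Finset.single_le_sum (f := fun x : ℕ × ℕ => (D.s 0 x.1 * D.a 0 x.2).re)
    (fun x hx => (Complex.le_def.mp (hnn x hx)).1) hmem
  beta_reduce at h1
  have e1 : D.s 0 m * D.a 0 0 = (D.σ m : ℂ) := by rw [a_zero, mul_one, s_zero_char]
  have h4 : D.σ m ≤ ((m : ℂ) * D.a 0 m).re := by
    rw [mul_a, Complex.re_sum]
    rw [e1, Complex.ofReal_re] at h1
    exact h1
  have h3 : ((m : ℂ) * D.a 0 m).re ≤ m * K := by
    refine (Complex.re_le_norm _).trans ?_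
    rw [norm_mul, Complex.norm_natCast]
    exact mul_le_mul_of_nonneg_left (hK m) (Nat.cast_nonneg m)
  calc D.σ m ≤ m * K := h4.trans h3
    _ ≤ K * (m + 1) := by rw [mul_comm]; gcongr; simp

theorem conv_s (χ : AddChar G ℂ) (x : ℝ) (hx0 : 0 ≤ x) (hx1 : x < 1) :
    Conv (PowerSeries.mk (D.s χ)) x := by
  obtain ⟨K, hK⟩ := D.σ_bound
  refine conv_of_bound (K := K) (fun m => ?_) hx0 hx1
  rw [PowerSeries.coeff_mk]
  exact (D.norm_s_le χ m).trans (hK m)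

theorem conv_a (χ : AddChar G ℂ) (x : ℝ) (hx0 : 0 ≤ x) (hx1 : x < 1) :
    Conv (PowerSeries.mk (D.a χ)) x := by
  obtain ⟨K, hK0, hK⟩ := D.a_bound χ
  refine conv_of_bound (K := K) (fun m => ?_) hx0 hx1
  rw [PowerSeries.coeff_mk]
  have := hK m
  nlinarith [Nat.cast_nonneg (α := ℝ) m]

/-- The order of vanishing at `1`. -/
noncomputable def ord (χ : AddChar G ℂ) : ℕ := (numer (D.a χ) D.N D.m0).rootMultiplicity 1

theorem tendsto_s (χ : AddChar G ℂ) :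
    Tendsto (fun x : ℝ => ((1 - x : ℝ) : ℂ) * ev (PowerSeries.mk (D.s χ)) x) (𝓝[<] 1)
      (𝓝 (1 - (D.ord χ : ℂ))) :=
  tendsto_residue (D.a_per χ) (D.mul_a χ) D.N_pos (D.a_zero χ) (D.conv_s χ)

theorem ord_eq_zero_iff (χ : AddChar G ℂ) : D.ord χ = 0 ↔ χ = 0 := by
  classical
  rw [ord, rootMultiplicity_eq_zero_iff D.N_pos (D.a_zero χ), a_sum, AddChar.sum_eq_ite]
  have hC : (D.C : ℂ) ≠ 0 := by exact_mod_cast D.C_pos.ne'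
  split_ifs with h <;> simp [h, hC]

end ClassData
end AbsPNT

namespace AbsPNT
namespace ClassData

open Finset Filter Topology

variable {P G : Type*} [AddCommGroup G] (D : ClassData P G) [Fintype G]

theorem re_ev {φ : PowerSeries ℂ} {x : ℝ} (h : Conv φ x) :
    (ev φ x).re = ∑' m, (PowerSeries.coeff m φ).re * x ^ m := by
  rw [ev, Complex.re_tsum h.of_norm]
  congr 1; ext m
  rw [← Complex.ofReal_pow, Complex.re_mul_ofReal]

theorem tendsto_re_s (χ : AddChar G ℂ) :
    Tendsto (fun x : ℝ => (1 - x) * (ev (PowerSeries.mk (D.s χ)) x).re) (𝓝[<] 1)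
      (𝓝 (1 - (D.ord χ : ℝ))) := by
  have h := (Complex.continuous_re.tendsto _).comp (D.tendsto_s χ)
  have e : (1 - (D.ord χ : ℂ)).re = 1 - (D.ord χ : ℝ) := by simp
  rw [e] at h
  refine h.congr fun x => ?_
  simp only [Function.comp]
  rw [Complex.re_ofReal_mul]

theorem eventually_Ico : ∀ᶠ x : ℝ in 𝓝[<] 1, 0 ≤ x ∧ x < 1 :=
  ((eventually_ge_nhds (show (0 : ℝ) < 1 by norm_num)).filter_mono nhdsWithin_le_nhds).and
    eventually_mem_nhdsWithin

theorem re_s_nonneg (χ : AddChar G ℂ) (j : ℕ) :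
    0 ≤ 3 * (D.s 0 j).re + 4 * (D.s χ j).re + (D.s (χ * χ) j).re := by
  rw [s_eq, s_eq, s_eq]
  simp only [Complex.re_sum, Finset.mul_sum]
  rw [← Finset.sum_add_distrib, ← Finset.sum_add_distrib]
  refine Finset.sum_nonneg fun p _ => ?_
  rw [← Finset.sum_add_distrib, ← Finset.sum_add_distrib]
  refine Finset.sum_nonneg fun i _ => ?_
  split_ifs
  · rw [Complex.re_ofReal_mul, Complex.re_ofReal_mul, Complex.re_ofReal_mul, AddChar.mul_apply,
      AddChar.zero_apply]
    have h1 := D.term_nonneg p j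
    have h2 := AddChar.norm_apply χ (i • D.cl p)
    set z := χ (i • D.cl p)
    have h3 : z.re ^ 2 + z.im ^ 2 = 1 := by
      have := Complex.sq_norm z
      rw [h2, Complex.normSq_apply] at this; linarith
    have h4 : (z * z).re = 2 * z.re ^ 2 - 1 := by
      rw [Complex.mul_re]; linarith
    rw [h4, Complex.one_re]
    have : 0 ≤ (D.deg p * (D.q⁻¹) ^ j : ℝ) * (2 * (1 + z.re) ^ 2) := by positivity
    linarith
  · simp

theorem ord_le (χ : AddChar G ℂ) : 4 * D.ord χ + D.ord (χ * χ) ≤ 7 + if χ = 0 then 0 else 1 := by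
  have h0 := (D.ord_eq_zero_iff 0).mpr rfl
  split_ifs with hχ
  · subst hχ
    have : (0 : AddChar G ℂ) * 0 = 0 := by rw [← AddChar.one_eq_zero, mul_one]
    rw [this, h0]; norm_num
  have h := ((D.tendsto_re_s 0).const_mul 3).add ((D.tendsto_re_s χ).const_mul 4) |>.add
    (D.tendsto_re_s (χ * χ))
  have h2 := ge_of_tendsto (b := 0) h (by
    filter_upwards [eventually_Ico] with x hx
    rw [re_ev (D.conv_s _ x hx.1 hx.2), re_ev (D.conv_s _ x hx.1 hx.2),
      re_ev (D.conv_s _ x hx.1 hx.2)]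
    have hs : ∀ χ : AddChar G ℂ,
        Summable fun m => (PowerSeries.coeff m (PowerSeries.mk (D.s χ))).re * x ^ m := fun χ => by
      have := Complex.hasSum_re (D.conv_s χ x hx.1 hx.2).of_norm.hasSum
      refine this.summable.congr fun m => ?_
      rw [← Complex.ofReal_pow, Complex.re_mul_ofReal]
    have e : 0 ≤ ∑' m, (3 * ((PowerSeries.coeff m (PowerSeries.mk (D.s 0))).re * x ^ m) +
      4 * ((PowerSeries.coeff m (PowerSeries.mk (D.s χ))).re * x ^ m) +
      (PowerSeries.coeff m (PowerSeries.mk (D.s (χ * χ)))).re * x ^ m) := by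
      refine tsum_nonneg fun m => ?_
      simp only [PowerSeries.coeff_mk]
      have := mul_nonneg (D.re_s_nonneg χ m) (pow_nonneg hx.1 m)
      linarith
    rw [Summable.tsum_add (((hs 0).mul_left 3).add ((hs χ).mul_left 4)) (hs _),
      Summable.tsum_add ((hs 0).mul_left 3) ((hs χ).mul_left 4), tsum_mul_left, tsum_mul_left] at e
    have := mul_nonneg (sub_nonneg.mpr hx.2.le) e
    linarith)
  rw [h0] at h2
  have h3 : ((4 * D.ord χ + D.ord (χ * χ) : ℕ) : ℝ) ≤ (7 + 1 : ℕ) := by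
    push_cast; push_cast at h2; linarith
  exact_mod_cast h3

theorem exists_prime (D : ClassData P G) : Nonempty P := by
  have : NeZero D.N := ⟨D.N_pos.ne'⟩
  by_contra hP
  rw [not_nonempty_iff] at hP
  set m := (D.δ 0).val + D.N * (D.m0 + 1) with hm
  have hmm : D.m0 + 1 ≤ m := by
    have := Nat.le_mul_of_pos_left (D.m0 + 1) D.N_pos
    omega
  have h1 := D.count m (by omega) 0
  rw [if_pos (by rw [hm]; push_cast; simp)] at h1
  have h2 : {s : Multiset P | (s.map D.deg).sum = m ∧ (s.map D.cl).sum = 0} = ∅ := by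
    ext s
    simp only [Set.mem_ofPred_eq, Set.mem_empty_iff_false, iff_false, not_and]
    intro h
    rw [Multiset.eq_zero_of_forall_notMem (s := s) (fun p _ => hP.elim p)] at h
    simp at h; omega
  rw [h2, Set.ncard_empty, Nat.cast_zero] at h1
  have := D.C_pos
  have := D.one_lt_q
  have : 0 < D.C * D.q ^ m := by positivity
  linarith

open ComplexOrder

theorem ord_ne_two {χ : AddChar G ℂ} (hχ : χ * χ = 0) : D.ord χ ≠ 2 := by
  intro ho
  have hreal : ∀ g, 0 ≤ 1 + χ g := by
    intro g
    have : χ g * χ g = 1 := by rw [← AddChar.mul_apply, hχ, AddChar.zero_apply]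
    rcases mul_self_eq_one_iff.mp this with h | h <;> rw [h]
    · rw [one_add_one_eq_two]; exact zero_le_two
    · simp
  have hτ : ∀ j, 0 ≤ D.s 0 j + D.s χ j := by
    intro j
    rw [s_eq, s_eq, ← Finset.sum_add_distrib]
    refine Finset.sum_nonneg fun p _ => ?_
    rw [← Finset.sum_add_distrib]
    refine Finset.sum_nonneg fun i _ => ?_
    split_ifs
    · rw [← mul_add, AddChar.zero_apply]
      exact mul_nonneg (Complex.zero_le_real.mpr (D.term_nonneg _ _)) (hreal _)
    · simp
  set B : PowerSeries ℂ := PowerSeries.mk (D.a 0) * PowerSeries.mk (D.a χ) with hB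
  set b : ℕ → ℂ := fun m => PowerSeries.coeff m B with hb
  have hder : ∀ ψ : AddChar G ℂ, PowerSeries.X * PowerSeries.derivative (R := ℂ) (PowerSeries.mk (D.a ψ)) =
      PowerSeries.mk (D.s ψ) * PowerSeries.mk (D.a ψ) := by
    intro ψ
    ext m
    have e0 : PowerSeries.coeff m (PowerSeries.mk (D.s ψ) * PowerSeries.mk (D.a ψ)) =
        (m : ℂ) * D.a ψ m := by
      rw [PowerSeries.coeff_mul, D.mul_a ψ m]
      refine Finset.sum_congr rfl fun y _ => ?_
      rw [PowerSeries.coeff_mk, PowerSeries.coeff_mk]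
    rw [e0]
    cases m with
    | zero => rw [PowerSeries.coeff_zero_X_mul]; simp
    | succ n => rw [PowerSeries.coeff_succ_X_mul]; simp [PowerSeries.coeff_derivative, mul_comm]
  have hrec : ∀ m : ℕ, (m : ℂ) * b m = ∑ x ∈ antidiagonal m, (D.s 0 x.1 + D.s χ x.1) * b x.2 := by
    intro m
    have h1 : PowerSeries.X * PowerSeries.derivative (R := ℂ) B =
        PowerSeries.mk (fun j => D.s 0 j + D.s χ j) * B := by
      have h2 : PowerSeries.mk (fun j => D.s 0 j + D.s χ j) =
          PowerSeries.mk (D.s 0) + PowerSeries.mk (D.s χ) := by ext; simp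
      rw [h2, hB, Derivation.leibniz, smul_eq_mul, smul_eq_mul]
      linear_combination PowerSeries.mk (D.a χ) * hder 0 + PowerSeries.mk (D.a 0) * hder χ
    have h3 := congrArg (PowerSeries.coeff m) h1
    rw [PowerSeries.coeff_mul m (PowerSeries.mk _)] at h3
    have h4 : PowerSeries.coeff m (PowerSeries.X * PowerSeries.derivative (R := ℂ) B) = m * b m := by
      cases m with
      | zero => rw [PowerSeries.coeff_zero_X_mul]; simp
      | succ n => rw [PowerSeries.coeff_succ_X_mul]; simp [PowerSeries.coeff_derivative, hb, mul_comm]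
    rw [h4] at h3
    rw [h3]
    refine Finset.sum_congr rfl fun y _ => ?_
    rw [PowerSeries.coeff_mk]
  have hb0 : b 0 = 1 := by
    simp only [hb, hB]
    rw [PowerSeries.coeff_mul]; simp [a_zero]
  have hbnn : ∀ m, 0 ≤ b m := by
    intro m
    induction m using Nat.strong_induction_on with
    | _ m ih =>
      rcases Nat.eq_zero_or_pos m with rfl | hm
      · rw [hb0]; exact zero_le_one
      have h1 : b m = (m : ℂ)⁻¹ * ∑ x ∈ antidiagonal m, (D.s 0 x.1 + D.s χ x.1) * b x.2 := by
        rw [← hrec, inv_mul_cancel_left₀ (by exact_mod_cast hm.ne')]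
      rw [h1]
      refine mul_nonneg ?_ (Finset.sum_nonneg fun x hx => ?_)
      · rw [← Complex.ofReal_natCast, ← Complex.ofReal_inv]
        exact Complex.zero_le_real.mpr (by positivity)
      · rcases Nat.eq_zero_or_pos x.1 with h | h
        · have : D.s 0 x.1 + D.s χ x.1 = 0 := by rw [h, s, s, sSeq_zero, sSeq_zero, add_zero]
          rw [this, zero_mul]
        · exact mul_nonneg (hτ _) (ih _ (by
            have := HasAntidiagonal.mem_antidiagonal.mp hx; omega))
  have hble : ∀ m : ℕ, (D.s 0 m + D.s χ m).re ≤ m * (b m).re := by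
    intro m
    have hmem : (m, 0) ∈ antidiagonal m := HasAntidiagonal.mem_antidiagonal.mpr (add_zero m)
    have h1 := Finset.single_le_sum (f := fun x : ℕ × ℕ => ((D.s 0 x.1 + D.s χ x.1) * b x.2).re)
      (fun x hx => (Complex.le_def.mp (mul_nonneg (hτ x.1) (hbnn x.2))).1) hmem
    beta_reduce at h1
    rw [← Complex.re_sum, ← hrec, hb0, mul_one, ← Complex.ofReal_natCast, Complex.re_ofReal_mul] at h1
    exact h1
  -- boundedness near `1`
  obtain ⟨R, hR, -⟩ := Polynomial.exists_eq_pow_rootMultiplicity_mul_and_not_dvd (numer (D.a χ) D.N D.m0)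
    (numer_ne_zero D.N_pos (D.a_zero χ)) 1
  rw [← ord, ho] at hR
  have hprod : (((1 - X ^ D.N) ^ 2 : ℂ[X]) : PowerSeries ℂ) * B =
      ((numer (D.a 0) D.N D.m0 * numer (D.a χ) D.N D.m0 : ℂ[X]) : PowerSeries ℂ) := by
    rw [Polynomial.coe_mul, numer_coe (D.a_per _), numer_coe (D.a_per _), hB]
    push_cast; ring
  set E : ℂ[X] := ∑ i ∈ range D.N, X ^ i with hE
  have hE1 : (1 - X ^ D.N : ℂ[X]) = -((X - Polynomial.C 1) * E) := by
    rw [hE, map_one, mul_geom_sum]; ring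
  have hEe : E.eval 1 = D.N := by simp [hE, Polynomial.eval_finsetSum]
  have hEne : (E ^ 2).eval 1 ≠ 0 := by
    rw [eval_pow, hEe]; exact pow_ne_zero _ (by exact_mod_cast D.N_pos.ne')
  have hconvB : ∀ x : ℝ, 0 ≤ x → x < 1 → Conv B x := fun x h0 h1 =>
    conv_mul (D.conv_a _ x h0 h1) (D.conv_a _ x h0 h1)
  have hcont : ∀ p : ℂ[X], Tendsto (fun x : ℝ => p.eval (x : ℂ)) (𝓝[<] 1) (𝓝 (p.eval 1)) := by
    intro p
    have : Continuous fun x : ℝ => p.eval (x : ℂ) := p.continuous.comp Complex.continuous_ofReal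
    have h := (this.tendsto 1).mono_left (nhdsWithin_le_nhds (s := Set.Iio 1))
    simpa using h
  have hlim := (hcont (numer (D.a 0) D.N D.m0 * R)).div (hcont (E ^ 2)) hEne
  have hlim2 : Tendsto (fun x : ℝ => ev B x) (𝓝[<] 1)
      (𝓝 ((numer (D.a 0) D.N D.m0 * R).eval 1 / (E ^ 2).eval 1)) := by
    refine hlim.congr' ?_
    filter_upwards [eventually_Ico, (hcont (E ^ 2)).eventually_ne hEne] with x hx hx2
    have h1 := congrArg (fun φ => ev φ x) hprod
    beta_reduce at h1
    rw [ev_mul (conv_coe _ _) (hconvB x hx.1 hx.2), ev_coe, ev_coe, hE1, hR] at h1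
    have hxne : ((x : ℂ) - 1) ≠ 0 := by
      rw [sub_ne_zero]; exact_mod_cast hx.2.ne
    rw [Pi.div_apply, div_eq_iff hx2]
    have h3 : ((x : ℂ) - 1) ^ 2 ≠ 0 := pow_ne_zero _ hxne
    refine mul_left_cancel₀ h3 ?_
    simp only [eval_mul, eval_pow, eval_neg, eval_sub, eval_X, eval_C] at h1 ⊢
    linear_combination -h1
  obtain ⟨K, hK⟩ : ∃ K : ℝ, ∀ᶠ x : ℝ in 𝓝[<] 1, (ev B x).re < K := by
    have h := (Complex.continuous_re.tendsto _).comp hlim2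
    exact ⟨_, h.eventually_lt_const (lt_add_one _)⟩
  have hsum : Summable fun m => (b m).re := by
    refine summable_of_sum_range_le (c := K) (fun m => (Complex.le_def.mp (hbnn m)).1) fun n => ?_
    have h1 : Tendsto (fun x : ℝ => ∑ m ∈ range n, (b m).re * x ^ m) (𝓝[<] 1)
        (𝓝 (∑ m ∈ range n, (b m).re * 1 ^ m)) := by
      have : Continuous fun x : ℝ => ∑ m ∈ range n, (b m).re * x ^ m := by fun_prop
      exact (this.tendsto 1).mono_left nhdsWithin_le_nhds
    simp only [one_pow, mul_one] at h1
    refine le_of_tendsto h1 ?_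
    filter_upwards [eventually_Ico, hK] with x hx hx2
    refine le_trans ?_ hx2.le
    rw [re_ev (hconvB x hx.1 hx.2)]
    refine Summable.sum_le_tsum _ (fun m _ => ?_) ?_
    · exact mul_nonneg (Complex.le_def.mp (hbnn m)).1 (pow_nonneg hx.1 m)
    · have := Complex.hasSum_re (hconvB x hx.1 hx.2).of_norm.hasSum
      refine this.summable.congr fun m => ?_
      rw [← Complex.ofReal_pow, Complex.re_mul_ofReal]
  have hzero := hsum.tendsto_atTop_zero
  -- linear recurrence
  set M := (numer (D.a 0) D.N D.m0 * numer (D.a χ) D.N D.m0).natDegree with hM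
  have hlin : ∀ m, M < m + 2 * D.N → b (m + 2 * D.N) - b (m + D.N) = b (m + D.N) - b m := by
    intro m hm
    have h1 := congrArg (PowerSeries.coeff (m + 2 * D.N)) hprod
    rw [Polynomial.coeff_coe, Polynomial.coeff_eq_zero_of_natDegree_lt hm] at h1
    have h2 : (((1 - X ^ D.N) ^ 2 : ℂ[X]) : PowerSeries ℂ) * B =
        B - PowerSeries.X ^ D.N * B - PowerSeries.X ^ D.N * B + PowerSeries.X ^ (2 * D.N) * B := by
      push_cast; ring
    rw [h2] at h1
    simp only [map_sub, map_add, PowerSeries.coeff_X_pow_mul'] at h1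
    rw [if_pos (by omega), if_pos (by omega), show m + 2 * D.N - D.N = m + D.N by omega,
      show m + 2 * D.N - 2 * D.N = m by omega] at h1
    simp only [hb]
    linear_combination h1
  have hbz : ∀ m, M < m → (b m).re = 0 := by
    intro m hm
    set d := (b (m + D.N)).re - (b m).re with hd
    have h1 : ∀ k : ℕ, (b (m + k * D.N)).re = (b m).re + k * d ∧
        (b (m + (k + 1) * D.N)).re = (b m).re + (k + 1) * d := by
      intro k
      induction k with
      | zero => simp [hd]
      | succ k ih =>
        have h2 := congrArg Complex.re (hlin (m + k * D.N) (by omega))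
        rw [show m + k * D.N + 2 * D.N = m + (k + 1 + 1) * D.N by ring,
          show m + k * D.N + D.N = m + (k + 1) * D.N by ring, Complex.sub_re, Complex.sub_re,
          ih.1, ih.2] at h2
        refine ⟨?_, ?_⟩
        · rw [ih.2]; push_cast; ring
        · push_cast; linarith
    have h3 : Tendsto (fun k : ℕ => (b m).re + k * d) atTop (𝓝 0) := by
      have h4 : Tendsto (fun k : ℕ => m + k * D.N) atTop atTop := by
        refine tendsto_atTop_mono (f := fun k : ℕ => k) (fun k => ?_) tendsto_id
        have := Nat.le_mul_of_pos_right k D.N_pos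
        omega
      refine (hzero.comp h4).congr fun k => ?_
      exact (h1 k).1
    have hd0 : d = 0 := by
      have h5 := (h3.comp (tendsto_add_atTop_nat 1)).sub h3
      rw [sub_zero] at h5
      have h6 : Tendsto (fun _ : ℕ => d) atTop (𝓝 0) := by
        refine h5.congr fun k => ?_
        simp only [Function.comp]; push_cast; ring
      exact tendsto_nhds_unique tendsto_const_nhds h6
    rw [hd0] at h3
    simp only [mul_zero, add_zero] at h3
    exact tendsto_nhds_unique tendsto_const_nhds h3
  obtain ⟨p⟩ := D.exists_prime
  set m := (2 * (M + 1)) * D.deg p with hm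
  have hmM : M < m := by
    have := Nat.le_mul_of_pos_right (2 * (M + 1)) (D.deg_pos p)
    omega
  have h1 := hble m
  rw [hbz m hmM, mul_zero] at h1
  have h2 : 0 < (D.s 0 m + D.s χ m).re := by
    rw [s_eq, s_eq, ← Finset.sum_add_distrib, Complex.re_sum]
    have hnn : ∀ p' i, 0 ≤ ((if i * D.deg p' = m then
        ((D.deg p' * (D.q⁻¹) ^ m : ℝ) : ℂ) * (0 : AddChar G ℂ) (i • D.cl p') else 0) +
        (if i * D.deg p' = m then
        ((D.deg p' * (D.q⁻¹) ^ m : ℝ) : ℂ) * χ (i • D.cl p') else 0)).re := by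
      intro p' i
      split_ifs
      · rw [← mul_add, AddChar.zero_apply, Complex.re_ofReal_mul]
        exact mul_nonneg (D.term_nonneg _ _) (Complex.le_def.mp (hreal _)).1
      · simp
    refine Finset.sum_pos' (fun p' _ => ?_) ⟨p, ?_, ?_⟩
    · rw [← Finset.sum_add_distrib, Complex.re_sum]
      exact Finset.sum_nonneg fun i _ => hnn _ _
    · rw [mem_primesLE, hm]; exact Nat.le_mul_of_pos_left _ (by omega)
    · rw [← Finset.sum_add_distrib, Complex.re_sum]
      refine Finset.sum_pos' (fun i _ => hnn _ _) ⟨2 * (M + 1), ?_, ?_⟩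
      · rw [Finset.mem_Icc, hm]
        exact ⟨by omega, Nat.le_mul_of_pos_right _ (D.deg_pos p)⟩
      · rw [if_pos hm.symm, if_pos hm.symm, AddChar.zero_apply, mul_comm 2, mul_nsmul,
          AddChar.map_nsmul_eq_pow, AddChar.map_nsmul_eq_pow]
        have e1 : (χ (D.cl p) ^ (M + 1)) ^ 2 = 1 := by
          rw [← pow_mul, mul_comm, pow_mul, pow_two (χ (D.cl p)), ← AddChar.mul_apply, hχ, AddChar.zero_apply, one_pow]
        rw [e1, mul_one]
        have := D.one_lt_q
        have h7 := D.deg_pos p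
        have : 0 < (D.deg p * (D.q⁻¹) ^ m : ℝ) := by positivity
        rw [Complex.add_re, Complex.ofReal_re]; linarith
  linarith

end ClassData
end AbsPNT

namespace AbsPNT
namespace ClassData

open Finset Filter Topology

variable {P G : Type*} [AddCommGroup G] (D : ClassData P G) [Fintype G]

theorem ord_eq_one {χ : AddChar G ℂ} (hχ : χ ≠ 0) : D.ord χ = 1 := by
  have h1 := D.ord_le χ
  rw [if_neg hχ] at h1
  have h2 := (D.ord_eq_zero_iff χ).not.mpr hχ
  by_cases h : χ * χ = 0
  · have := D.ord_ne_two h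
    omega
  · have := (D.ord_eq_zero_iff _).not.mpr h
    omega

theorem card_primesLE_le : ∃ K : ℝ, ∀ n : ℕ, ((primesLE D.hfin n).card : ℝ) ≤ K * (n + 1) * D.q ^ n := by
  obtain ⟨K, hK0, hK⟩ := D.a_bound 0
  refine ⟨K, fun n => ?_⟩
  have hq := D.one_lt_q
  have h1 : ∀ j, ((divs D.hfin j).card : ℝ) ≤ K * D.q ^ j := by
    intro j
    have h2 := hK j
    have h3 : D.a 0 j = (((divs D.hfin j).card * (D.q⁻¹) ^ j : ℝ) : ℂ) := by
      rw [a, aSeq, Finset.sum_congr rfl (g := fun _ => ((D.q : ℂ)⁻¹) ^ j)]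
      · simp
      · intro t ht
        rw [mem_divs] at ht
        rw [prod_f, AddChar.zero_apply, one_mul, ht]
    rw [h3, Complex.norm_real, Real.norm_of_nonneg (by positivity), inv_pow] at h2
    rwa [← div_eq_mul_inv, div_le_iff₀ (by positivity)] at h2
  classical
  have h2 : (primesLE D.hfin n).card ≤ ∑ j ∈ range (n + 1), (divs D.hfin j).card := by
    refine le_trans ?_ Finset.card_biUnion_le
    refine Finset.card_le_card_of_injOn (fun p => ({p} : Multiset P)) (fun p hp => ?_)
      (fun a _ b _ h => Multiset.singleton_inj.mp h)
    rw [Finset.mem_coe, mem_primesLE] at hp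
    simp only [Finset.coe_biUnion, Set.mem_iUnion, Finset.mem_coe, mem_divs, Finset.mem_range]
    exact ⟨D.deg p, by omega, by simp⟩
  calc ((primesLE D.hfin n).card : ℝ) ≤ ∑ j ∈ range (n + 1), ((divs D.hfin j).card : ℝ) := by
        exact_mod_cast h2
    _ ≤ ∑ j ∈ range (n + 1), K * D.q ^ n := by
        refine Finset.sum_le_sum fun j hj => (h1 j).trans ?_
        have : j ≤ n := by rw [Finset.mem_range] at hj; omega
        gcongr
        exact hq.le
    _ = _ := by rw [Finset.sum_const, card_range, nsmul_eq_mul]; push_cast; ring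

/-- The logarithmic derivatives, averaged against a class. -/
noncomputable def t (g : G) (m : ℕ) : ℂ := ∑ χ : AddChar G ℂ, χ (-g) * D.s χ m

theorem t_eq [DecidableEq G] (g : G) (m : ℕ) : D.t g m =
    ∑ p ∈ primesLE D.hfin m, ∑ i ∈ Icc 1 m, if i * D.deg p = m ∧ i • D.cl p = g then
      ((D.deg p * (D.q⁻¹) ^ m : ℝ) : ℂ) * Fintype.card G else 0 := by
  simp only [t, s_eq, Finset.mul_sum]
  rw [Finset.sum_comm]
  refine Finset.sum_congr rfl fun p _ => ?_
  rw [Finset.sum_comm]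
  refine Finset.sum_congr rfl fun i _ => ?_
  by_cases h : i * D.deg p = m
  · simp only [h, if_true, true_and]
    have h1 : ∀ χ : AddChar G ℂ, χ (-g) * (((D.deg p * (D.q⁻¹) ^ m : ℝ) : ℂ) * χ (i • D.cl p)) =
        ((D.deg p * (D.q⁻¹) ^ m : ℝ) : ℂ) * χ (i • D.cl p - g) := by
      intro χ
      rw [sub_eq_add_neg, AddChar.map_add_eq_mul]; ring
    simp only [h1]
    rw [← Finset.mul_sum, AddChar.sum_apply_eq_ite]
    simp only [sub_eq_zero]
    split_ifs <;> simp
  · simp [h]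

theorem norm_t_le {g : G} {d m : ℕ} (hd : ∀ p, D.cl p = g → D.deg p < d) (hm : d ≤ m) :
    ‖D.t g m‖ ≤ (primesLE D.hfin (m / 2)).card * (m * (m * (D.q⁻¹) ^ m * Fintype.card G)) := by
  classical
  have hq := D.one_lt_q
  rw [t_eq]
  have hsub : primesLE D.hfin (m / 2) ⊆ primesLE D.hfin m := fun p hp => by
    rw [mem_primesLE] at *; omega
  rw [← Finset.sum_subset hsub]
  · refine (norm_sum_le_of_le (f := _) _ (n := fun _ => m * (m * (D.q⁻¹) ^ m * Fintype.card G))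
      fun p hp => ?_).trans ?_
    · refine (norm_sum_le_of_le _ (n := fun _ => m * (D.q⁻¹) ^ m * Fintype.card G) fun i hi => ?_).trans ?_
      · split_ifs with h
        · rw [norm_mul, Complex.norm_real, Real.norm_of_nonneg (D.term_nonneg _ _),
            Complex.norm_natCast]
          have : (D.deg p : ℝ) ≤ m := by
            rw [mem_primesLE] at hp
            exact_mod_cast hp.trans (Nat.div_le_self _ _)
          gcongr
        · simp; positivity
      · simp
    · simp
  · intro p hp hp2
    rw [mem_primesLE] at hp hp2
    refine Finset.sum_eq_zero fun i hi => if_neg fun h => ?_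
    rw [Finset.mem_Icc] at hi
    have h2 : i < 2 := by
      by_contra h3
      have : 2 * D.deg p ≤ i * D.deg p := Nat.mul_le_mul_right _ (by omega)
      omega
    have h3 : i = 1 := by omega
    subst h3
    rw [one_mul, one_smul] at h
    have := hd p h.2
    omega

/-- A Dirichlet type theorem: every class contains primes of arbitrarily large degree. -/
theorem exists_prime_of_class (g : G) (d : ℕ) : ∃ p, D.cl p = g ∧ d ≤ D.deg p := by
  classical
  by_contra! hd
  have hq := D.one_lt_q
  have hsq : 1 < √D.q := by rw [Real.lt_sqrt (by norm_num)]; simpa using hq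
  set r := (√D.q)⁻¹ with hr
  have hr0 : 0 < r := by positivity
  have hr1 : r < 1 := inv_lt_one_of_one_lt₀ hsq
  obtain ⟨K, hK⟩ := D.card_primesLE_le
  have hK0 : 0 ≤ K := by
    have := hK 0
    simp only [CharP.cast_eq_zero, zero_add, mul_one, pow_zero] at this
    exact le_trans (Nat.cast_nonneg _) this
  have hqr : ∀ m : ℕ, D.q ^ (m / 2) * (D.q⁻¹) ^ m ≤ r ^ m := by
    intro m
    have e1 : D.q = √D.q ^ 2 := (Real.sq_sqrt (by linarith)).symm
    rw [inv_pow, ← div_eq_mul_inv, div_le_iff₀ (by positivity)]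
    have e2 : r ^ m * D.q ^ m = √D.q ^ m := by
      rw [hr, ← mul_pow]
      congr 1
      nth_rewrite 2 [e1]
      rw [pow_two, inv_mul_cancel_left₀ (by positivity)]
    rw [e2]
    nth_rewrite 1 [e1]
    rw [← pow_mul]
    exact pow_le_pow_right₀ hsq.le (Nat.mul_div_le m 2)
  have hsum : Summable fun m => ‖D.t g m‖ := by
    have h1 : Summable fun m : ℕ => (K * Fintype.card G) * (((m : ℝ) ^ 3 * r ^ m) + ((m : ℝ) ^ 2 * r ^ m)) :=
      Summable.mul_left _ (Summable.add
        (summable_pow_mul_geometric_of_norm_lt_one 3 (by rwa [Real.norm_of_nonneg hr0.le]))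
        (summable_pow_mul_geometric_of_norm_lt_one 2 (by rwa [Real.norm_of_nonneg hr0.le])))
    refine Summable.of_norm_bounded_eventually_nat h1 ?_
    filter_upwards [eventually_ge_atTop d] with m hm
    rw [norm_norm]
    refine (D.norm_t_le hd hm).trans ?_
    have h2 := hK (m / 2)
    have h3 : ((m / 2 : ℕ) : ℝ) ≤ m := by exact_mod_cast Nat.div_le_self _ _
    calc _ ≤ (K * ((m / 2 : ℕ) + 1) * D.q ^ (m / 2)) * (m * (m * (D.q⁻¹) ^ m * Fintype.card G)) := by
          gcongr
      _ = (K * ((m / 2 : ℕ) + 1) * m * m * Fintype.card G) * (D.q ^ (m / 2) * (D.q⁻¹) ^ m) := by ring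
      _ ≤ (K * (m + 1) * m * m * Fintype.card G) * r ^ m := by
          gcongr
          exact hqr m
      _ = _ := by ring
  -- the two limits
  have h1 : Tendsto (fun x : ℝ => ∑ χ : AddChar G ℂ, χ (-g) *
      (((1 - x : ℝ) : ℂ) * ev (PowerSeries.mk (D.s χ)) x)) (𝓝[<] 1)
      (𝓝 (∑ χ : AddChar G ℂ, χ (-g) * (1 - (D.ord χ : ℂ)))) :=
    tendsto_finsetSum _ fun χ _ => (D.tendsto_s χ).const_mul _
  have e1 : ∑ χ : AddChar G ℂ, χ (-g) * (1 - (D.ord χ : ℂ)) = 1 := by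
    rw [Finset.sum_eq_single 0]
    · rw [(D.ord_eq_zero_iff 0).mpr rfl, AddChar.zero_apply]; simp
    · intro χ _ hχ
      rw [D.ord_eq_one hχ]; simp
    · simp
  rw [e1] at h1
  have h2 : Tendsto (fun x : ℝ => ∑ χ : AddChar G ℂ, χ (-g) *
      (((1 - x : ℝ) : ℂ) * ev (PowerSeries.mk (D.s χ)) x)) (𝓝[<] 1) (𝓝 0) := by
    have h3 : Tendsto (fun x : ℝ => (1 - x) * ∑' m, ‖D.t g m‖) (𝓝[<] 1) (𝓝 0) := by
      have : Continuous fun x : ℝ => (1 - x) * ∑' m, ‖D.t g m‖ := by fun_prop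
      have := (this.tendsto 1).mono_left (nhdsWithin_le_nhds (s := Set.Iio 1))
      simpa using this
    refine squeeze_zero_norm' ?_ h3
    filter_upwards [eventually_Ico] with x hx
    have h4 : ∑ χ : AddChar G ℂ, χ (-g) * (((1 - x : ℝ) : ℂ) * ev (PowerSeries.mk (D.s χ)) x) =
        ((1 - x : ℝ) : ℂ) * ∑' m, D.t g m * (x : ℂ) ^ m := by
      simp only [t, Finset.sum_mul]
      rw [Summable.tsum_finsetSum]
      · rw [Finset.mul_sum]
        refine Finset.sum_congr rfl fun χ _ => ?_
        rw [ev]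
        simp only [mul_assoc]
        rw [tsum_mul_left]
        simp only [PowerSeries.coeff_mk]
        ring
      · intro χ _
        have := ((D.conv_s χ x hx.1 hx.2).of_norm).mul_left (χ (-g))
        simpa only [PowerSeries.coeff_mk, mul_assoc] using this
    rw [h4, norm_mul, Complex.norm_real, Real.norm_of_nonneg (by linarith [hx.2])]
    refine mul_le_mul_of_nonneg_left ?_ (by linarith [hx.2])
    refine tsum_of_norm_bounded hsum.hasSum fun m => ?_
    rw [norm_mul, norm_pow, Complex.norm_real, Real.norm_of_nonneg hx.1]
    exact mul_le_of_le_one_right (norm_nonneg _) (pow_le_one₀ hx.1 hx.2.le)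
  exact one_ne_zero (tendsto_nhds_unique h1 h2)

end ClassData
end AbsPNT

open scoped WithZero in
theorem WithZero.exp_mul_le_exp_add (i j : ℤ) (x : ℤᵐ⁰) :
    WithZero.exp i * x ≤ WithZero.exp (i + j) ↔ x ≤ WithZero.exp j := by
  rw [WithZero.exp_add]
  exact mul_le_mul_iff_right₀ WithZero.exp_pos

open scoped WithZero in
/-- A ring of functions with poles at a single place, in terms of its valuation `v`. -/
structure OnePlace (k A K : Type*) [Field k] [CommRing A] [Field K] [Algebra k A] [Algebra A K]
    [Algebra k K] where
  v : Valuation K ℤᵐ⁰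
  v_const : ∀ c : k, v (algebraMap k K c) ≤ 1
  const : ∀ a : A, v (algebraMap A K a) ≤ 1 → a ∈ Set.range (algebraMap k A)
  unif : ∃ ϖ, v ϖ = WithZero.exp (-1)
  j0 : ℕ
  approx : ∀ z, ∃ a : A, v (z - algebraMap A K a) ≤ WithZero.exp (j0 : ℤ)
  fin : ∀ j : ℤ, {a : A | v (algebraMap A K a) ≤ WithZero.exp j}.Finite

namespace OnePlace
open WithZero

variable {k A K : Type*} [Field k] [CommRing A] [Field K] [Algebra k A] [Algebra A K]
    [Algebra k K] (D : OnePlace k A K)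

/-- The pole order valuation on the ring. -/
abbrev va : Valuation A (WithZero (Multiplicative ℤ)) := D.v.comap (algebraMap A K)

theorem va_apply (a : A) : D.va a = D.v (algebraMap A K a) := rfl

/-- Elements with a pole of order at most `j`. -/
def O (j : ℤ) : Submodule k K where
  carrier := {z | D.v z ≤ exp j}
  add_mem' ha hb := (D.v.map_add _ _).trans (max_le ha hb)
  zero_mem' := by simp
  smul_mem' c x hx := by
    simp only [Set.mem_ofPred_eq] at hx ⊢
    rw [Algebra.smul_def, map_mul]
    exact mul_le_of_le_one_of_le (D.v_const c) hx

theorem ne_zero_of_v {y : K} {d : ℤ} (hy : D.v y = exp d) : y ≠ 0 := by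
  rintro rfl
  rw [map_zero] at hy
  exact exp_ne_zero hy.symm

theorem ne_zero_of_va {y : A} {d : ℤ} (hy : D.va y = exp d) : y ≠ 0 := by
  rintro rfl
  rw [map_zero] at hy
  exact exp_ne_zero hy.symm

theorem mem_O {j : ℤ} {z : K} : z ∈ D.O j ↔ D.v z ≤ exp j := Iff.rfl

theorem O_mono {i j : ℤ} (h : i ≤ j) : D.O i ≤ D.O j := fun _ hz =>
  le_trans (D.mem_O.mp hz) (exp_le_exp.mpr h)

variable [IsScalarTower k A K]

/-- Ring elements with a pole of order at most `j`. -/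
def V (j : ℤ) : Submodule k A := (D.O j).comap (IsScalarTower.toAlgHom k A K).toLinearMap

theorem mem_V {j : ℤ} {z : A} : z ∈ D.V j ↔ D.va z ≤ exp j := Iff.rfl

theorem V_mono {i j : ℤ} (h : i ≤ j) : D.V i ≤ D.V j := fun _ hz =>
  le_trans (D.mem_V.mp hz) (exp_le_exp.mpr h)

/-- The dimension of the space of elements with pole of order at most `j`. -/
noncomputable def dimV (j : ℤ) : ℕ := Module.finrank k (D.V j)

instance finite_V (j : ℤ) : Finite (D.V j) := (D.fin j).to_subtype

theorem exists_v_eq (j : ℤ) : ∃ z, D.v z = exp j := by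
  obtain ⟨ϖ, hϖ⟩ := D.unif
  refine ⟨ϖ ^ (-j), ?_⟩
  rw [map_zpow₀, hϖ, ← exp_zsmul]
  simp

/-- A graded piece of the filtration by pole order. -/
abbrev gr (i j : ℤ) := ↥(D.O j) ⧸ (D.O i).comap (D.O j).subtype

/-- The reduction of a ring element in a graded piece. -/
def toGr (i j : ℤ) : D.V j →ₗ[k] D.gr i j :=
  (Submodule.mkQ _).comp
    ((IsScalarTower.toAlgHom k A K).toLinearMap.restrict (p := D.V j) (q := D.O j) (fun _ h => h))

theorem toGr_surjective {i j : ℤ} (hi : D.j0 ≤ i) (hij : i ≤ j) :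
    Function.Surjective (D.toGr i j) := by
  intro z
  obtain ⟨⟨z, hz⟩, rfl⟩ := Submodule.mkQ_surjective _ z
  obtain ⟨a, ha⟩ := D.approx z
  have ha' : D.v (z - algebraMap A K a) ≤ exp i := ha.trans (exp_le_exp.mpr hi)
  have hv : a ∈ D.V j := by
    rw [mem_V, va_apply, show algebraMap A K a = z - (z - algebraMap A K a) by ring]
    exact (D.v.map_sub _ _).trans (max_le hz (ha'.trans (exp_le_exp.mpr hij)))
  refine ⟨⟨a, hv⟩, ?_⟩
  rw [toGr, LinearMap.comp_apply]
  rw [Submodule.mkQ_apply, Submodule.mkQ_apply, Submodule.Quotient.eq, Submodule.mem_comap,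
    Submodule.subtype_apply, mem_O]
  rw [Valuation.map_sub_swap] at ha'
  exact ha'

theorem ker_toGr (i j : ℤ) : LinearMap.ker (D.toGr i j) = (D.V i).comap (D.V j).subtype := by
  rw [toGr, LinearMap.ker_comp, Submodule.ker_mkQ]
  rfl

theorem finrank_V_add [Finite k] {i j : ℤ} (hi : D.j0 ≤ i) (hij : i ≤ j) :
    D.dimV j = D.dimV i + Module.finrank k (D.gr i j) := by
  have h1 := LinearMap.finrank_range_add_finrank_ker (D.toGr i j)
  rw [LinearMap.range_eq_top.mpr (D.toGr_surjective hi hij), finrank_top, ker_toGr,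
    (Submodule.comapSubtypeEquivOfLe (D.V_mono hij)).finrank_eq] at h1
  rw [dimV, dimV]
  omega

/-- Multiplication by a nonzero element as an isomorphism of filtration pieces. -/
noncomputable def mulO {y : K} {d : ℤ} (hy : D.v y = exp d) (i : ℤ) : D.O i ≃ₗ[k] D.O (d + i) where
  toFun z := ⟨y * z, by
    rw [mem_O, map_mul, hy, exp_mul_le_exp_add]; exact z.2⟩
  invFun z := ⟨y⁻¹ * z, by
    rw [mem_O, ← exp_mul_le_exp_add d, ← hy, ← map_mul, mul_inv_cancel_left₀ (D.ne_zero_of_v hy)]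
    exact z.2⟩
  left_inv z := by
    ext
    exact inv_mul_cancel_left₀ (D.ne_zero_of_v hy) _
  right_inv z := by
    ext
    exact mul_inv_cancel_left₀ (D.ne_zero_of_v hy) _
  map_add' a b := by ext; simp [mul_add]
  map_smul' a b := by ext; simp

theorem mulO_apply {y : K} {d : ℤ} (hy : D.v y = exp d) (i : ℤ) (z : D.O i) :
    (D.mulO hy i z : K) = y * z := rfl

/-- Multiplication by a nonzero element on graded pieces. -/
noncomputable def mulGr {y : K} {d : ℤ} (hy : D.v y = exp d) (i j : ℤ) :
    D.gr i j ≃ₗ[k] D.gr (d + i) (d + j) :=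
  Submodule.Quotient.equiv _ _ (D.mulO hy j) (by
    ext z
    obtain ⟨z, rfl⟩ := (D.mulO hy j).surjective z
    rw [Submodule.mem_map_equiv]
    simp only [LinearEquiv.symm_apply_apply, Submodule.mem_comap, Submodule.subtype_apply, mem_O,
      mulO_apply, map_mul, hy, exp_mul_le_exp_add])

/-- The degree of the place at infinity. -/
noncomputable def f : ℕ := Module.finrank k (D.gr 0 1)

theorem finrank_gr (i : ℤ) : Module.finrank k (D.gr i (i + 1)) = D.f := by
  obtain ⟨y, hy⟩ := D.exists_v_eq i
  have := (D.mulGr hy 0 1).finrank_eq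
  rw [f, this, add_zero]

theorem finrank_V [Finite k] (i d : ℕ) (hi : D.j0 ≤ i) :
    D.dimV (i + d) = D.dimV i + D.f * d := by
  induction d with
  | zero => simp
  | succ d ih =>
    have := D.finrank_V_add (i := i + d) (j := i + d + 1) (by omega) (by omega)
    rw [finrank_gr, ih] at this
    push_cast
    rw [← add_assoc, this]
    ring

theorem f_pos [Finite k] : 0 < D.f := by
  obtain ⟨z, hz⟩ := D.exists_v_eq (D.j0 + 1)
  rw [← D.finrank_gr D.j0]
  have : Module.Finite k (D.gr D.j0 (D.j0 + 1)) :=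
    Module.Finite.of_surjective _ (D.toGr_surjective le_rfl (by omega))
  rw [Module.finrank_pos_iff_exists_ne_zero]
  refine ⟨Submodule.Quotient.mk ⟨z, hz.le⟩, ?_⟩
  rw [Ne, Submodule.Quotient.mk_eq_zero, Submodule.mem_comap, Submodule.subtype_apply, mem_O, hz,
    exp_le_exp]
  omega

theorem v_const_eq [Finite k] {c : k} (hc : c ≠ 0) : D.v (algebraMap k K c) = 1 := by
  refine le_antisymm (D.v_const c) ?_
  have h1 := D.v_const c⁻¹
  have h2 : D.v (algebraMap k K c) * D.v (algebraMap k K c⁻¹) = 1 := by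
    rw [← map_mul, ← map_mul, mul_inv_cancel₀ hc, map_one, map_one]
  calc 1 = D.v (algebraMap k K c) * D.v (algebraMap k K c⁻¹) := h2.symm
    _ ≤ D.v (algebraMap k K c) := mul_le_of_le_one_right zero_le h1

theorem exists_va_eq [Finite k] {x : A} (hx : x ≠ 0) [FaithfulSMul A K] :
    ∃ i : ℕ, D.va x = exp (i : ℤ) := by
  have hx' : D.va x ≠ 0 := by
    rw [va_apply, Ne, Valuation.zero_iff, FaithfulSMul.algebraMap_eq_zero_iff]
    exact hx
  by_cases h : D.va x ≤ 1
  · obtain ⟨c, rfl⟩ := D.const x h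
    refine ⟨0, ?_⟩
    rw [va_apply, ← IsScalarTower.algebraMap_apply, v_const_eq]
    · simp
    · rintro rfl; simp at hx
  · obtain ⟨i, hi⟩ : ∃ i : ℤ, D.va x = exp i := ⟨log (D.va x), (exp_log hx').symm⟩
    rw [hi, ← exp_zero, exp_le_exp, not_le] at h
    exact ⟨i.toNat, by rw [hi, Int.toNat_of_nonneg h.le]⟩

/-- Approximation by elements of a coset of an ideal. -/
theorem approx_ideal {I : Ideal A} {b : A} (hb : b ∈ I) {i : ℤ} (hi : D.va b = exp i) (a₀ : A)
    (z : K) : ∃ a, a - a₀ ∈ I ∧ D.v (z - algebraMap A K a) ≤ exp (i + D.j0) := by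
  have hb0 : algebraMap A K b ≠ 0 := D.ne_zero_of_v hi
  obtain ⟨c, hc⟩ := D.approx ((z - algebraMap A K a₀) / algebraMap A K b)
  refine ⟨a₀ + b * c, ?_, ?_⟩
  · rw [add_sub_cancel_left]
    exact I.mul_mem_right _ hb
  · rw [← exp_mul_le_exp_add i, ← hi, va_apply, ← map_mul] at hc
    convert hc using 2
    field_simp
    simp
    ring

section Quotient
variable [Finite k] [FaithfulSMul A K]

theorem va_mul_le {x : A} {i : ℤ} (hx : D.va x = exp i) (y : A) (j : ℤ) :
    D.va (x * y) ≤ exp (i + j) ↔ D.va y ≤ exp j := by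
  rw [map_mul, hx, exp_mul_le_exp_add]

/-- Reduction modulo `x` of elements of bounded pole order. -/
noncomputable def toQuot (x : A) (j : ℤ) : D.V j →ₗ[k] A ⧸ Ideal.span {x} :=
  (Ideal.Quotient.mkₐ k (Ideal.span {x})).toLinearMap.comp (D.V j).subtype

theorem toQuot_surjective {x : A} {i : ℤ} (hx : D.va x = exp i) {j : ℤ} (hj : D.j0 ≤ j) :
    Function.Surjective (D.toQuot x (i + j)) := by
  intro z
  obtain ⟨z, rfl⟩ := Ideal.Quotient.mk_surjective z
  obtain ⟨a, ha, ha2⟩ := D.approx_ideal (Ideal.mem_span_singleton_self x) hx z 0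
  refine ⟨⟨a, ?_⟩, ?_⟩
  · rw [mem_V, va_apply]
    rw [zero_sub, Valuation.map_neg] at ha2
    exact ha2.trans (exp_le_exp.mpr (by omega))
  · exact Ideal.Quotient.eq.mpr ha

/-- Multiplication by `x` on elements of bounded pole order. -/
def mulV {x : A} {i : ℤ} (hx : D.va x = exp i) (j : ℤ) : D.V j →ₗ[k] D.V (i + j) :=
  (LinearMap.mulLeft k x).restrict (fun y hy => (D.va_mul_le hx y j).mpr hy)

theorem ker_toQuot {x : A} {i : ℤ} (hx : D.va x = exp i) (j : ℤ) :
    LinearMap.ker (D.toQuot x (i + j)) = LinearMap.range (D.mulV hx j) := by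
  ext ⟨y, hy⟩
  rw [LinearMap.mem_ker, LinearMap.mem_range]
  constructor
  · intro h
    obtain ⟨z, rfl⟩ := Ideal.mem_span_singleton'.mp (Ideal.Quotient.eq_zero_iff_mem.mp h)
    rw [mul_comm] at hy
    refine ⟨⟨z, (D.va_mul_le hx z j).mp hy⟩, ?_⟩
    ext
    exact mul_comm _ _
  · rintro ⟨z, hz⟩
    refine Ideal.Quotient.eq_zero_iff_mem.mpr (Ideal.mem_span_singleton'.mpr ⟨z, ?_⟩)
    exact (mul_comm _ _).trans (Subtype.ext_iff.mp hz)

theorem mulV_injective [IsDomain A] {x : A} {i : ℤ} (hx : D.va x = exp i) (j : ℤ) :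
    Function.Injective (D.mulV hx j) := by
  have hx0 : x ≠ 0 := D.ne_zero_of_va hx
  intro a b h
  ext
  exact mul_left_cancel₀ hx0 (Subtype.ext_iff.mp h)

theorem module_finite_quot (D : OnePlace k A K) {x : A} (hx : x ≠ 0) : Module.Finite k (A ⧸ Ideal.span {x}) := by
  obtain ⟨i, hi⟩ := D.exists_va_eq hx
  exact Module.Finite.of_surjective _ (D.toQuot_surjective hi le_rfl)

theorem finrank_quot [IsDomain A] {x : A} {i : ℕ} (hx : D.va x = exp (i : ℤ)) :
    Module.finrank k (A ⧸ Ideal.span {x}) = D.f * i := by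
  have h1 := LinearMap.finrank_range_add_finrank_ker (D.toQuot x (i + D.j0))
  rw [LinearMap.range_eq_top.mpr (D.toQuot_surjective hx le_rfl), finrank_top, ker_toQuot D hx,
    LinearMap.finrank_range_of_inj (D.mulV_injective hx _), ← dimV, ← dimV, add_comm (i : ℤ),
    D.finrank_V _ _ le_rfl] at h1
  omega

theorem module_finite_quot_ideal (D : OnePlace k A K) {I : Ideal A} (hI : I ≠ ⊥) : Module.Finite k (A ⧸ I) := by
  obtain ⟨x, hxI, hx⟩ := Submodule.exists_mem_ne_zero_of_ne_bot hI
  have := D.module_finite_quot hx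
  exact Module.Finite.of_surjective
    (Ideal.Quotient.factorₐ k ((Ideal.span_singleton_le_iff_mem I).mpr hxI)).toLinearMap
    (Ideal.Quotient.factor_surjective ((Ideal.span_singleton_le_iff_mem I).mpr hxI))

theorem finite_quot_ideal (D : OnePlace k A K) {I : Ideal A} (hI : I ≠ ⊥) : Finite (A ⧸ I) := by
  have := D.module_finite_quot_ideal hI
  exact Module.finite_of_finite k

/-- Minkowski: an ideal contains nonzero elements of controlled pole order. -/
theorem exists_mem_ideal {I : Ideal A} (hI : I ≠ ⊥) {j : ℤ}
    (h : Module.finrank k (A ⧸ I) < D.dimV j) :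
    ∃ x ∈ I, x ≠ 0 ∧ D.va x ≤ exp j := by
  have := D.module_finite_quot_ideal hI
  obtain ⟨x, hx, hx0⟩ := Submodule.exists_mem_ne_zero_of_ne_bot (LinearMap.ker_ne_bot_of_finrank_lt
    (f := (Ideal.Quotient.mkₐ k I).toLinearMap.comp (D.V j).subtype) h)
  refine ⟨x, Ideal.Quotient.eq_zero_iff_mem.mp hx, fun h => hx0 (Subtype.ext h), x.2⟩

theorem finite_ideals_mem (D : OnePlace k A K) {x : A} (hx : x ≠ 0) : {I : Ideal A | x ∈ I}.Finite := by
  have : Finite (A ⧸ Ideal.span {x}) :=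
    D.finite_quot_ideal (by rwa [Ne, Ideal.span_singleton_eq_bot])
  have h : Finite (Ideal (A ⧸ Ideal.span {x})) :=
    Finite.of_injective (fun I => (I : Set (A ⧸ Ideal.span {x}))) SetLike.coe_injective
  refine (Set.finite_range
    (fun I : Ideal (A ⧸ Ideal.span {x}) => I.comap (Ideal.Quotient.mk _))).subset ?_
  intro I hI
  refine ⟨I.map (Ideal.Quotient.mk _), ?_⟩
  beta_reduce
  rw [Ideal.comap_map_mk]
  exact (Ideal.span_singleton_le_iff_mem I).mpr hI

end Quotient

end OnePlace

theorem LinearMap.det_of_exact {k N M Q : Type*} [Field k] [AddCommGroup N] [AddCommGroup M]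
    [AddCommGroup Q] [Module k N] [Module k M] [Module k Q] [Module.Finite k M]
    {i : N →ₗ[k] M} {π : M →ₗ[k] Q} (hi : Function.Injective i) (hπ : Function.Surjective π)
    (h : LinearMap.range i = LinearMap.ker π) {eN : N →ₗ[k] N} {eM : M →ₗ[k] M} {eQ : Q →ₗ[k] Q}
    (h1 : ∀ x, i (eN x) = eM (i x)) (h2 : ∀ x, π (eM x) = eQ (π x)) :
    LinearMap.det eM = LinearMap.det eN * LinearMap.det eQ := by
  have he : LinearMap.range i ≤ (LinearMap.range i).comap eM := by
    rintro _ ⟨x, rfl⟩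
    exact ⟨eN x, h1 x⟩
  rw [LinearMap.det_eq_det_mul_det (LinearMap.range i) eM he]
  congr 1
  · rw [← LinearMap.det_conj eN (LinearEquiv.ofInjective i hi)]
    congr 1
    ext ⟨_, x, rfl⟩
    have h3 : (LinearEquiv.ofInjective i hi).symm ⟨i x, x, rfl⟩ = x := by
      rw [LinearEquiv.symm_apply_eq]; rfl
    simp [h3, h1]
  · let E : (M ⧸ LinearMap.range i) ≃ₗ[k] Q :=
      (Submodule.quotEquivOfEq _ _ h).trans (LinearMap.quotKerEquivOfSurjective π hπ)
    rw [← LinearMap.det_conj _ E]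
    congr 1
    ext y
    obtain ⟨x, rfl⟩ := hπ y
    have h3 : E.symm (π x) = Submodule.Quotient.mk x := by
      rw [LinearEquiv.symm_apply_eq]; rfl
    simp only [LinearMap.comp_apply, LinearEquiv.coe_coe, h3, Submodule.mapQ_apply]
    exact h2 x

theorem LinearMap.finrank_of_exact {k N M Q : Type*} [Field k] [AddCommGroup N] [AddCommGroup M]
    [AddCommGroup Q] [Module k N] [Module k M] [Module k Q] [Module.Finite k M]
    {i : N →ₗ[k] M} {π : M →ₗ[k] Q} (hi : Function.Injective i) (hπ : Function.Surjective π)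
    (h : LinearMap.range i = LinearMap.ker π) :
    Module.finrank k M = Module.finrank k N + Module.finrank k Q := by
  have h1 := LinearMap.finrank_range_add_finrank_ker π
  rw [LinearMap.range_eq_top.mpr hπ, finrank_top, ← h, LinearMap.finrank_range_of_inj hi] at h1
  omega

section DedekindNorm

variable {k A : Type*} [Field k] [CommRing A] [IsDedekindDomain A] [Algebra k A]

theorem Ideal.exists_exact_mul {I P : Ideal A} (hI : I ≠ ⊥) [hP : P.IsMaximal] :
    ∃ i : A ⧸ P →ₗ[A] A ⧸ (I * P), Function.Injective i ∧
      LinearMap.range i = LinearMap.ker (Ideal.Quotient.factorₐ A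
        (Ideal.mul_le_left : I * P ≤ I)).toLinearMap := by
  have hlt : ¬ I ≤ I * P := by
    intro h
    have h1 : I * P = I * ⊤ := by
      rw [Ideal.mul_top]
      exact le_antisymm Ideal.mul_le_left h
    exact hP.ne_top (mul_left_cancel₀ hI h1)
  obtain ⟨x, hxI, hx⟩ := Set.not_subset.mp hlt
  have hk : ∀ a, a * x ∈ I * P ↔ a ∈ P := by
    have h1 : P ≤ Submodule.comap (LinearMap.toSpanSingleton A A x) (I * P) := by
      intro a ha
      change a • x ∈ I * P
      rw [smul_eq_mul, mul_comm a x]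
      exact Ideal.mul_mem_mul hxI ha
    have h2 : Submodule.comap (LinearMap.toSpanSingleton A A x) (I * P) ≠ ⊤ := by
      intro h
      apply hx
      have : (1 : A) ∈ Submodule.comap (LinearMap.toSpanSingleton A A x) (I * P) := h ▸ Submodule.mem_top
      simpa using this
    have h3 := hP.eq_of_le h2 h1
    intro a
    conv_rhs => rw [h3]
    rfl
  have hsup : Ideal.span {x} ⊔ I * P = I := by
    have h1 : Ideal.span {x} ⊔ I * P ≤ I :=
      sup_le ((Ideal.span_singleton_le_iff_mem I).mpr hxI) Ideal.mul_le_left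
    obtain ⟨L, hL⟩ := Ideal.dvd_iff_le.mpr h1
    have h2 : P ≤ L := by
      have : I * P ≤ I * L := hL ▸ le_sup_right
      rw [← Ideal.dvd_iff_le] at this ⊢
      exact (mul_dvd_mul_iff_left hI).mp this
    have h3 : L = ⊤ := by
      by_contra h
      rw [← hP.eq_of_le h h2] at hL
      exact hx (hL ▸ Ideal.mem_sup_left (Ideal.mem_span_singleton_self x))
    rw [hL, h3, Ideal.mul_top]
  have hle : P ≤ LinearMap.ker
      (LinearMap.toSpanSingleton A (A ⧸ (I * P)) (Ideal.Quotient.mk _ x)) := by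
    intro a ha
    exact Ideal.Quotient.eq_zero_iff_mem.mpr ((hk a).mpr ha)
  refine ⟨Submodule.liftQ P (LinearMap.toSpanSingleton A (A ⧸ (I * P)) (Ideal.Quotient.mk _ x)) hle,
    ?_, ?_⟩
  · rw [injective_iff_map_eq_zero]
    intro a ha
    obtain ⟨a, rfl⟩ := Ideal.Quotient.mk_surjective a
    exact Ideal.Quotient.eq_zero_iff_mem.mpr
      ((hk a).mp (Ideal.Quotient.eq_zero_iff_mem.mp ha))
  · ext y
    obtain ⟨y, rfl⟩ := Ideal.Quotient.mk_surjective y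
    rw [LinearMap.mem_ker]
    constructor
    · rintro ⟨a, ha⟩
      obtain ⟨a, rfl⟩ := Ideal.Quotient.mk_surjective a
      have h1 : a * x - y ∈ I * P := Ideal.Quotient.eq.mp ha
      refine Ideal.Quotient.eq_zero_iff_mem.mpr ?_
      have := I.sub_mem (I.mul_mem_left a hxI) (Ideal.mul_le_left h1)
      rwa [sub_sub_cancel] at this
    · intro h
      have h1 : y ∈ I := Ideal.Quotient.eq_zero_iff_mem.mp h
      rw [← hsup] at h1
      obtain ⟨_, h2, b, hb, rfl⟩ := Submodule.mem_sup.mp h1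
      obtain ⟨a, rfl⟩ := Ideal.mem_span_singleton'.mp h2
      refine ⟨Ideal.Quotient.mk P a, Ideal.Quotient.eq.mpr ?_⟩
      simpa using hb

/-- The norm of an element acting on the quotient by an ideal. -/
noncomputable abbrev Ideal.quotNorm (k : Type*) {A : Type*} [Field k] [CommRing A] [Algebra k A]
    (I : Ideal A) : A →* k :=
  (Algebra.norm k (S := A ⧸ I)).comp (Ideal.Quotient.mk I : A →* A ⧸ I)


theorem Ideal.quotNorm_mul (hfin : ∀ I : Ideal A, I ≠ ⊥ → Module.Finite k (A ⧸ I))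
    {I P : Ideal A} (hI : I ≠ ⊥) (hP0 : P ≠ ⊥) [hP : P.IsMaximal] (w : A) :
    (I * P).quotNorm k w = I.quotNorm k w * P.quotNorm k w := by
  obtain ⟨i, hi, hi2⟩ := Ideal.exists_exact_mul hI (P := P)
  have := hfin (I * P) (mul_ne_zero hI hP0)
  rw [mul_comm (I.quotNorm k w)]
  refine LinearMap.det_of_exact (i := i.restrictScalars k)
    (π := (Ideal.Quotient.factorₐ A (Ideal.mul_le_left : I * P ≤ I)).toLinearMap.restrictScalars k)
    hi (Ideal.Quotient.factor_surjective Ideal.mul_le_left) ?_ ?_ ?_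
  · ext x
    exact SetLike.ext_iff.mp hi2 x
  · intro x
    exact i.map_smul w x
  · intro x
    exact (Ideal.Quotient.factorₐ A (Ideal.mul_le_left : I * P ≤ I)).toLinearMap.map_smul w x

theorem Ideal.finrank_quot_mul (hfin : ∀ I : Ideal A, I ≠ ⊥ → Module.Finite k (A ⧸ I))
    {I P : Ideal A} (hI : I ≠ ⊥) (hP0 : P ≠ ⊥) [hP : P.IsMaximal] :
    Module.finrank k (A ⧸ (I * P)) = Module.finrank k (A ⧸ I) + Module.finrank k (A ⧸ P) := by
  obtain ⟨i, hi, hi2⟩ := Ideal.exists_exact_mul hI (P := P)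
  have := hfin (I * P) (mul_ne_zero hI hP0)
  rw [add_comm]
  refine LinearMap.finrank_of_exact (i := i.restrictScalars k)
    (π := (Ideal.Quotient.factorₐ A (Ideal.mul_le_left : I * P ≤ I)).toLinearMap.restrictScalars k)
    hi (Ideal.Quotient.factor_surjective Ideal.mul_le_left) ?_
  ext x
  exact SetLike.ext_iff.mp hi2 x

/-- The product of a multiset of prime ideals. -/
noncomputable def HeightOneSpectrum.prodI (s : Multiset (HeightOneSpectrum A)) : Ideal A :=
  (s.map HeightOneSpectrum.asIdeal).prod

namespace HeightOneSpectrum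

@[simp] theorem prodI_zero : prodI (0 : Multiset (HeightOneSpectrum A)) = 1 := by simp [prodI]

@[simp] theorem prodI_add (s t : Multiset (HeightOneSpectrum A)) :
    prodI (s + t) = prodI s * prodI t := by simp [prodI]

@[simp] theorem prodI_cons (p : HeightOneSpectrum A) (t : Multiset (HeightOneSpectrum A)) :
    prodI (p ::ₘ t) = p.asIdeal * prodI t := by simp [prodI]

theorem prodI_ne_bot (s : Multiset (HeightOneSpectrum A)) : prodI s ≠ ⊥ := by
  rw [prodI, ← Ideal.zero_eq_bot, Ne, Multiset.prod_eq_zero_iff, Multiset.mem_map]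
  rintro ⟨p, -, hp⟩
  exact p.ne_bot hp

theorem prodI_injective : Function.Injective (prodI : Multiset (HeightOneSpectrum A) → Ideal A) := by
  intro s t h
  have key : ∀ s : Multiset (HeightOneSpectrum A),
      UniqueFactorizationMonoid.normalizedFactors (prodI s) = s.map HeightOneSpectrum.asIdeal := by
    intro s
    rw [prodI]
    refine UniqueFactorizationMonoid.normalizedFactors_prod_of_prime ?_
    intro I hI
    obtain ⟨p, -, rfl⟩ := Multiset.mem_map.mp hI
    exact p.prime
  have h2 := key s
  rw [h, key t] at h2
  exact (Multiset.map_injective (fun p q h => HeightOneSpectrum.ext h) h2).symm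

theorem exists_prodI_eq {I : Ideal A} (hI : I ≠ ⊥) : ∃ s, prodI s = I := by
  obtain ⟨f, hf, u, hu⟩ := UniqueFactorizationMonoid.exists_prime_factors I hI
  have hu1 : (u : Ideal A) = 1 := by
    have := u.isUnit
    rwa [Ideal.isUnit_iff, ← Ideal.one_eq_top] at this
  rw [hu1, mul_one] at hu
  clear hu1
  induction f using Multiset.induction_on generalizing I with
  | empty => exact ⟨0, by rw [← hu]; simp⟩
  | cons P f ih =>
    obtain ⟨s, hs⟩ := ih (I := f.prod) (by
        intro h
        exact hI (by rw [← hu, Multiset.prod_cons, h]; exact Ideal.mul_bot P))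
      (fun b hb => hf b (Multiset.mem_cons_of_mem hb)) rfl
    have hP := hf P (Multiset.mem_cons_self P f)
    exact ⟨⟨P, Ideal.isPrime_of_prime hP, hP.ne_zero⟩ ::ₘ s, by rw [prodI_cons, hs, ← hu]; simp⟩

theorem quotNorm_prodI (hfin : ∀ I : Ideal A, I ≠ ⊥ → Module.Finite k (A ⧸ I)) (w : A)
    (s : Multiset (HeightOneSpectrum A)) :
    (prodI s).quotNorm k w = (s.map fun p => p.asIdeal.quotNorm k w).prod := by
  induction s using Multiset.induction_on with
  | empty =>
    rw [prodI_zero, Multiset.map_zero, Multiset.prod_zero]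
    have : Subsingleton (A ⧸ (1 : Ideal A)) := Ideal.Quotient.subsingleton_iff.mpr Ideal.one_eq_top
    exact LinearMap.det_eq_one_of_subsingleton _
  | cons p s ih =>
    have := p.isMaximal
    rw [prodI_cons, mul_comm, Ideal.quotNorm_mul hfin (prodI_ne_bot s) p.ne_bot, ih, Multiset.map_cons,
      Multiset.prod_cons, mul_comm]

theorem finrank_prodI (hfin : ∀ I : Ideal A, I ≠ ⊥ → Module.Finite k (A ⧸ I))
    (s : Multiset (HeightOneSpectrum A)) :
    Module.finrank k (A ⧸ prodI s) = (s.map fun p => Module.finrank k (A ⧸ p.asIdeal)).sum := by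
  induction s using Multiset.induction_on with
  | empty =>
    rw [prodI_zero, Multiset.map_zero, Multiset.sum_zero]
    have : Subsingleton (A ⧸ (1 : Ideal A)) := Ideal.Quotient.subsingleton_iff.mpr Ideal.one_eq_top
    exact Module.finrank_zero_of_subsingleton
  | cons p s ih =>
    have := p.isMaximal
    rw [prodI_cons, mul_comm, Ideal.finrank_quot_mul hfin (prodI_ne_bot s) p.ne_bot, ih,
      Multiset.map_cons, Multiset.sum_cons, add_comm]

end HeightOneSpectrum

end DedekindNorm

namespace OnePlace
open WithZero

variable {k A K : Type*} [Field k] [CommRing A] [Field K] [Algebra k A] [Algebra A K]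
    [Algebra k K]

/-- Data fixing a ray class group: elements are compared modulo `w ^ 2` and near infinity with
powers of `w ^ M`. -/
structure Modulus (D : OnePlace k A K) where
  w : A
  e : ℕ
  M : ℕ
  hw : D.va w = exp (e : ℤ)
  he : 0 < e
  hM : 0 < M

namespace Modulus

variable {D : OnePlace k A K} (R : D.Modulus)

/-- Closeness to one at infinity. -/
def near : Subgroup Kˣ where
  carrier := {y | D.v ((y : K) - 1) ≤ exp (-(R.e : ℤ))}
  one_mem' := by simp
  mul_mem' {x y} hx hy := by
    simp only [Set.mem_ofPred_eq, Units.val_mul] at *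
    have hx1 : D.v (x : K) ≤ 1 := by
      rw [show (x : K) = (x - 1) + 1 by ring]
      refine (D.v.map_add _ _).trans (max_le (hx.trans ?_) (by simp))
      rw [← exp_zero, exp_le_exp]; omega
    rw [show (x * y - 1 : K) = x * (y - 1) + (x - 1) by ring]
    refine (D.v.map_add _ _).trans (max_le ?_ hx)
    rw [map_mul]
    exact mul_le_of_le_one_of_le hx1 hy
  inv_mem' {x} hx := by
    simp only [Set.mem_ofPred_eq] at *
    have hx1 : D.v (x : K) = 1 := by
      have h1 : D.v ((x : K) - 1) < D.v 1 := by
        rw [map_one]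
        refine hx.trans_lt ?_
        rw [← exp_zero, exp_lt_exp]
        have := R.he
        omega
      have := D.v.map_add_eq_of_lt_left h1
      rwa [add_sub_cancel, map_one] at this
    have h2 : ((x⁻¹ : Kˣ) : K) - 1 = -((x⁻¹ : Kˣ) : K) * (x - 1) := by
      rw [mul_sub, neg_mul, Units.inv_mul]; ring
    have h3 : D.v ((x⁻¹ : Kˣ) : K) = 1 := by
      rw [Units.val_inv_eq_inv_val, map_inv₀, hx1, inv_one]
    rw [h2, map_mul, Valuation.map_neg, h3, one_mul]
    exact hx

theorem mem_near {y : Kˣ} : y ∈ R.near ↔ D.v ((y : K) - 1) ≤ exp (-(R.e : ℤ)) := Iff.rfl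

theorem v_of_near {y : Kˣ} (hy : y ∈ R.near) : D.v (y : K) = 1 := by
  have h1 : D.v ((y : K) - 1) < D.v 1 := by
    rw [map_one]
    refine (R.mem_near.mp hy).trans_lt ?_
    rw [← exp_zero, exp_lt_exp]
    have := R.he
    omega
  have := D.v.map_add_eq_of_lt_left h1
  rwa [add_sub_cancel, map_one] at this

/-- The modulus element as a unit of the field. -/
noncomputable def wu : Kˣ := Units.mk0 (algebraMap A K R.w) (D.ne_zero_of_v R.hw)

theorem v_wu : D.v (R.wu : K) = exp (R.e : ℤ) := R.hw

/-- `x` is one modulo `w ^ 2` and close to `w ^ t` at infinity. -/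
def IsRay (t : ℕ) (x : A) : Prop :=
  x - 1 ∈ Ideal.span {R.w ^ 2} ∧ ∃ y ∈ R.near, algebraMap A K x = (y * R.wu ^ t : Kˣ)

theorem isRay_one : R.IsRay 0 1 := ⟨by simp, 1, R.near.one_mem, by simp⟩

variable {R}

theorem IsRay.mul {s t : ℕ} {x y : A} (hx : R.IsRay s x) (hy : R.IsRay t y) :
    R.IsRay (s + t) (x * y) := by
  obtain ⟨hx1, a, ha, hx2⟩ := hx
  obtain ⟨hy1, b, hb, hy2⟩ := hy
  refine ⟨?_, a * b, R.near.mul_mem ha hb, ?_⟩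
  · rw [show x * y - 1 = x * (y - 1) + (x - 1) by ring]
    exact Ideal.add_mem _ (Ideal.mul_mem_left _ _ hy1) hx1
  · rw [map_mul, hx2, hy2, ← Units.val_mul, pow_add, mul_mul_mul_comm]

theorem IsRay.pow {t : ℕ} {x : A} (hx : R.IsRay t x) (n : ℕ) : R.IsRay (t * n) (x ^ n) := by
  induction n with
  | zero => simpa using R.isRay_one
  | succ n ih => rw [mul_add, mul_one, pow_succ]; exact ih.mul hx

theorem IsRay.va_eq {t : ℕ} {x : A} (hx : R.IsRay t x) : D.va x = exp ((R.e * t : ℕ) : ℤ) := by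
  obtain ⟨-, a, ha, hx2⟩ := hx
  rw [va_apply, hx2, Units.val_mul, map_mul, R.v_of_near ha, one_mul, Units.val_pow_eq_pow_val,
    map_pow, R.v_wu, ← exp_nsmul]
  simp [mul_comm]

theorem IsRay.ne_zero {t : ℕ} {x : A} (hx : R.IsRay t x) : x ≠ 0 := D.ne_zero_of_va hx.va_eq

theorem isRay_iff {t : ℕ} {x : A} : R.IsRay t x ↔ x - 1 ∈ Ideal.span {R.w ^ 2} ∧
    D.va (x - R.w ^ t) ≤ exp ((R.e * t : ℤ) - R.e) := by
  have hwt : (R.wu : K) ^ t ≠ 0 := pow_ne_zero _ R.wu.ne_zero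
  have hvt : D.v ((R.wu : K) ^ t) = exp (R.e * t : ℤ) := by
    rw [map_pow, v_wu, ← exp_nsmul]; simp [mul_comm]
  have key : ∀ y : K, D.v (y * R.wu ^ t - R.wu ^ t) ≤ exp ((R.e * t : ℤ) - R.e) ↔
      D.v (y - 1) ≤ exp (-(R.e : ℤ)) := by
    intro y
    rw [show y * R.wu ^ t - R.wu ^ t = (R.wu : K) ^ t * (y - 1) by ring, map_mul, hvt,
      sub_eq_add_neg (R.e * t : ℤ), exp_mul_le_exp_add]
  refine and_congr_right fun _ => ⟨?_, fun h => ?_⟩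
  · rintro ⟨y, hy, h⟩
    rw [va_apply, map_sub, map_pow, h, Units.val_mul, Units.val_pow_eq_pow_val]
    exact (key y).mpr hy
  · have hx : algebraMap A K x ≠ 0 := by
      intro hx
      rw [va_apply, map_sub, map_pow, hx, zero_sub, Valuation.map_neg] at h
      change D.v ((R.wu : K) ^ t) ≤ _ at h
      rw [hvt, exp_le_exp] at h
      have := R.he
      omega
    refine ⟨Units.mk0 _ hx * (R.wu ^ t)⁻¹, ?_, by simp⟩
    rw [mem_near, ← key]
    rw [va_apply, map_sub, map_pow] at h
    convert h using 2
    simp [wu]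
    exact inv_mul_cancel_right₀ (b := (R.wu : K) ^ t) hwt _

variable (R)

/-- The ray monoid. -/
def ray : Submonoid A where
  carrier := {x | ∃ t, R.IsRay (R.M * t) x}
  one_mem' := ⟨0, R.isRay_one⟩
  mul_mem' := by
    rintro x y ⟨s, hs⟩ ⟨t, ht⟩
    exact ⟨s + t, by rw [mul_add]; exact hs.mul ht⟩

variable {R} in
theorem ne_zero_of_mem_ray {x : A} (hx : x ∈ R.ray) : x ≠ 0 := by
  obtain ⟨t, ht⟩ := hx
  exact ht.ne_zero

variable [IsScalarTower k A K] [Finite k] [IsDomain A] [FaithfulSMul A K]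

theorem isRay_of_mul {s t : ℕ} {x z : A} (hx : R.IsRay s x) (hxz : R.IsRay t (x * z)) :
    s ≤ t ∧ R.IsRay (t - s) z := by
  obtain ⟨i, hi⟩ := D.exists_va_eq (right_ne_zero_of_mul hxz.ne_zero)
  have h1 := hxz.va_eq
  rw [map_mul, hx.va_eq, hi, ← exp_add, exp_inj, ← Nat.cast_add, Nat.cast_inj] at h1
  have hst : s ≤ t := Nat.le_of_mul_le_mul_left (by omega) R.he
  refine ⟨hst, ?_, ?_⟩
  · rw [show z - 1 = (x * z - 1) - (x - 1) * z by ring]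
    exact Ideal.sub_mem _ hxz.1 (Ideal.mul_mem_right _ _ hx.1)
  · obtain ⟨-, a, ha, hx2⟩ := hx
    obtain ⟨-, b, hb, hy2⟩ := hxz
    refine ⟨b * a⁻¹, R.near.mul_mem hb (R.near.inv_mem ha), ?_⟩
    have h3 : algebraMap A K x ≠ 0 := by rw [hx2]; exact Units.ne_zero _
    apply mul_left_cancel₀ h3
    rw [← map_mul, hy2, hx2, ← Units.val_mul, Units.val_inj]
    rw [show b * R.wu ^ t = b * (R.wu ^ s * R.wu ^ (t - s)) by rw [← pow_add, Nat.add_sub_cancel' hst]]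
    rw [show a * R.wu ^ s * (b * a⁻¹ * R.wu ^ (t - s)) = (a * a⁻¹) * (b * (R.wu ^ s * R.wu ^ (t - s)))
      by ac_rfl]
    simp

theorem mem_ray_of_mul {x z : A} (hx : x ∈ R.ray) (hxz : x * z ∈ R.ray) : z ∈ R.ray := by
  obtain ⟨s, hs⟩ := hx
  obtain ⟨t, ht⟩ := hxz
  have h := (R.isRay_of_mul hs ht).2
  rw [← Nat.mul_sub] at h
  exact ⟨_, h⟩

theorem eq_of_span_eq {t : ℕ} {x y : A} (hx : R.IsRay t x) (hy : R.IsRay t y)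
    (h : Ideal.span {x} = Ideal.span {y}) : x = y := by
  obtain ⟨u, hu⟩ := Ideal.span_singleton_eq_span_singleton.mp h
  have hu1 := (R.isRay_of_mul hx (hu ▸ hy)).2
  rw [Nat.sub_self] at hu1
  obtain ⟨c, hc⟩ := D.const u (by have := hu1.va_eq; rw [va_apply] at this; rw [this]; simp)
  have h1 : algebraMap k A (c - 1) ∈ Ideal.span {R.w ^ 2} := by
    rw [map_sub, hc, map_one]
    exact hu1.1
  by_cases hc1 : c = 1
  · rw [← hu, ← hc, hc1]; simp
  · exfalso
    obtain ⟨b, hb⟩ := Ideal.mem_span_singleton.mp h1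
    have h2 := D.v_const_eq (sub_ne_zero.mpr hc1)
    rw [IsScalarTower.algebraMap_apply k A K, hb, ← va_apply, map_mul, map_pow, R.hw] at h2
    have hb0 : b ≠ 0 := by
      rintro rfl
      simp at h2
    obtain ⟨i, hi⟩ := D.exists_va_eq hb0
    rw [hi, ← exp_nsmul, ← exp_add, exp_eq_one] at h2
    have := R.he
    simp at h2
    omega

end Modulus
end OnePlace

namespace OnePlace
open WithZero

variable {k A K : Type*} [Field k] [CommRing A] [Field K] [Algebra k A] [Algebra A K]
    [Algebra k K]

namespace Modulus

variable {D : OnePlace k A K} (R : D.Modulus)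

/-- The primes away from the modulus. -/
abbrev Pt := {p : HeightOneSpectrum A // R.w ∉ p.asIdeal}

section
variable [IsDedekindDomain A]

/-- The ideal attached to an effective divisor away from the modulus. -/
noncomputable def pr (s : Multiset R.Pt) : Ideal A := HeightOneSpectrum.prodI (s.map Subtype.val)

@[simp] theorem pr_zero : R.pr 0 = 1 := by simp [pr]

@[simp] theorem pr_add (s t : Multiset R.Pt) : R.pr (s + t) = R.pr s * R.pr t := by simp [pr]

@[simp] theorem pr_singleton (p : R.Pt) : R.pr {p} = p.1.asIdeal := by
  simp [pr, HeightOneSpectrum.prodI]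

theorem pr_cons (p : R.Pt) (s : Multiset R.Pt) : R.pr (p ::ₘ s) = p.1.asIdeal * R.pr s := by
  simp [pr]

theorem pr_ne_bot (s : Multiset R.Pt) : R.pr s ≠ ⊥ := HeightOneSpectrum.prodI_ne_bot _

theorem pr_injective : Function.Injective R.pr :=
  HeightOneSpectrum.prodI_injective.comp (Multiset.map_injective Subtype.val_injective)

theorem isCoprime_pr (s : Multiset R.Pt) : IsCoprime (R.pr s) (Ideal.span {R.w}) := by
  induction s using Multiset.induction_on with
  | empty => rw [pr_zero]; exact isCoprime_one_left
  | cons p s ih =>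
    rw [pr_cons]
    refine IsCoprime.mul_left ?_ ih
    rw [Ideal.isCoprime_iff_sup_eq]
    refine p.1.isMaximal.out.2 _ (lt_of_le_of_ne le_sup_left ?_)
    intro h
    exact p.2 (h ▸ Ideal.mem_sup_right (Ideal.mem_span_singleton_self _))

theorem isCoprime_pr_sq (s : Multiset R.Pt) : IsCoprime (R.pr s) (Ideal.span {R.w ^ 2}) := by
  rw [← Ideal.span_singleton_pow]
  exact (R.isCoprime_pr s).pow_right

theorem exists_pr_eq {I : Ideal A} (hI : I ≠ ⊥) (hc : IsCoprime I (Ideal.span {R.w})) :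
    ∃ s, R.pr s = I := by
  obtain ⟨s, rfl⟩ := HeightOneSpectrum.exists_prodI_eq hI
  have h : ∀ p ∈ s, R.w ∉ p.asIdeal := by
    intro p hp hw
    rw [Ideal.isCoprime_iff_sup_eq] at hc
    have h1 : HeightOneSpectrum.prodI s ≤ p.asIdeal :=
      Ideal.le_of_dvd (Multiset.dvd_prod (Multiset.mem_map_of_mem _ hp))
    have h2 := sup_le h1 ((Ideal.span_singleton_le_iff_mem _).mpr hw)
    rw [hc] at h2
    exact p.isPrime.ne_top (top_le_iff.mp h2)
  lift s to Multiset R.Pt using h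
  exact ⟨s, rfl⟩

theorem exists_pr_eq_span {z : A} (hz0 : z ≠ 0) (hz : IsCoprime z R.w) :
    ∃ s, R.pr s = Ideal.span {z} := by
  refine R.exists_pr_eq (by rwa [Ne, Ideal.span_singleton_eq_bot]) ?_
  exact (Ideal.isCoprime_span_singleton_iff z R.w).mpr hz

end

theorem IsRay.isCoprime {t : ℕ} {z : A} (hz : R.IsRay t z) : IsCoprime z R.w := by
  obtain ⟨b, hb⟩ := Ideal.mem_span_singleton.mp hz.1
  exact ⟨1, -(R.w * b), by linear_combination hb⟩

/-- The degree of a prime. -/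
noncomputable def deg (p : R.Pt) : ℕ := Module.finrank k (A ⧸ p.1.asIdeal)

/-- The degree of an effective divisor. -/
noncomputable def degS (s : Multiset R.Pt) : ℕ := (s.map R.deg).sum

@[simp] theorem degS_add (s t : Multiset R.Pt) : R.degS (s + t) = R.degS s + R.degS t := by
  simp [degS]

@[simp] theorem degS_singleton (p : R.Pt) : R.degS {p} = R.deg p := by simp [degS]

variable [IsScalarTower k A K] [Finite k] [IsDedekindDomain A] [FaithfulSMul A K]

theorem finrank_pr (s : Multiset R.Pt) : Module.finrank k (A ⧸ R.pr s) = R.degS s := by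
  rw [pr, HeightOneSpectrum.finrank_prodI (fun I hI => D.module_finite_quot_ideal hI), degS,
    Multiset.map_map]
  rfl

theorem finrank_mul_ideal (D : OnePlace k A K) {I J : Ideal A} (hI : I ≠ ⊥) (hJ : J ≠ ⊥) :
    Module.finrank k (A ⧸ (I * J)) = Module.finrank k (A ⧸ I) + Module.finrank k (A ⧸ J) := by
  obtain ⟨s, rfl⟩ := HeightOneSpectrum.exists_prodI_eq hI
  obtain ⟨t, rfl⟩ := HeightOneSpectrum.exists_prodI_eq hJ
  have hf : ∀ I : Ideal A, I ≠ ⊥ → Module.Finite k (A ⧸ I) :=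
    fun I hI => D.module_finite_quot_ideal hI
  rw [← HeightOneSpectrum.prodI_add, HeightOneSpectrum.finrank_prodI hf,
    HeightOneSpectrum.finrank_prodI hf, HeightOneSpectrum.finrank_prodI hf, Multiset.map_add,
    Multiset.sum_add]

theorem deg_pos (p : R.Pt) : 0 < R.deg p := by
  have := D.module_finite_quot_ideal p.1.ne_bot
  have : Nontrivial (A ⧸ p.1.asIdeal) := Ideal.Quotient.nontrivial_iff.mpr p.1.isPrime.ne_top
  exact Module.finrank_pos


theorem exists_small_mem (D : OnePlace k A K) {I : Ideal A} (hI : I ≠ ⊥) :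
    ∃ c ∈ I, ∃ i : ℕ, D.va c = exp (i : ℤ) ∧
      D.f * i ≤ D.f * (D.j0 + 1) + Module.finrank k (A ⧸ I) := by
  set β := Module.finrank k (A ⧸ I) with hβ
  have hf := D.f_pos
  have h1 : β < D.dimV (D.j0 + (β / D.f + 1 : ℕ)) := by
    rw [D.finrank_V _ _ le_rfl]
    have := Nat.lt_mul_div_succ β hf
    omega
  obtain ⟨c, hc, hc0, hcv⟩ := D.exists_mem_ideal hI h1
  obtain ⟨i, hi⟩ := D.exists_va_eq hc0
  refine ⟨c, hc, i, hi, ?_⟩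
  rw [hi, exp_le_exp] at hcv
  have h2 : i ≤ D.j0 + (β / D.f + 1) := by exact_mod_cast hcv
  calc D.f * i ≤ D.f * (D.j0 + (β / D.f + 1)) := Nat.mul_le_mul_left _ h2
    _ = D.f * (D.j0 + 1) + D.f * (β / D.f) := by ring
    _ ≤ _ := by gcongr; exact Nat.mul_div_le β D.f

theorem finite_degS (m : ℕ) : {s : Multiset R.Pt | R.degS s = m}.Finite := by
  set j : ℤ := D.j0 + (m / D.f + 1 : ℕ)
  have h1 : m < D.dimV j := by
    rw [D.finrank_V _ _ le_rfl]
    have := Nat.lt_mul_div_succ m D.f_pos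
    omega
  have hfin : (⋃ x ∈ {x : A | D.va x ≤ exp j ∧ x ≠ 0}, {I : Ideal A | x ∈ I}).Finite := by
    refine Set.Finite.biUnion ((D.fin j).subset fun x hx => hx.1) ?_
    intro x hx
    exact D.finite_ideals_mem hx.2
  refine Set.Finite.of_finite_image (f := R.pr) (hfin.subset ?_) R.pr_injective.injOn
  rintro _ ⟨s, hs, rfl⟩
  have hs' : R.degS s = m := hs
  rw [← hs', ← finrank_pr] at h1
  obtain ⟨x, hx, hx0, hxv⟩ := D.exists_mem_ideal (R.pr_ne_bot s) h1
  exact Set.mem_biUnion (x := x) ⟨hxv, hx0⟩ hx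

theorem exists_isRay_mem {I : Ideal A} (hI : IsCoprime I (Ideal.span {R.w ^ 2})) {c : A}
    (hc : c ∈ I) {i : ℕ} (hi : D.va c = exp (i : ℤ)) {t : ℕ}
    (ht : i + 3 * R.e + D.j0 ≤ R.e * t) : ∃ z ∈ I, R.IsRay t z := by
  obtain ⟨a₀, ha, b, hb, hab⟩ := Ideal.isCoprime_iff_exists.mp hI
  have hb' : c * R.w ^ 2 ∈ I ⊓ Ideal.span {R.w ^ 2} :=
    ⟨Ideal.mul_mem_right _ _ hc, Ideal.mul_mem_left _ _ (Ideal.mem_span_singleton_self _)⟩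
  have hv : D.va (c * R.w ^ 2) = exp (i + 2 * R.e : ℤ) := by
    rw [map_mul, map_pow, hi, R.hw, ← exp_nsmul, ← exp_add]
    simp
  obtain ⟨z, hz1, hz2⟩ := D.approx_ideal hb' hv a₀ (algebraMap A K (R.w ^ t))
  refine ⟨z, ?_, ?_⟩
  · have := I.add_mem hz1.1 ha
    rwa [sub_add_cancel] at this
  · rw [isRay_iff]
    refine ⟨?_, ?_⟩
    · rw [show z - 1 = (z - a₀) - b by linear_combination hab]
      exact Ideal.sub_mem _ hz1.2 hb
    · rw [Valuation.map_sub_swap, va_apply, map_sub]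
      refine hz2.trans (exp_le_exp.mpr ?_)
      have : ((i + 3 * R.e + D.j0 : ℕ) : ℤ) ≤ (R.e * t : ℕ) := by exact_mod_cast ht
      push_cast at this
      linarith

theorem exists_bound : ∃ B, ∀ s, ∃ s', R.degS s' ≤ B ∧
    ∃ z ∈ R.ray, R.pr s * R.pr s' = Ideal.span {z} := by
  refine ⟨D.f * (2 * D.j0 + 1 + 3 * R.e + R.e * R.M), fun s => ?_⟩
  obtain ⟨c, hc, i, hi, hi2⟩ := exists_small_mem D (R.pr_ne_bot s)
  have heM : 0 < R.e * R.M := Nat.mul_pos R.he R.hM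
  set t := (i + 3 * R.e + D.j0) / (R.e * R.M) + 1 with ht
  have h1 : i + 3 * R.e + D.j0 ≤ R.e * R.M * t := (Nat.lt_mul_div_succ _ heM).le
  have h2 : R.e * R.M * t ≤ i + 3 * R.e + D.j0 + R.e * R.M := by
    rw [ht, mul_add, mul_one]
    gcongr
    exact Nat.mul_div_le _ _
  rw [mul_assoc] at h1
  obtain ⟨z, hz, hzr⟩ := R.exists_isRay_mem (R.isCoprime_pr_sq s) hc hi h1
  obtain ⟨J, hJ⟩ := Ideal.dvd_iff_le.mpr ((Ideal.span_singleton_le_iff_mem _).mpr hz)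
  obtain ⟨u, hu⟩ := R.exists_pr_eq_span hzr.ne_zero hzr.isCoprime
  have hJ0 : J ≠ ⊥ := by
    rintro rfl
    rw [← hu] at hJ
    exact R.pr_ne_bot u (hJ.trans (Ideal.mul_bot _))
  have hJc : IsCoprime J (Ideal.span {R.w}) := by
    have := R.isCoprime_pr u
    rw [hu, hJ] at this
    exact this.of_mul_left_right
  obtain ⟨s', rfl⟩ := R.exists_pr_eq hJ0 hJc
  refine ⟨s', ?_, z, ⟨t, hzr⟩, hJ.symm⟩
  have h3 := finrank_mul_ideal D (R.pr_ne_bot s) (R.pr_ne_bot s')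
  rw [← hJ, D.finrank_quot hzr.va_eq, finrank_pr, finrank_pr] at h3
  rw [finrank_pr] at hi2
  have h4 : D.f * (R.e * (R.M * t)) ≤ D.f * (i + 3 * R.e + D.j0 + R.e * R.M) :=
    Nat.mul_le_mul_left _ (by rw [← mul_assoc]; exact h2)
  have h5 : D.f * (2 * D.j0 + 1 + 3 * R.e + R.e * R.M) =
    D.f * (D.j0 + 1) + D.f * (3 * R.e + D.j0 + R.e * R.M) := by ring
  have h6 : D.f * (i + 3 * R.e + D.j0 + R.e * R.M) =
    D.f * i + D.f * (3 * R.e + D.j0 + R.e * R.M) := by ring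
  omega

/-- The ray class relation. -/
noncomputable def con : AddCon (Multiset R.Pt) where
  r s s' := ∃ x ∈ R.ray, ∃ x' ∈ R.ray, Ideal.span {x} * R.pr s = Ideal.span {x'} * R.pr s'
  iseqv := by
    refine ⟨fun s => ⟨1, R.ray.one_mem, 1, R.ray.one_mem, rfl⟩, ?_, ?_⟩
    · rintro s t ⟨x, hx, y, hy, h⟩
      exact ⟨y, hy, x, hx, h.symm⟩
    · rintro s t u ⟨x, hx, y, hy, h⟩ ⟨x', hx', y', hy', h'⟩
      refine ⟨x * x', R.ray.mul_mem hx hx', y * y', R.ray.mul_mem hy hy', ?_⟩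
      rw [← Ideal.span_singleton_mul_span_singleton, ← Ideal.span_singleton_mul_span_singleton,
        mul_right_comm, h, mul_right_comm, mul_assoc, h', mul_assoc]
  add' := by
    rintro s t u v ⟨x, hx, y, hy, h⟩ ⟨x', hx', y', hy', h'⟩
    refine ⟨x * x', R.ray.mul_mem hx hx', y * y', R.ray.mul_mem hy hy', ?_⟩
    rw [← Ideal.span_singleton_mul_span_singleton, ← Ideal.span_singleton_mul_span_singleton,
      pr_add, pr_add, mul_mul_mul_comm, h, h', mul_mul_mul_comm]

/-- The ray class group. -/
abbrev Cl := R.con.Quotient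

/-- The class of an effective divisor. -/
noncomputable def clOf : Multiset R.Pt →+ R.Cl := R.con.mk'

theorem clOf_surjective : Function.Surjective R.clOf := AddCon.mk'_surjective

theorem clOf_eq_clOf {s t : Multiset R.Pt} : R.clOf s = R.clOf t ↔
    ∃ x ∈ R.ray, ∃ x' ∈ R.ray, Ideal.span {x} * R.pr s = Ideal.span {x'} * R.pr t :=
  AddCon.eq _

theorem clOf_eq_zero {s : Multiset R.Pt} : R.clOf s = 0 ↔ ∃ z ∈ R.ray, R.pr s = Ideal.span {z} := by
  rw [← map_zero R.clOf, clOf_eq_clOf]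
  constructor
  · rintro ⟨x, hx, y, hy, h⟩
    rw [pr_zero, mul_one] at h
    have h1 : x ∣ y := by
      rw [← Ideal.mem_span_singleton, ← Ideal.span_singleton_le_iff_mem, ← h]
      exact Ideal.mul_le_left
    obtain ⟨z, rfl⟩ := h1
    refine ⟨z, R.mem_ray_of_mul hx hy, ?_⟩
    rw [← Ideal.span_singleton_mul_span_singleton] at h
    exact mul_left_cancel₀ (by
      rw [Ideal.zero_eq_bot, Ne, Ideal.span_singleton_eq_bot]; exact ne_zero_of_mem_ray hx) h
  · rintro ⟨z, hz, h⟩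
    exact ⟨1, R.ray.one_mem, z, hz, by rw [h]; simp⟩

theorem exists_neg (g : R.Cl) : ∃ h, h + g = 0 := by
  obtain ⟨s, rfl⟩ := R.clOf_surjective g
  obtain ⟨B, hB⟩ := R.exists_bound
  obtain ⟨s', -, z, hz, h⟩ := hB s
  refine ⟨R.clOf s', ?_⟩
  rw [← map_add, clOf_eq_zero]
  exact ⟨z, hz, by rw [pr_add, mul_comm, h]⟩

noncomputable instance : Neg R.Cl := ⟨fun g => (R.exists_neg g).choose⟩

noncomputable instance : AddCommGroup R.Cl where
  toAddCommMonoid := inferInstance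
  neg g := (R.exists_neg g).choose
  zsmul := zsmulRec
  neg_add_cancel g := (R.exists_neg g).choose_spec

instance : Finite R.Cl := by
  obtain ⟨B, hB⟩ := R.exists_bound
  have hf : Finite {s : Multiset R.Pt | R.degS s ≤ B} := by
    have : {s : Multiset R.Pt | R.degS s ≤ B} = ⋃ m ∈ Set.Iic B, {s | R.degS s = m} := by
      ext s; simp
    rw [this]
    exact (Set.Finite.biUnion (Set.finite_Iic B) fun m _ => R.finite_degS m).to_subtype
  refine Finite.of_surjective (fun s : {s : Multiset R.Pt | R.degS s ≤ B} => -R.clOf s) ?_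
  intro g
  obtain ⟨s, rfl⟩ := R.clOf_surjective g
  obtain ⟨s', hs', z, hz, h⟩ := hB s
  refine ⟨⟨s', hs'⟩, ?_⟩
  beta_reduce
  rw [neg_eq_iff_add_eq_zero, ← map_add, clOf_eq_zero]
  exact ⟨z, hz, by rw [pr_add, mul_comm, h]⟩

end Modulus
end OnePlace

namespace OnePlace
open WithZero

variable {k A K : Type*} [Field k] [CommRing A] [Field K] [Algebra k A] [Algebra A K]
    [Algebra k K]

namespace Modulus

variable {D : OnePlace k A K} (R : D.Modulus)
variable [IsScalarTower k A K] [Finite k] [IsDedekindDomain A] [FaithfulSMul A K]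

theorem finrank_span_sq : Module.finrank k (A ⧸ Ideal.span {R.w ^ 2}) = 2 * (D.f * R.e) := by
  have : D.va (R.w ^ 2) = exp ((2 * R.e : ℕ) : ℤ) := by
    rw [map_pow, R.hw, ← exp_nsmul]; simp
  rw [D.finrank_quot this]
  ring

theorem ncard_isRay (s : Multiset R.Pt) : ∃ t₀ : ℕ, ∀ t : ℕ, t₀ ≤ t → ∃ d : ℕ,
    (d : ℤ) = D.f * R.e * t + (D.dimV D.j0 - D.f * D.j0 - 3 * (D.f * R.e)) - R.degS s ∧
    {z | z ∈ R.pr s ∧ R.IsRay t z}.ncard = Nat.card k ^ d := by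
  obtain ⟨c, hc, i, hi, -⟩ := exists_small_mem D (R.pr_ne_bot s)
  refine ⟨i + 3 * R.e + D.j0, fun t ht => ?_⟩
  have he := R.he
  have hle : i + 3 * R.e + D.j0 ≤ R.e * t := ht.trans (Nat.le_mul_of_pos_left _ he)
  obtain ⟨z₀, hz₀, hr₀⟩ := R.exists_isRay_mem (R.isCoprime_pr_sq s) hc hi hle
  obtain ⟨d, hd⟩ := Nat.exists_eq_add_of_le hle
  have hj : ((R.e * t : ℤ) - R.e) = (D.j0 : ℕ) + (i + 2 * R.e + d : ℕ) := by
    have : ((R.e * t : ℕ) : ℤ) = ((i + 3 * R.e + D.j0 + d : ℕ) : ℤ) := by rw [hd]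
    push_cast at this ⊢
    linarith
  set I := R.pr s * Ideal.span {R.w ^ 2} with hI
  have hw2 : Ideal.span {R.w ^ 2} ≠ ⊥ := by
    rw [Ne, Ideal.span_singleton_eq_bot]
    exact pow_ne_zero _ (D.ne_zero_of_va R.hw)
  have hI2 : I = R.pr s ⊓ Ideal.span {R.w ^ 2} :=
    Ideal.mul_eq_inf_of_coprime (Ideal.isCoprime_iff_sup_eq.mp (R.isCoprime_pr_sq s))
  have hI0 : I ≠ ⊥ := mul_ne_zero (R.pr_ne_bot s) hw2
  have hfr := finrank_mul_ideal D (R.pr_ne_bot s) hw2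
  rw [finrank_pr, finrank_span_sq, ← hI] at hfr
  let L : D.V (R.e * t - R.e) →ₗ[k] A ⧸ I :=
    (Ideal.Quotient.mkₐ k I).toLinearMap.comp (D.V _).subtype
  have hL : Function.Surjective L := by
    intro y
    obtain ⟨y, rfl⟩ := Ideal.Quotient.mk_surjective y
    have hb : c * R.w ^ 2 ∈ I := Ideal.mul_mem_mul hc (Ideal.mem_span_singleton_self _)
    have hv : D.va (c * R.w ^ 2) = exp (i + 2 * R.e : ℤ) := by
      rw [map_mul, map_pow, hi, R.hw, ← exp_nsmul, ← exp_add]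
      simp
    obtain ⟨a, ha, ha2⟩ := D.approx_ideal hb hv y 0
    rw [zero_sub, Valuation.map_neg] at ha2
    refine ⟨⟨a, ?_⟩, Ideal.Quotient.eq.mpr ha⟩
    refine D.mem_V.mpr (ha2.trans (exp_le_exp.mpr ?_))
    rw [hj]; push_cast; omega
  have hk := LinearMap.finrank_range_add_finrank_ker L
  rw [LinearMap.range_eq_top.mpr hL, finrank_top, hfr, ← dimV] at hk
  have hk := hk.trans ((congrArg D.dimV hj).trans (D.finrank_V _ _ le_rfl))
  refine ⟨Module.finrank k (LinearMap.ker L), ?_, ?_⟩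
  · have h1 : ((D.f * (R.e * t) : ℕ) : ℤ) = (D.f * (i + 3 * R.e + D.j0 + d) : ℕ) := by rw [hd]
    have h2 : ((R.degS s + 2 * (D.f * R.e) + Module.finrank k (LinearMap.ker L) : ℕ) : ℤ) =
      (D.dimV D.j0 + D.f * (i + 2 * R.e + d) : ℕ) := by rw [hk]
    push_cast at h1 h2
    linarith
  · rw [← Module.natCard_eq_pow_finrank (K := k) (V := LinearMap.ker L)]
    have hinj : Function.Injective (fun y : LinearMap.ker L => z₀ + (y.1 : A)) := by
      intro y y' h
      exact Subtype.ext (Subtype.ext (add_left_cancel h))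
    rw [← Nat.card_range_of_injective hinj, ← Nat.card_coe_set_eq]
    congr 2
    ext z
    rw [Set.mem_range]
    have hker : ∀ y : D.V (R.e * t - R.e), y ∈ LinearMap.ker L ↔ (y : A) ∈ I := by
      intro y
      rw [LinearMap.mem_ker]
      exact Ideal.Quotient.eq_zero_iff_mem
    obtain ⟨h01, h02⟩ := isRay_iff.mp hr₀
    constructor
    · rintro ⟨hz, hr⟩
      obtain ⟨h1, h2⟩ := isRay_iff.mp hr
      have hv : z - z₀ ∈ D.V (R.e * t - R.e) := by
        rw [mem_V, show z - z₀ = (z - R.w ^ t) - (z₀ - R.w ^ t) by ring]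
        exact (Valuation.map_sub _ _ _).trans (max_le h2 h02)
      refine ⟨⟨⟨z - z₀, hv⟩, (hker _).mpr ?_⟩, by simp⟩
      rw [hI2]
      refine ⟨Ideal.sub_mem _ hz hz₀, ?_⟩
      have := Ideal.sub_mem _ h1 h01
      rwa [sub_sub_sub_cancel_right] at this
    · rintro ⟨⟨⟨y, hyv⟩, hy⟩, rfl⟩
      rw [hker, hI2] at hy
      refine ⟨Ideal.add_mem _ hz₀ hy.1, isRay_iff.mpr ⟨?_, ?_⟩⟩
      · rw [show z₀ + y - 1 = (z₀ - 1) + y by ring]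
        exact Ideal.add_mem _ h01 hy.2
      · rw [show z₀ + y - R.w ^ t = (z₀ - R.w ^ t) + y by ring]
        exact (Valuation.map_add _ _ _).trans (max_le h02 hyv)

/-- The period of the degree. -/
noncomputable def N : ℕ := D.f * R.e * R.M

theorem N_pos : 0 < R.N := Nat.mul_pos (Nat.mul_pos D.f_pos R.he) R.hM

theorem finrank_span_of_mem_ray {x : A} (hx : x ∈ R.ray) :
    R.N ∣ Module.finrank k (A ⧸ Ideal.span {x}) := by
  obtain ⟨t, ht⟩ := hx
  rw [D.finrank_quot ht.va_eq]
  exact ⟨t, by rw [N]; ring⟩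

/-- The degree of a class. -/
noncomputable def degCl : R.Cl →+ ZMod R.N :=
  R.con.lift
    { toFun := fun s => ((R.degS s : ℕ) : ZMod R.N)
      map_zero' := by simp [degS]
      map_add' := fun s t => by simp }
    (by
      rintro s t ⟨x, hx, y, hy, h⟩
      have h0 : ∀ {x}, x ∈ R.ray → Ideal.span {x} ≠ ⊥ := fun hx => by
        rw [Ne, Ideal.span_singleton_eq_bot]; exact ne_zero_of_mem_ray hx
      have h1 := finrank_mul_ideal D (h0 hx) (R.pr_ne_bot s)
      rw [h, finrank_mul_ideal D (h0 hy) (R.pr_ne_bot t), finrank_pr, finrank_pr] at h1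
      have h2 := congrArg (Nat.cast (R := ZMod R.N)) h1
      rw [Nat.cast_add, Nat.cast_add, (ZMod.natCast_eq_zero_iff _ _).mpr (R.finrank_span_of_mem_ray hx),
        (ZMod.natCast_eq_zero_iff _ _).mpr (R.finrank_span_of_mem_ray hy), zero_add, zero_add] at h2
      exact h2.symm)

theorem degCl_clOf (s : Multiset R.Pt) : R.degCl (R.clOf s) = (R.degS s : ℕ) := rfl

theorem ncard_class {b : Multiset R.Pt} {m t : ℕ} (h : R.N * t = m + R.degS b) :
    {s : Multiset R.Pt | R.degS s = m ∧ R.clOf s = -R.clOf b}.ncard =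
      {z | z ∈ R.pr b ∧ R.IsRay (R.M * t) z}.ncard := by
  have key : ∀ s, R.degS s = m ∧ R.clOf s = -R.clOf b →
      ∃ z, (z ∈ R.pr b ∧ R.IsRay (R.M * t) z) ∧ R.pr (s + b) = Ideal.span {z} := by
    rintro s ⟨h1, h2⟩
    rw [← add_eq_zero_iff_eq_neg, ← map_add, clOf_eq_zero] at h2
    obtain ⟨z, ⟨t', hz⟩, h3⟩ := h2
    refine ⟨z, ⟨?_, ?_⟩, h3⟩
    · rw [pr_add] at h3
      have : Ideal.span {z} ≤ R.pr b := h3 ▸ Ideal.mul_le_right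
      exact this (Ideal.mem_span_singleton_self z)
    · have h4 := R.finrank_pr (s + b)
      rw [h3, D.finrank_quot hz.va_eq, degS_add, h1, ← h, N] at h4
      have h5 : D.f * R.e * R.M * t' = D.f * R.e * R.M * t := by rw [← h4]; ring
      have h6 := Nat.eq_of_mul_eq_mul_left R.N_pos h5
      rwa [h6] at hz
  refine Set.ncard_congr (fun s hs => (key s hs).choose) ?_ ?_ ?_
  · intro s hs
    exact (key s hs).choose_spec.1
  · intro s s' hs hs' h
    have h1 := (key s hs).choose_spec.2
    have h2 := (key s' hs').choose_spec.2
    beta_reduce at h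
    rw [h, ← h2] at h1
    exact add_right_cancel (R.pr_injective h1)
  · rintro z ⟨hz, hr⟩
    obtain ⟨J, hJ⟩ := Ideal.dvd_iff_le.mpr ((Ideal.span_singleton_le_iff_mem _).mpr hz)
    obtain ⟨u, hu⟩ := R.exists_pr_eq_span hr.ne_zero hr.isCoprime
    have hJ0 : J ≠ ⊥ := by
      rintro rfl
      rw [← hu] at hJ
      exact R.pr_ne_bot u (hJ.trans (Ideal.mul_bot _))
    have hJc : IsCoprime J (Ideal.span {R.w}) := by
      have := R.isCoprime_pr u
      rw [hu, hJ] at this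
      exact this.of_mul_left_right
    obtain ⟨s, rfl⟩ := R.exists_pr_eq hJ0 hJc
    have h1 : R.pr (s + b) = Ideal.span {z} := by rw [pr_add, mul_comm, hJ]
    have hs : R.degS s = m ∧ R.clOf s = -R.clOf b := by
      constructor
      · have h4 := R.finrank_pr (s + b)
        rw [h1, D.finrank_quot hr.va_eq, degS_add] at h4
        have : D.f * (R.e * (R.M * t)) = R.N * t := by rw [N]; ring
        omega
      · rw [← add_eq_zero_iff_eq_neg, ← map_add, clOf_eq_zero]
        exact ⟨z, ⟨t, hr⟩, h1⟩
    refine ⟨s, hs, ?_⟩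
    refine R.eq_of_span_eq (key s hs).choose_spec.1.2 hr ?_
    rw [← (key s hs).choose_spec.2, h1]

/-- The constant in the count of effective divisors. -/
noncomputable def cst : ℝ := (Nat.card k : ℝ) ^ (D.dimV D.j0 - D.f * D.j0 - 3 * (D.f * R.e) : ℤ)

theorem card_pos' (k : Type*) [Field k] [Finite k] : (0 : ℝ) < Nat.card k := by
  have := Finite.one_lt_card (α := k)
  exact_mod_cast (by omega : 0 < Nat.card k)

theorem exists_count_class (g : R.Cl) : ∃ m₀ : ℕ, ∀ m : ℕ, m₀ ≤ m →
    ({s : Multiset R.Pt | R.degS s = m ∧ R.clOf s = g}.ncard : ℝ) =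
      if (m : ZMod R.N) = R.degCl g then R.cst * (Nat.card k : ℝ) ^ m else 0 := by
  obtain ⟨b, hb⟩ := R.clOf_surjective (-g)
  obtain ⟨t₀, ht₀⟩ := R.ncard_isRay b
  have hg : g = -R.clOf b := by rw [hb, neg_neg]
  refine ⟨R.N * t₀, fun m hm => ?_⟩
  subst hg
  split_ifs with h
  · rw [map_neg, degCl_clOf, ← add_eq_zero_iff_eq_neg, ← Nat.cast_add, ZMod.natCast_eq_zero_iff] at h
    obtain ⟨t, ht⟩ := h
    have h1 : t₀ ≤ t := by
      by_contra hlt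
      have := Nat.mul_lt_mul_of_pos_left (not_le.mp hlt) R.N_pos
      omega
    obtain ⟨d, hd, hd2⟩ := ht₀ (R.M * t) (h1.trans (Nat.le_mul_of_pos_left _ R.hM))
    rw [R.ncard_class ht.symm, hd2, Nat.cast_pow, cst, ← zpow_natCast, ← zpow_natCast _ m,
      ← zpow_add₀ (card_pos' k).ne', hd]
    congr 1
    have h2 : ((m + R.degS b : ℕ) : ℤ) = ((R.N * t : ℕ) : ℤ) := by rw [ht]
    rw [N] at h2
    push_cast at h2 ⊢
    linarith
  · rw [Nat.cast_eq_zero]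
    convert Set.ncard_empty (Multiset R.Pt)
    ext s
    simp only [Set.mem_ofPred_eq, Set.mem_empty_iff_false, iff_false]
    rintro ⟨rfl, h2⟩
    exact h (by rw [← h2, degCl_clOf])

theorem sum_cl (s : Multiset R.Pt) : (s.map fun p => R.clOf {p}).sum = R.clOf s := by
  conv_rhs => rw [← Multiset.sum_map_singleton s, map_multiset_sum, Multiset.map_map]
  rfl

theorem exists_count : ∃ m₀ : ℕ, ∀ m : ℕ, m₀ ≤ m → ∀ g : R.Cl,
    ({s : Multiset R.Pt | R.degS s = m ∧ R.clOf s = g}.ncard : ℝ) =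
      if (m : ZMod R.N) = R.degCl g then R.cst * (Nat.card k : ℝ) ^ m else 0 := by
  have := Fintype.ofFinite R.Cl
  choose f hf using R.exists_count_class
  exact ⟨Finset.univ.sup f, fun m hm g => hf g m ((Finset.le_sup (Finset.mem_univ g)).trans hm)⟩

/-- The data for the abstract prime number theorem. -/
noncomputable def classData : AbsPNT.ClassData R.Pt R.Cl where
  deg := R.deg
  cl p := R.clOf {p}
  q := Nat.card k
  C := R.cst
  N := R.N
  m0 := R.exists_count.choose
  δ := R.degCl
  deg_pos := R.deg_pos
  one_lt_q := by exact_mod_cast Finite.one_lt_card (α := k)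
  C_pos := zpow_pos (card_pos' k) _
  N_pos := R.N_pos
  hfin := R.finite_degS
  count m hm g := by
    have h := R.exists_count.choose_spec m hm g
    rw [← h]
    simp only [sum_cl]
    rfl

/-- Every ray class contains primes of large degree. -/
theorem exists_prime_of_class (g : R.Cl) (d : ℕ) : ∃ p : R.Pt, R.clOf {p} = g ∧ d ≤ R.deg p := by
  have := Fintype.ofFinite R.Cl
  exact R.classData.exists_prime_of_class g d

end Modulus
end OnePlace

namespace OnePlace
open WithZero

variable {k A K : Type*} [Field k] [CommRing A] [Field K] [Algebra k A] [Algebra A K]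
    [Algebra k K] (D : OnePlace k A K)

theorem mul_mem_O {y z : K} (hy : D.v y ≤ 1) {i : ℤ} (hz : z ∈ D.O i) : y * z ∈ D.O i := by
  rw [mem_O, map_mul]
  exact mul_le_of_le_one_of_le hy hz

/-- Multiplication by an integral element on a graded piece. -/
noncomputable def grMul {y : K} (hy : D.v y ≤ 1) (i j : ℤ) : D.gr i j →ₗ[k] D.gr i j :=
  Submodule.mapQ _ _ ((LinearMap.mulLeft k y).restrict (p := D.O j) (q := D.O j)
    (fun _ hz => D.mul_mem_O hy hz)) (fun _ hz => D.mul_mem_O hy hz)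

theorem gr_mk_eq {i j : ℤ} {a b : D.O j} :
    (Submodule.Quotient.mk a : D.gr i j) = Submodule.Quotient.mk b ↔
      D.v ((a : K) - b) ≤ exp i := by
  rw [Submodule.Quotient.eq]; rfl

theorem grMul_eq_id {y : K} (hy : D.v y ≤ 1) {e : ℤ} (h : D.v (y - 1) ≤ exp (-e)) (i : ℤ) {j : ℤ}
    (hj : j = i + e) :
    D.grMul hy i j = LinearMap.id := by
  subst hj
  ext ⟨z, hz⟩
  refine D.gr_mk_eq.mpr ?_
  change D.v (y * z - z) ≤ _
  rw [show y * z - z = (y - 1) * z by ring, map_mul]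
  calc D.v (y - 1) * D.v z ≤ exp (-e) * exp (i + e) := mul_le_mul' h hz
    _ = exp i := by rw [← exp_add]; congr 1; ring

variable [IsScalarTower k A K]

theorem grMul_shift {y : K} (hy : D.v y ≤ 1) (d i j : ℤ) {i' j' : ℤ} (hi : i' = d + i)
    (hj : j' = d + j) :
    LinearMap.det (D.grMul hy i' j') = LinearMap.det (D.grMul hy i j) := by
  subst hi hj
  obtain ⟨z, hz⟩ := D.exists_v_eq d
  rw [← LinearMap.det_conj (D.grMul hy i j) (D.mulGr hz i j)]
  congr 1
  refine LinearMap.ext fun a => ?_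
  obtain ⟨a, rfl⟩ := (D.mulGr hz i j).surjective a
  obtain ⟨a, rfl⟩ := Submodule.mkQ_surjective _ a
  rw [LinearMap.comp_apply, LinearMap.comp_apply, LinearEquiv.coe_coe, LinearEquiv.coe_coe,
    LinearEquiv.symm_apply_apply]
  refine D.gr_mk_eq.mpr ?_
  change D.v (y * (z * a) - z * (y * a)) ≤ _
  rw [show y * (z * a) - z * (y * a) = 0 by ring, map_zero]
  exact zero_le

variable [Finite k]

theorem finite_gr {i j : ℤ} (h : i ≤ j) : Module.Finite k (D.gr i j) := by
  obtain ⟨z, hz⟩ := D.exists_v_eq (D.j0 - i)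
  have : Module.Finite k (D.gr (D.j0 - i + i) (D.j0 - i + j)) :=
    Module.Finite.of_surjective _ (D.toGr_surjective (by omega) (by omega))
  exact Module.Finite.equiv (D.mulGr hz i j).symm

theorem det_grMul_trans {y : K} (hy : D.v y ≤ 1) {i m j : ℤ} (h1 : i ≤ m) (h2 : m ≤ j) :
    LinearMap.det (D.grMul hy i j) =
      LinearMap.det (D.grMul hy i m) * LinearMap.det (D.grMul hy m j) := by
  have := D.finite_gr (h1.trans h2)
  let f : D.gr i m →ₗ[k] D.gr i j := Submodule.mapQ _ _ (Submodule.inclusion (D.O_mono h2))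
    (fun _ h => h)
  let g : D.gr i j →ₗ[k] D.gr m j := Submodule.mapQ _ _ LinearMap.id
    (fun _ h => D.O_mono h1 h)
  refine LinearMap.det_of_exact (i := f) (π := g) ?_ ?_ ?_ ?_ ?_
  · rw [injective_iff_map_eq_zero]
    intro z h
    obtain ⟨z, rfl⟩ := Submodule.mkQ_surjective _ z
    refine (Submodule.Quotient.mk_eq_zero _).mpr ?_
    have h' : (Submodule.Quotient.mk ⟨z, D.O_mono h2 z.2⟩ : D.gr i j) = 0 := h
    have h3 := (Submodule.Quotient.mk_eq_zero ((D.O i).comap (D.O j).subtype)).mp h'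
    exact h3
  · intro z
    obtain ⟨z, rfl⟩ := Submodule.mkQ_surjective _ z
    exact ⟨Submodule.Quotient.mk z, rfl⟩
  · ext z
    obtain ⟨z, rfl⟩ := Submodule.mkQ_surjective _ z
    rw [LinearMap.mem_ker, LinearMap.mem_range]
    constructor
    · rintro ⟨a, ha⟩
      obtain ⟨a, rfl⟩ := Submodule.mkQ_surjective _ a
      change Submodule.Quotient.mk _ = Submodule.Quotient.mk _ at ha
      refine (Submodule.Quotient.mk_eq_zero _).mpr ?_
      have h := D.gr_mk_eq.mp ha
      change D.v ((a : K) - z) ≤ exp i at h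
      have : (z : K) = a - ((a : K) - z) := by ring
      change D.v (z : K) ≤ exp m
      rw [this]
      exact (D.v.map_sub _ _).trans (max_le a.2 (h.trans (exp_le_exp.mpr h1)))
    · intro h
      have h' := (Submodule.Quotient.mk_eq_zero (x := z) ((D.O m).comap (D.O j).subtype)).mp h
      exact ⟨Submodule.Quotient.mk ⟨z, h'⟩, rfl⟩
  · intro z
    obtain ⟨z, rfl⟩ := Submodule.mkQ_surjective _ z
    rfl
  · intro z
    obtain ⟨z, rfl⟩ := Submodule.mkQ_surjective _ z
    rfl

theorem det_grMul {y : K} (hy : D.v y ≤ 1) (i : ℤ) (m : ℕ) {j : ℤ} (hj : j = i + m) :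
    LinearMap.det (D.grMul hy i j) = LinearMap.det (D.grMul hy (-1) 0) ^ m := by
  induction m generalizing j with
  | zero =>
    rw [pow_zero]
    have : Subsingleton (D.gr i j) := by
      refine Submodule.Quotient.subsingleton_iff.mpr (eq_top_iff.mpr ?_)
      rintro ⟨z, hz⟩ -
      rw [hj] at hz
      simpa using hz
    exact LinearMap.det_eq_one_of_subsingleton _
  | succ m ih =>
    rw [D.det_grMul_trans hy (m := i + m) (by omega) (by push_cast at hj; omega), ih rfl, pow_succ]
    congr 1
    exact D.grMul_shift hy (i + m + 1) (-1) 0 (by ring) (by rw [hj]; push_cast; ring)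

end OnePlace

namespace OnePlace
open WithZero

variable {k A K : Type*} [Field k] [CommRing A] [Field K] [Algebra k A] [Algebra A K]
    [Algebra k K] (D : OnePlace k A K)

/-- The valuation ring at infinity, as an algebra over the constants. -/
def valRing : Subalgebra k K where
  carrier := {z | D.v z ≤ 1}
  mul_mem' {a b} ha hb := by
    rw [Set.mem_ofPred_eq, map_mul]
    exact mul_le_one' ha hb
  add_mem' ha hb := (D.v.map_add _ _).trans (max_le ha hb)
  algebraMap_mem' := D.v_const

theorem mem_valRing {z : K} : z ∈ D.valRing ↔ D.v z ≤ 1 := Iff.rfl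

/-- The maximal ideal of the valuation ring at infinity. -/
def valIdeal : Ideal D.valRing where
  carrier := {z | D.v z ≤ exp (-1)}
  zero_mem' := by simp
  add_mem' ha hb := (D.v.map_add _ _).trans (max_le ha hb)
  smul_mem' c x hx := by
    rw [Set.mem_ofPred_eq, smul_eq_mul, MulMemClass.coe_mul, map_mul]
    exact mul_le_of_le_one_of_le c.2 hx

theorem mem_valIdeal {z : D.valRing} : z ∈ D.valIdeal ↔ D.v (z : K) ≤ exp (-1) := Iff.rfl

theorem v_eq_one_of_notMem {z : D.valRing} (hz : z ∉ D.valIdeal) : D.v (z : K) = 1 := by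
  rw [mem_valIdeal, not_le] at hz
  have h0 : D.v (z : K) ≠ 0 := (exp_pos.trans hz).ne'
  obtain ⟨i, hi⟩ : ∃ i : ℤ, D.v (z : K) = exp i := ⟨_, (exp_log h0).symm⟩
  have h1 : D.v (z : K) ≤ 1 := z.2
  rw [hi, exp_lt_exp] at hz
  rw [hi, ← exp_zero, exp_le_exp] at h1
  rw [hi, show i = 0 by omega, exp_zero]

instance : D.valIdeal.IsMaximal := by
  rw [Ideal.isMaximal_iff]
  refine ⟨?_, ?_⟩
  · rw [mem_valIdeal, OneMemClass.coe_one, map_one, ← exp_zero, exp_le_exp]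
    omega
  · intro J z hJ hz hzJ
    have h1 := D.v_eq_one_of_notMem hz
    have hz0 : (z : K) ≠ 0 := by
      intro h; rw [h, map_zero] at h1; exact zero_ne_one h1
    let z' : D.valRing := ⟨(z : K)⁻¹, by
      change D.v _ ≤ 1
      rw [map_inv₀, h1, inv_one]⟩
    have : 1 = z' * z := by
      ext
      exact (inv_mul_cancel₀ hz0).symm
    rw [this]
    exact J.mul_mem_left _ hzJ

/-- The residue field at infinity. -/
abbrev resField := D.valRing ⧸ D.valIdeal

noncomputable instance : Field D.resField := Ideal.Quotient.field _

/-- Elements with pole order at most zero as elements of the valuation ring. -/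
noncomputable def toValRing : D.O 0 →ₗ[k] D.valRing where
  toFun z := ⟨z, D.mem_valRing.mpr (by have h := D.mem_O.mp z.2; rwa [exp_zero] at h)⟩
  map_add' _ _ := rfl
  map_smul' _ _ := rfl

/-- The residue field as a graded piece. -/
noncomputable def grToRes : D.gr (-1) 0 →ₗ[k] D.resField :=
  Submodule.liftQ _ ((Ideal.Quotient.mkₐ k D.valIdeal).toLinearMap.comp D.toValRing) (by
    intro z hz
    rw [LinearMap.mem_ker]
    exact Ideal.Quotient.eq_zero_iff_mem.mpr hz)

theorem grToRes_mk (z : D.O 0) : D.grToRes (Submodule.Quotient.mk z) =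
    Ideal.Quotient.mk D.valIdeal (D.toValRing z) := rfl

theorem grToRes_bijective : Function.Bijective D.grToRes := by
  constructor
  · rw [injective_iff_map_eq_zero]
    intro z h
    obtain ⟨z, rfl⟩ := Submodule.mkQ_surjective _ z
    refine (Submodule.Quotient.mk_eq_zero _).mpr ?_
    exact Ideal.Quotient.eq_zero_iff_mem.mp ((D.grToRes_mk z).symm.trans h)
  · intro z
    obtain ⟨z, rfl⟩ := Ideal.Quotient.mk_surjective z
    exact ⟨Submodule.Quotient.mk ⟨z, by rw [mem_O, exp_zero]; exact z.2⟩, rfl⟩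

variable [IsScalarTower k A K] [Finite k]

theorem exists_det_grMul {c : k} (hc : c ≠ 0) : ∃ (y : K) (hy : D.v y = 1),
    LinearMap.det (D.grMul hy.le (-1) 0) = c := by
  have h1 := D.finite_gr (i := -1) (j := 0) (by omega)
  have h2 : Module.Finite k D.resField := Module.Finite.of_surjective _ D.grToRes_bijective.2
  have h3 : Finite D.resField := Module.finite_of_finite k
  obtain ⟨y, hy⟩ := FiniteField.norm_surjective k D.resField c
  obtain ⟨y, rfl⟩ := Ideal.Quotient.mk_surjective y
  have hfree : Module.Free k D.resField := Module.Free.of_divisionRing k _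
  have hyn : y ∉ D.valIdeal := by
    intro h
    rw [Ideal.Quotient.eq_zero_iff_mem.mpr h, Algebra.norm_zero] at hy
    exact hc hy.symm
  have hy1 := D.v_eq_one_of_notMem hyn
  refine ⟨y, hy1, ?_⟩
  rw [← hy, Algebra.norm_apply,
    ← LinearMap.det_conj (D.grMul hy1.le (-1) 0) (LinearEquiv.ofBijective _ D.grToRes_bijective)]
  congr 1
  refine LinearMap.ext fun a => ?_
  obtain ⟨a, rfl⟩ := (LinearEquiv.ofBijective _ D.grToRes_bijective).surjective a
  rw [LinearMap.comp_apply, LinearMap.comp_apply, LinearEquiv.coe_coe, LinearEquiv.coe_coe,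
    LinearEquiv.symm_apply_apply]
  obtain ⟨a, rfl⟩ := Submodule.mkQ_surjective _ a
  rfl

theorem exists_det_grMul' {c : k} (hc : c ≠ 0) {e : ℕ} (he : e.Coprime (Nat.card k - 1)) :
    ∃ (y : K) (hy : D.v y = 1), ∀ i j : ℤ, j = i + e → LinearMap.det (D.grMul hy.le i j) = c := by
  have hcard : Nat.card kˣ = Nat.card k - 1 := Nat.card_units k
  obtain ⟨b, hb⟩ := (powCoprime (G := kˣ) (n := e) (by rw [hcard]; exact he.symm)).surjective
    (Units.mk0 c hc)
  obtain ⟨y, hy, h⟩ := D.exists_det_grMul b.ne_zero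
  refine ⟨y, hy, fun i j hij => ?_⟩
  rw [D.det_grMul hy.le i e hij, h]
  simpa [Units.ext_iff] using hb

end OnePlace

namespace OnePlace
open WithZero

variable {k A K : Type*} [Field k] [CommRing A] [Field K] [Algebra k A] [Algebra A K]
    [Algebra k K] (D : OnePlace k A K)
    [IsScalarTower k A K] [Finite k] [IsDomain A] [FaithfulSMul A K]

/-- Multiplication by `w` on elements with bounded poles extends to an automorphism. -/
theorem exists_auto {w : A} {e : ℤ} (he : 0 ≤ e) (hw : D.va w = exp e) (j : ℤ) :
    ∃ T : D.V (e + j) ≃ₗ[k] D.V (e + j), ∀ (v : A) (hv : v ∈ D.V j),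
      (T ⟨v, D.V_mono (by omega) hv⟩ : A) = w * v := by
  have hle : D.V j ≤ D.V (e + j) := D.V_mono (by omega)
  let E1 := LinearEquiv.ofInjective (Submodule.inclusion hle) (Submodule.inclusion_injective hle)
  let E2 := LinearEquiv.ofInjective (D.mulV hw j) (D.mulV_injective hw j)
  obtain ⟨T, hT⟩ := Submodule.exists_linearEquiv_restrict_eq (E1.symm.trans E2)
  refine ⟨T, fun v hv => ?_⟩
  have := hT (E1 ⟨v, hv⟩)
  rw [LinearEquiv.trans_apply, LinearEquiv.symm_apply_apply] at this
  exact (congrArg Subtype.val this).symm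

theorem exists_decomp {x : A} {i : ℤ} (hx : D.va x = exp i) {m j : ℤ} (hj : D.j0 ≤ j)
    (hjm : j ≤ m) {a : A} (ha : a ∈ D.V (i + m)) :
    ∃ v ∈ D.V (i + j), ∃ d ∈ D.V m, a = v + x * d := by
  have hx0 : algebraMap A K x ≠ 0 := D.ne_zero_of_v hx
  obtain ⟨d, hd⟩ := D.approx (algebraMap A K a / algebraMap A K x)
  have h1 : a - x * d ∈ D.V (i + j) := by
    have h2 : algebraMap A K (a - x * d) =
        algebraMap A K x * (algebraMap A K a / algebraMap A K x - algebraMap A K d) := by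
      rw [map_sub, map_mul]; field_simp
    rw [mem_V, va_apply, h2, map_mul, ← va_apply, hx, exp_mul_le_exp_add]
    exact hd.trans (exp_le_exp.mpr hj)
  refine ⟨a - x * d, h1, d, ?_, by ring⟩
  rw [mem_V, ← D.va_mul_le hx]
  have : x * d = a - (a - x * d) := by ring
  rw [this]
  exact ((D.va).map_sub _ _).trans (max_le ha (h1.trans (exp_le_exp.mpr (by omega))))

theorem exists_twist {w : A} {e : ℤ} (he : 0 ≤ e) (hw : D.va w = exp e) {j : ℤ} (hj : D.j0 ≤ j)
    (T : D.V (e + j) ≃ₗ[k] D.V (e + j))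
    (hT : ∀ (v : A) (hv : v ∈ D.V j), (T ⟨v, D.V_mono (by omega) hv⟩ : A) = w * v)
    {x : A} {i : ℤ} (hx : D.va x = exp i) :
    ∃ E : D.V (i + (e + j)) →ₗ[k] D.V (i + (e + j)),
      (∀ (v : A) (hv : v ∈ D.V (i + j)), (E ⟨v, D.V_mono (by omega) hv⟩ : A) = w * v) ∧
      ∀ d, E (D.mulV hx _ d) = D.mulV hx _ (T d) := by
  let F : D.V (i + j) × D.V (e + j) →ₗ[k] D.V (i + (e + j)) :=
    (Submodule.inclusion (D.V_mono (by omega))).coprod (D.mulV hx _)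
  have hwm : ∀ v ∈ D.V (i + j), w * v ∈ D.V (i + (e + j)) := by
    intro v hv
    have := (D.va_mul_le hw v (i + j)).mpr hv
    rw [mem_V, show i + (e + j) = e + (i + j) by ring]
    exact this
  let G : D.V (i + j) × D.V (e + j) →ₗ[k] D.V (i + (e + j)) :=
    ((LinearMap.mulLeft k w).restrict hwm).coprod ((D.mulV hx _).comp T.toLinearMap)
  have hF : Function.Surjective F := by
    rintro ⟨a, ha⟩
    obtain ⟨v, hv, d, hd, rfl⟩ := D.exists_decomp hx hj (by omega) ha
    exact ⟨(⟨v, hv⟩, ⟨d, hd⟩), rfl⟩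
  have hFG : ∀ p, F p = 0 → G p = 0 := by
    rintro ⟨⟨v, hv⟩, ⟨d, hd⟩⟩ h
    have h1 : v + x * d = 0 := congrArg Subtype.val h
    have h2 : d ∈ D.V j := by
      rw [mem_V, ← D.va_mul_le hx, ← neg_eq_of_add_eq_zero_right h1, Valuation.map_neg]
      exact hv
    ext
    change w * v + x * (T ⟨d, hd⟩ : A) = 0
    rw [hT d h2]
    linear_combination w * h1
  obtain ⟨s, hs⟩ := F.exists_rightInverse_of_surjective (LinearMap.range_eq_top.mpr hF)
  have key : ∀ p, G (s (F p)) = G p := by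
    intro p
    rw [← sub_eq_zero, ← map_sub]
    apply hFG
    rw [map_sub, sub_eq_zero]
    exact LinearMap.congr_fun hs (F p)
  refine ⟨G.comp s, fun v hv => ?_, fun d => ?_⟩
  · have h := key (⟨v, hv⟩, 0)
    have h1 : F (⟨v, hv⟩, 0) = ⟨v, D.V_mono (by omega) hv⟩ := by
      change _ + D.mulV hx _ 0 = _
      rw [map_zero, add_zero]
      rfl
    rw [h1] at h
    rw [LinearMap.comp_apply, h]
    change w * v + x * (T 0 : A) = w * v
    simp
  · have h := key (0, d)
    have h1 : F (0, d) = D.mulV hx _ d := by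
      ext
      change (0 : A) + x * d = x * d
      rw [zero_add]
    rw [h1] at h
    rw [LinearMap.comp_apply, h]
    ext
    change w * 0 + x * (T d : A) = x * (T d : A)
    rw [mul_zero, zero_add]

theorem det_twist {w : A} {e : ℤ} (he : 0 ≤ e) {j : ℤ} (hj : D.j0 ≤ j)
    (T : D.V (e + j) ≃ₗ[k] D.V (e + j)) {x : A} {i : ℤ} (hx : D.va x = exp i)
    {E : D.V (i + (e + j)) →ₗ[k] D.V (i + (e + j))}
    (h1 : ∀ (v : A) (hv : v ∈ D.V (i + j)), (E ⟨v, D.V_mono (by omega) hv⟩ : A) = w * v)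
    (h2 : ∀ d, E (D.mulV hx _ d) = D.mulV hx _ (T d)) :
    LinearMap.det E = LinearMap.det (T : D.V (e + j) →ₗ[k] D.V (e + j)) *
      (Ideal.span {x}).quotNorm k w := by
  have : Module.Finite k (D.V (i + (e + j))) := Module.Finite.of_finite
  rw [Ideal.quotNorm, MonoidHom.comp_apply, Algebra.norm_apply]
  refine LinearMap.det_of_exact (i := D.mulV hx (e + j)) (π := D.toQuot x (i + (e + j)))
    (D.mulV_injective hx _) (D.toQuot_surjective hx (by omega)) (D.ker_toQuot hx _).symm
    (fun d => (h2 d).symm) ?_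
  rintro ⟨a, ha⟩
  obtain ⟨v, hv, d, hd, rfl⟩ := D.exists_decomp hx hj (by omega) ha
  have h3 : (⟨v + x * d, ha⟩ : D.V (i + (e + j))) =
      ⟨v, D.V_mono (by omega) hv⟩ + D.mulV hx _ ⟨d, hd⟩ := rfl
  have h4 : ∀ d, D.toQuot x _ (D.mulV hx (e + j) d) = 0 := by
    intro d
    rw [← LinearMap.mem_ker, D.ker_toQuot hx]
    exact ⟨d, rfl⟩
  rw [h3, map_add, map_add, h2, map_add, h4, h4, add_zero, add_zero]
  change Ideal.Quotient.mk _ ((E ⟨v, D.V_mono (by omega) hv⟩ : D.V _) : A) = _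
  rw [h1 v hv, map_mul]
  rfl

theorem quotNorm_ne_zero {I : Ideal A} {w : A} (h : IsCoprime I (Ideal.span {w})) :
    I.quotNorm k w ≠ 0 := by
  obtain ⟨a, ha, b, hb, hab⟩ := Ideal.isCoprime_iff_exists.mp h
  obtain ⟨c, rfl⟩ := Ideal.mem_span_singleton'.mp hb
  have h1 : Ideal.Quotient.mk I c * Ideal.Quotient.mk I w = 1 := by
    rw [← map_mul, ← map_one (Ideal.Quotient.mk I), Ideal.Quotient.eq]
    rw [show c * w - 1 = -a by linear_combination hab]
    exact I.neg_mem ha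
  have h2 : I.quotNorm k c * I.quotNorm k w = 1 := by
    rw [← map_mul, Ideal.quotNorm, MonoidHom.comp_apply, MonoidHom.coe_coe, map_mul, h1, map_one]
  exact right_ne_zero_of_mul_eq_one h2

/-- The reciprocity law: elements congruent modulo `w` have norms of `w` differing by a local
factor at infinity. -/
theorem quotNorm_eq_mul_det {w : A} {e : ℤ} (he : 0 ≤ e) (hw : D.va w = exp e) {x x₁ : A} {i : ℤ}
    (hx : D.va x = exp i) (hx₁ : D.va x₁ = exp i) (hxx : x - x₁ ∈ Ideal.span {w})
    (hc : IsCoprime x₁ w) {y : K} (hy : D.v y ≤ 1) (hxy : y * algebraMap A K x = algebraMap A K x₁) :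
    (Ideal.span {x}).quotNorm k w = (Ideal.span {x₁}).quotNorm k w *
      LinearMap.det (D.grMul hy (i + D.j0) (i + (e + D.j0))) := by
  obtain ⟨T, hT⟩ := D.exists_auto he hw D.j0
  obtain ⟨E, hE1, hE2⟩ := D.exists_twist he hw le_rfl T hT hx
  obtain ⟨E', hE1', hE2'⟩ := D.exists_twist he hw le_rfl T hT hx₁
  have hd := D.det_twist he le_rfl T hx hE1 hE2
  have hd' := D.det_twist he le_rfl T hx₁ hE1' hE2'
  have hT0 : LinearMap.det (T : D.V (e + D.j0) →ₗ[k] D.V (e + D.j0)) ≠ 0 :=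
    (LinearEquiv.isUnit_det' T).ne_zero
  have hx₁0 : x₁ ≠ 0 := D.ne_zero_of_va hx₁
  have hn0 : (Ideal.span {x₁}).quotNorm k w ≠ 0 :=
    quotNorm_ne_zero
      ((Ideal.isCoprime_span_singleton_iff _ _).mpr hc)
  have hfin : Module.Finite k (D.V (i + (e + D.j0))) := Module.Finite.of_finite
  have hE'0 : LinearMap.det E' ≠ 0 := by rw [hd']; exact mul_ne_zero hT0 hn0
  let E₁ := LinearMap.equivOfDetNeZero E' hE'0
  have hE₁ : ∀ a, E₁ a = E' a := fun a => rfl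
  let S : D.V (i + (e + D.j0)) →ₗ[k] D.V (i + (e + D.j0)) := E₁.symm.toLinearMap.comp E
  have hS : ∀ a b, E a = E' b → S a = b := by
    intro a b h
    change E₁.symm (E a) = b
    rw [LinearEquiv.symm_apply_eq, h, hE₁]
  have hES : E = E'.comp S := by
    ext1 a
    change E a = E' (E₁.symm (E a))
    rw [← hE₁, LinearEquiv.apply_symm_apply]
  obtain ⟨g, hg⟩ := Ideal.mem_span_singleton.mp hxx
  have hgv : ∀ d ∈ D.V (e + D.j0), g * d ∈ D.V (i + D.j0) := by
    intro d hd
    rw [mem_V, ← D.va_mul_le hw, ← mul_assoc, ← hg,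
      show e + (i + (D.j0 : ℤ)) = i + (e + D.j0) by ring, map_mul, exp_add]
    exact mul_le_mul' ((D.va.map_sub _ _).trans (max_le hx.le hx₁.le)) hd
  have hS1 : ∀ v (hv : v ∈ D.V (i + D.j0)), S ⟨v, D.V_mono (by omega) hv⟩ =
      ⟨v, D.V_mono (by omega) hv⟩ := by
    intro v hv
    apply hS
    ext
    rw [hE1 v hv, hE1' v hv]
  have hS2 : ∀ d, S (D.mulV hx _ d) = D.mulV hx₁ _ d +
      ⟨g * (T d : A), D.V_mono (by omega) (hgv _ (T d).2)⟩ := by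
    intro d
    apply hS
    rw [map_add, hE2, hE2']
    ext
    rw [Submodule.coe_add, hE1' _ (hgv _ (T d).2)]
    change x * (T d : A) = x₁ * (T d : A) + w * (g * (T d : A))
    linear_combination (T d : A) * hg
  have hdS : LinearMap.det S = LinearMap.det (D.grMul hy (i + D.j0) (i + (e + D.j0))) := by
    have hle : D.V (i + D.j0) ≤ D.V (i + (e + D.j0)) := D.V_mono (by omega)
    rw [← one_mul (LinearMap.det (D.grMul hy (i + D.j0) (i + (e + D.j0)))),
      ← LinearMap.det_id (M := D.V (i + D.j0)) (A := k)]
    refine LinearMap.det_of_exact (i := Submodule.inclusion hle) (π := D.toGr _ _)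
      (Submodule.inclusion_injective hle) (D.toGr_surjective ?_ (by omega)) ?_
      (fun v => (hS1 v.1 v.2).symm) ?_
    · obtain ⟨n, hn⟩ := D.exists_va_eq hx₁0
      rw [hx₁, exp_inj] at hn
      omega
    · rw [ker_toGr, Submodule.range_inclusion]
    · rintro ⟨a, ha⟩
      obtain ⟨v, hv, d, hd, rfl⟩ := D.exists_decomp hx le_rfl (by omega) ha
      have h3 : (⟨v + x * d, ha⟩ : D.V (i + (e + D.j0))) =
        ⟨v, D.V_mono (by omega) hv⟩ + D.mulV hx _ ⟨d, hd⟩ := rfl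
      rw [h3, map_add, hS1 v hv, hS2]
      refine D.gr_mk_eq.mpr ?_
      change D.v (algebraMap A K (v + (x₁ * d + g * (T ⟨d, hd⟩ : A))) -
        y * algebraMap A K (v + x * d)) ≤ _
      have h4 : algebraMap A K (v + (x₁ * d + g * (T ⟨d, hd⟩ : A))) -
          y * algebraMap A K (v + x * d) =
          algebraMap A K (v + g * (T ⟨d, hd⟩ : A)) - y * algebraMap A K v := by
        simp only [map_add, map_mul, ← hxy]
        ring
      rw [h4]
      refine (D.v.map_sub _ _).trans (max_le ?_ (D.mul_mem_O hy hv))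
      exact (D.V (i + D.j0)).add_mem hv (hgv _ (T ⟨d, hd⟩).2)
  have : LinearMap.det E = LinearMap.det E' * LinearMap.det S := by
    rw [hES, LinearMap.det_comp]
  rw [hd, hd', hdS, mul_assoc] at this
  exact mul_left_cancel₀ hT0 this

end OnePlace

namespace OnePlace
open WithZero

section
variable {k A K : Type*} [Field k] [CommRing A] [Field K] [Algebra k A] [Algebra A K]
    [Algebra k K] (D : OnePlace k A K)

theorem grMul_congr {y y' : K} (hy : D.v y ≤ 1) (hy' : D.v y' ≤ 1) {e : ℤ}
    (h : D.v (y - y') ≤ exp (-e)) (i : ℤ) {j : ℤ} (hj : j = i + e) :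
    D.grMul hy i j = D.grMul hy' i j := by
  subst hj
  ext ⟨z, hz⟩
  refine D.gr_mk_eq.mpr ?_
  change D.v (y * z - y' * z) ≤ _
  rw [← sub_mul, map_mul]
  calc D.v (y - y') * D.v z ≤ exp (-e) * exp (i + e) := mul_le_mul' h hz
    _ = exp i := by rw [← exp_add]; congr 1; ring

variable [IsScalarTower k A K] [Finite k] [IsDedekindDomain A] [FaithfulSMul A K]

theorem quotNorm_mul_ideal (D : OnePlace k A K) {I J : Ideal A} (hI : I ≠ ⊥) (hJ : J ≠ ⊥) (w : A) :
    (I * J).quotNorm k w = I.quotNorm k w * J.quotNorm k w := by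
  obtain ⟨s, rfl⟩ := HeightOneSpectrum.exists_prodI_eq hI
  obtain ⟨t, rfl⟩ := HeightOneSpectrum.exists_prodI_eq hJ
  have hf : ∀ I : Ideal A, I ≠ ⊥ → Module.Finite k (A ⧸ I) :=
    fun I hI => D.module_finite_quot_ideal hI
  rw [← HeightOneSpectrum.prodI_add, HeightOneSpectrum.quotNorm_prodI hf,
    HeightOneSpectrum.quotNorm_prodI hf, HeightOneSpectrum.quotNorm_prodI hf, Multiset.map_add,
    Multiset.prod_add]

theorem quotNorm_span_mul (D : OnePlace k A K) {x y : A} (hx : x ≠ 0) (hy : y ≠ 0) (w : A) :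
    (Ideal.span {x * y}).quotNorm k w =
      (Ideal.span {x}).quotNorm k w * (Ideal.span {y}).quotNorm k w := by
  rw [← Ideal.span_singleton_mul_span_singleton]
  exact D.quotNorm_mul_ideal (by rwa [Ne, Ideal.span_singleton_eq_bot])
    (by rwa [Ne, Ideal.span_singleton_eq_bot]) w

theorem quotNorm_span_pow (D : OnePlace k A K) {x : A} (hx : x ≠ 0) (w : A) {n : ℕ} (hn : 0 < n) :
    (Ideal.span {x ^ n}).quotNorm k w = (Ideal.span {x}).quotNorm k w ^ n := by
  induction n, hn using Nat.le_induction with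
  | base => simp
  | succ n _ ih =>
    rw [pow_succ, D.quotNorm_span_mul (pow_ne_zero _ hx) hx, ih, pow_succ]

end

namespace Modulus

variable {k A K : Type*} [Field k] [CommRing A] [Field K] [Algebra k A] [Algebra A K]
    [Algebra k K] {D : OnePlace k A K} (R : D.Modulus)
    [IsScalarTower k A K] [Finite k] [IsDedekindDomain A] [FaithfulSMul A K]

theorem quotNorm_eq_of_isRay {t : ℕ} {x y : A} (hx : R.IsRay t x) (hy : R.IsRay t y) :
    (Ideal.span {x}).quotNorm k R.w = (Ideal.span {y}).quotNorm k R.w := by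
  obtain ⟨a, ha, hxa⟩ := hx.2
  obtain ⟨b, hb, hyb⟩ := hy.2
  have hyx := R.near.mul_mem hb (R.near.inv_mem ha)
  have hv := R.v_of_near hyx
  have hxy : x - y ∈ Ideal.span {R.w} := by
    have h := sub_mem hx.1 hy.1
    rw [show x - 1 - (y - 1) = x - y by ring] at h
    refine Ideal.span_singleton_le_span_singleton.mpr ?_ h
    exact dvd_pow_self _ two_ne_zero
  rw [D.quotNorm_eq_mul_det (y := ((b * a⁻¹ : Kˣ) : K)) (by omega) R.hw hx.va_eq hy.va_eq hxy
    hy.isCoprime hv.le (by rw [hxa, hyb, ← Units.val_mul]; congr 1; group)]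
  rw [D.grMul_eq_id hv.le (R.mem_near.mp hyx) _ (by ring), LinearMap.det_id, mul_one]

theorem quotNorm_ray (hM : Nat.card k - 1 ∣ R.M) {x : A} (hx : x ∈ R.ray) :
    (Ideal.span {x}).quotNorm k R.w = 1 := by
  obtain ⟨t, ht⟩ := hx
  have hpow : ∀ c : k, c ≠ 0 → c ^ R.M = 1 := by
    intro c hc
    have := Fintype.ofFinite k
    obtain ⟨d, hd⟩ := hM
    rw [hd, pow_mul, Nat.card_eq_fintype_card, FiniteField.pow_card_sub_one_eq_one c hc, one_pow]
  have hz : ∀ t' x', R.IsRay t' x' → (Ideal.span {x' ^ R.M}).quotNorm k R.w = 1 := by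
    intro t' x' hx'
    rw [D.quotNorm_span_pow hx'.ne_zero _ R.hM]
    exact hpow _ (quotNorm_ne_zero
      ((Ideal.isCoprime_span_singleton_iff _ _).mpr hx'.isCoprime))
  have hex : ∀ t', 3 * R.e + D.j0 ≤ t' → ∃ z, R.IsRay t' z := by
    intro t' h
    obtain ⟨z, -, hz⟩ := R.exists_isRay_mem (I := ⊤) (Ideal.isCoprime_iff_sup_eq.mpr (top_sup_eq _))
      (c := 1) trivial (i := 0) (by rw [map_one]; rfl) (t := t')
      (by have := Nat.le_mul_of_pos_left t' R.he; omega)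
    exact ⟨z, hz⟩
  obtain ⟨x₁, h₁⟩ := hex (3 * R.e + D.j0) le_rfl
  obtain ⟨x₂, h₂⟩ := hex (t + (3 * R.e + D.j0)) (by omega)
  have h₃ : R.IsRay (R.M * (t + (3 * R.e + D.j0))) (x * x₁ ^ R.M) := by
    have := ht.mul (h₁.pow R.M)
    convert this using 1
    ring
  have h₄ := h₂.pow R.M
  rw [mul_comm] at h₄
  have := R.quotNorm_eq_of_isRay h₃ h₄
  rw [D.quotNorm_span_mul ht.ne_zero (pow_ne_zero _ h₁.ne_zero), hz _ _ h₁, hz _ _ h₂, mul_one] at this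
  exact this

/-- The norm of `w` modulo an effective divisor. -/
noncomputable def rho (s : Multiset R.Pt) : k := (R.pr s).quotNorm k R.w

theorem rho_add (s t : Multiset R.Pt) : R.rho (s + t) = R.rho s * R.rho t := by
  rw [rho, pr_add, D.quotNorm_mul_ideal (R.pr_ne_bot s) (R.pr_ne_bot t)]
  rfl

theorem rho_ne_zero (s : Multiset R.Pt) : R.rho s ≠ 0 :=
  quotNorm_ne_zero (R.isCoprime_pr s)

theorem rho_congr (hM : Nat.card k - 1 ∣ R.M) {s t : Multiset R.Pt} (h : R.clOf s = R.clOf t) :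
    R.rho s = R.rho t := by
  obtain ⟨x, hx, y, hy, h⟩ := R.clOf_eq_clOf.mp h
  have h1 := congrArg (fun I => Ideal.quotNorm k I R.w) h
  beta_reduce at h1
  rwa [D.quotNorm_mul_ideal _ (R.pr_ne_bot s), D.quotNorm_mul_ideal _ (R.pr_ne_bot t),
    R.quotNorm_ray hM hx, R.quotNorm_ray hM hy, one_mul, one_mul] at h1
  · rw [Ne, Ideal.span_singleton_eq_bot]; exact ne_zero_of_mem_ray hy
  · rw [Ne, Ideal.span_singleton_eq_bot]; exact ne_zero_of_mem_ray hx

theorem exists_approx (a : A) {n : ℕ} (hn : 3 * R.e + D.j0 ≤ n) {z : K} (hz : D.v z = exp (n : ℤ)) :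
    ∃ x, x - a ∈ Ideal.span {R.w ^ 2} ∧ D.va x = exp (n : ℤ) ∧
      D.v (z / algebraMap A K x - 1) ≤ exp (-(R.e : ℤ)) := by
  have hw2 : D.va (R.w ^ 2) = exp (2 * R.e : ℤ) := by
    rw [map_pow, R.hw, ← exp_nsmul]; simp
  obtain ⟨x, hx, hxz⟩ := D.approx_ideal (Ideal.mem_span_singleton_self (R.w ^ 2)) hw2 a z
  have hvx : D.va x = exp (n : ℤ) := by
    rw [va_apply, ← hz, show algebraMap A K x = z - (z - algebraMap A K x) by ring]
    refine Valuation.map_sub_eq_of_lt_left _ (hxz.trans_lt ?_)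
    rw [hz, exp_lt_exp]
    have := R.he
    omega
  refine ⟨x, hx, hvx, ?_⟩
  have hx0 : algebraMap A K x ≠ 0 := D.ne_zero_of_v hvx
  rw [← exp_mul_le_exp_add (n : ℤ), ← hvx, va_apply, ← map_mul]
  rw [show algebraMap A K x * (z / algebraMap A K x - 1) = z - algebraMap A K x by field_simp]
  refine hxz.trans (exp_le_exp.mpr ?_)
  omega

/-- Elements in a given residue class modulo `w ^ 2` realise every norm of `w`. -/
theorem exists_quotNorm_eq (hcop : R.e.Coprime (Nat.card k - 1)) {a : A} (ha : IsCoprime a R.w)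
    {c : k} (hc : c ≠ 0) {t : ℕ} (ht : 3 * R.e + D.j0 ≤ R.e * t) :
    ∃ x, x - a ∈ Ideal.span {R.w ^ 2} ∧ D.va x = exp ((R.e * t : ℕ) : ℤ) ∧
      (Ideal.span {x}).quotNorm k R.w = c := by
  have hz : D.v ((R.wu : K) ^ t) = exp ((R.e * t : ℕ) : ℤ) := by
    rw [map_pow, v_wu, ← exp_nsmul]; simp [mul_comm]
  obtain ⟨x₁, h₁, hv₁, -⟩ := R.exists_approx a ht hz
  have hcop' : ∀ x, x - a ∈ Ideal.span {R.w ^ 2} → IsCoprime x R.w := by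
    intro x hx
    obtain ⟨b, hb⟩ := Ideal.mem_span_singleton.mp hx
    rw [show x = a + R.w * (R.w * b) by linear_combination hb]
    exact IsCoprime.add_mul_left_left ha _
  have hn0 : (Ideal.span {x₁}).quotNorm k R.w ≠ 0 :=
    quotNorm_ne_zero ((Ideal.isCoprime_span_singleton_iff _ _).mpr (hcop' _ h₁))
  obtain ⟨y, hy, hyc⟩ := D.exists_det_grMul' (div_ne_zero hc hn0) hcop
  have hy0 : y ≠ 0 := by rintro rfl; simp at hy
  obtain ⟨x, hx, hv, hxy⟩ := R.exists_approx a ht (z := algebraMap A K x₁ / y)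
    (by rw [map_div₀, hy, div_one]; exact hv₁)
  have hx0 : algebraMap A K x ≠ 0 := D.ne_zero_of_v hv
  refine ⟨x, hx, hv, ?_⟩
  have hxx : x - x₁ ∈ Ideal.span {R.w} := by
    have h := sub_mem hx h₁
    rw [show x - a - (x₁ - a) = x - x₁ by ring] at h
    exact Ideal.span_singleton_le_span_singleton.mpr (dvd_pow_self _ two_ne_zero) h
  set y' := algebraMap A K x₁ / algebraMap A K x
  have hvy' : D.v y' = 1 := by
    rw [map_div₀, ← va_apply, ← va_apply, hv₁, hv, div_self exp_ne_zero]
  rw [D.quotNorm_eq_mul_det (y := y') (by omega) R.hw hv hv₁ hxx (hcop' _ h₁) hvy'.le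
    (div_mul_cancel₀ _ hx0)]
  have hyy : D.v (y' - y) ≤ exp (-(R.e : ℤ)) := by
    have h1 : y' - y = y * (algebraMap A K x₁ / y / algebraMap A K x - 1) := by
      simp only [y']; field_simp
    rw [h1, map_mul, hy, one_mul]
    exact hxy
  rw [D.grMul_congr hvy'.le hy.le hyy _ (by ring), hyc _ _ (by ring), mul_div_cancel₀ _ hn0]

end Modulus
end OnePlace

namespace OnePlace
open WithZero

variable {k A K : Type*} [Field k] [CommRing A] [Field K] [Algebra k A] [Algebra A K]
    [Algebra k K] (D : OnePlace k A K)
    [IsScalarTower k A K] [Finite k] [IsDedekindDomain A] [FaithfulSMul A K]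
    {B ι : Type*} [CommRing B] [IsDomain B] [Algebra A B] [Algebra k B] [IsScalarTower k A B] [Fintype ι]
    [Nonempty ι] (b : Module.Basis ι A B)

/-- Elements of a finite free extension with coordinates of bounded pole order. -/
noncomputable def boxMap (j : ℤ) : (ι → D.V j) →ₗ[k] B :=
  (b.equivFun.symm.toLinearMap.restrictScalars k).comp (LinearMap.compLeft (D.V j).subtype ι)

noncomputable def box (j : ℤ) : Submodule k B := LinearMap.range (D.boxMap b j)

theorem boxMap_apply (j : ℤ) (c : ι → D.V j) : D.boxMap b j c = b.equivFun.symm fun i => (c i : A) :=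
  rfl

theorem boxMap_injective (j : ℤ) : Function.Injective (D.boxMap b j) := by
  intro c d h
  have h1 := b.equivFun.symm.injective h
  funext i
  exact Subtype.ext (congrFun h1 i)

theorem mem_box {j : ℤ} {x : B} : x ∈ D.box b j ↔ ∀ i, b.equivFun x i ∈ D.V j := by
  constructor
  · rintro ⟨c, rfl⟩ i
    rw [boxMap_apply, LinearEquiv.apply_symm_apply]
    exact (c i).2
  · intro h
    exact ⟨fun i => ⟨_, h i⟩, b.equivFun.symm_apply_apply x⟩

theorem finrank_box (j : ℤ) : Module.finrank k (D.box b j) = Fintype.card ι * D.dimV j := by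
  have : Module.Finite k (D.V j) := Module.Finite.of_finite
  rw [box, LinearMap.finrank_range_of_inj (D.boxMap_injective b j), Module.finrank_pi_fintype]
  simp [dimV]

instance finite_box (j : ℤ) : Finite (D.box b j) :=
  (Set.finite_range (D.boxMap b j)).to_subtype

theorem finite_coe_box (j : ℤ) : (D.box b j : Set B).Finite := Set.finite_range (D.boxMap b j)

theorem exists_mul_mem_box : ∃ c : ℕ, ∀ i j : ℤ, ∀ x ∈ D.box b i, ∀ y ∈ D.box b j,
    x * y ∈ D.box b (i + j + c) := by
  have h : ∀ a : A, ∃ c : ℕ, D.va a ≤ exp (c : ℤ) := by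
    intro a
    by_cases ha : a = 0
    · exact ⟨0, by rw [ha, map_zero]; exact zero_le⟩
    · obtain ⟨i, hi⟩ := D.exists_va_eq ha
      exact ⟨i, hi.le⟩
  choose f hf using h
  let c : ℕ := Finset.univ.sup fun p : ι × ι × ι => f (b.equivFun (b p.1 * b p.2.1) p.2.2)
  have hc : ∀ l m n, b.equivFun (b l * b m) n ∈ D.V c := by
    intro l m n
    refine (hf _).trans (exp_le_exp.mpr ?_)
    exact_mod_cast Finset.le_sup (f := fun p : ι × ι × ι => f (b.equivFun (b p.1 * b p.2.1) p.2.2))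
      (Finset.mem_univ (l, m, n))
  refine ⟨c, fun i j x hx y hy => (D.mem_box b).mpr fun n => ?_⟩
  have hxy : x * y = ∑ l, ∑ m, (b.equivFun x l * b.equivFun y m) • (b l * b m) := by
    conv_lhs => rw [← b.sum_equivFun x, ← b.sum_equivFun y]
    rw [Finset.sum_mul_sum]
    simp only [smul_mul_smul_comm]
  rw [hxy, map_sum, Finset.sum_apply]
  refine Submodule.sum_mem _ fun l _ => ?_
  rw [map_sum, Finset.sum_apply]
  refine Submodule.sum_mem _ fun m _ => ?_
  rw [map_smul, Pi.smul_apply, smul_eq_mul, mem_V, map_mul, map_mul, exp_add, exp_add]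
  exact mul_le_mul' (mul_le_mul' ((D.mem_box b).mp hx l) ((D.mem_box b).mp hy m)) (hc l m n)

theorem exists_algebraMap_mem (b : Module.Basis ι A B) {I : Ideal B} (hI : I ≠ ⊥) :
    ∃ a : A, a ≠ 0 ∧ algebraMap A B a ∈ I := by
  have : Module.Finite A B := Module.Finite.of_basis b
  have : FaithfulSMul A B := by
    have := Module.Free.of_basis b
    infer_instance
  obtain ⟨x, hx, hx0⟩ := Submodule.exists_mem_ne_zero_of_ne_bot hI
  obtain ⟨a, ha, ha0⟩ := Submodule.exists_mem_ne_zero_of_ne_bot 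
    (Ideal.comap_ne_bot_of_integral_mem (R := A) hx0 hx (Algebra.IsIntegral.isIntegral x))
  exact ⟨a, ha0, ha⟩

theorem exists_box_surjective {I : Ideal B} (hI : I ≠ ⊥) : ∃ J₀ : ℤ, ∀ J, J₀ ≤ J →
    Function.Surjective ((Ideal.Quotient.mkₐ k I).toLinearMap.comp (D.box b J).subtype) := by
  obtain ⟨a, ha, haI⟩ := exists_algebraMap_mem b hI
  obtain ⟨i, hi⟩ := D.exists_va_eq ha
  refine ⟨i + D.j0, fun J hJ z => ?_⟩
  obtain ⟨z, rfl⟩ := Ideal.Quotient.mk_surjective z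
  have h : ∀ n, ∃ c : D.V J, ∃ d, b.equivFun z n = c + a * d := by
    intro n
    obtain ⟨c, hc⟩ := D.toQuot_surjective hi le_rfl (Ideal.Quotient.mk _ (b.equivFun z n))
    obtain ⟨d, hd⟩ := Ideal.mem_span_singleton.mp (Ideal.Quotient.eq.mp hc)
    refine ⟨⟨c, D.V_mono hJ c.2⟩, -d, ?_⟩
    rw [Submodule.subtype_apply] at hd
    linear_combination -hd
  choose c d hcd using h
  refine ⟨⟨D.boxMap b J c, ⟨c, rfl⟩⟩, ?_⟩
  refine Ideal.Quotient.eq.mpr ?_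
  have hz : z = D.boxMap b J c + algebraMap A B a * b.equivFun.symm d := by
    apply b.equivFun.injective
    rw [map_add, boxMap_apply, LinearEquiv.apply_symm_apply, ← Algebra.smul_def, map_smul,
      LinearEquiv.apply_symm_apply]
    funext n
    exact hcd n
  change D.boxMap b J c - z ∈ I
  rw [hz, sub_add_cancel_left]
  exact I.neg_mem (I.mul_mem_right _ haI)

theorem finite_quot_of_basis (D : OnePlace k A K) (b : Module.Basis ι A B) {I : Ideal B} (hI : I ≠ ⊥) : Module.Finite k (B ⧸ I) := by
  obtain ⟨J, hJ⟩ := D.exists_box_surjective b hI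
  exact Module.Finite.of_surjective _ (hJ J le_rfl)

theorem exists_mem_ideal_box {I : Ideal B} (hI : I ≠ ⊥) {j : ℤ}
    (h : Module.finrank k (B ⧸ I) < Fintype.card ι * D.dimV j) :
    ∃ x ∈ I, x ≠ 0 ∧ x ∈ D.box b j := by
  have := D.finite_quot_of_basis b hI
  rw [← D.finrank_box b] at h
  obtain ⟨x, hx, hx0⟩ := Submodule.exists_mem_ne_zero_of_ne_bot (LinearMap.ker_ne_bot_of_finrank_lt
    (f := (Ideal.Quotient.mkₐ k I).toLinearMap.comp (D.box b j).subtype) h)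
  exact ⟨x, Ideal.Quotient.eq_zero_iff_mem.mp hx, fun h => hx0 (Subtype.ext h), x.2⟩

theorem finite_ideals_mem_of_basis (D : OnePlace k A K) (b : Module.Basis ι A B) {x : B} (hx : x ≠ 0) : {I : Ideal B | x ∈ I}.Finite := by
  have := D.finite_quot_of_basis b (I := Ideal.span {x})
    (by rwa [Ne, Ideal.span_singleton_eq_bot])
  have : Finite (B ⧸ Ideal.span {x}) := Module.finite_of_finite k
  have h : Finite (Ideal (B ⧸ Ideal.span {x})) :=
    Finite.of_injective (fun I => (I : Set (B ⧸ Ideal.span {x}))) SetLike.coe_injective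
  refine (Set.finite_range
    (fun I : Ideal (B ⧸ Ideal.span {x}) => I.comap (Ideal.Quotient.mk _))).subset ?_
  intro I hI
  refine ⟨I.map (Ideal.Quotient.mk _), ?_⟩
  beta_reduce
  rw [Ideal.comap_map_mk]
  exact (Ideal.span_singleton_le_iff_mem I).mpr hI

/-- An element with coordinates of bounded pole order has controlled norm. -/
theorem finrank_quot_box_le : ∃ c : ℕ, ∀ (i : ℕ) (x : B), x ≠ 0 → x ∈ D.box b i →
    Module.finrank k (B ⧸ Ideal.span {x}) ≤ Fintype.card ι * D.f * (i + c) := by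
  obtain ⟨c, hc⟩ := D.exists_mul_mem_box b
  refine ⟨c, fun i x hx0 hx => ?_⟩
  obtain ⟨J₀, hJ₀⟩ := D.exists_box_surjective b (I := Ideal.span {x})
    (by rwa [Ne, Ideal.span_singleton_eq_bot])
  obtain ⟨n, hn⟩ : ∃ n : ℕ, J₀ ≤ n := ⟨J₀.toNat, Int.self_le_toNat _⟩
  set m : ℕ := D.j0 + n
  have hs := hJ₀ ((m + (i + c) : ℕ) : ℤ) (by push_cast [m]; omega)
  have hd : D.dimV ((m + (i + c) : ℕ) : ℤ) = D.dimV m + D.f * (i + c) := by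
    rw [Nat.cast_add m, D.finrank_V m _ (by omega)]
  have h1 := LinearMap.finrank_range_add_finrank_ker
    ((Ideal.Quotient.mkₐ k (Ideal.span {x})).toLinearMap.comp (D.box b ((m + (i + c) : ℕ) : ℤ)).subtype)
  rw [LinearMap.range_eq_top.mpr hs, finrank_top, finrank_box, hd] at h1
  have hmul : ∀ y ∈ D.box b m, x * y ∈ D.box b ((m + (i + c) : ℕ) : ℤ) := by
    intro y hy
    have := hc i m x hx y hy
    convert this using 2
    push_cast; ring
  let F : D.box b m →ₗ[k] D.box b ((m + (i + c) : ℕ) : ℤ) := (LinearMap.mulLeft k x).restrict hmul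
  have hF : Function.Injective F := fun y z h => Subtype.ext (mul_left_cancel₀ hx0 (Subtype.ext_iff.mp h))
  have h2 : LinearMap.range F ≤ LinearMap.ker ((Ideal.Quotient.mkₐ k (Ideal.span {x})).toLinearMap.comp
      (D.box b ((m + (i + c) : ℕ) : ℤ)).subtype) := by
    rintro _ ⟨y, rfl⟩
    exact Ideal.Quotient.eq_zero_iff_mem.mpr (Ideal.mul_mem_right _ _ (Ideal.mem_span_singleton_self x))
  have : Module.Finite k (D.box b ((m + (i + c) : ℕ) : ℤ)) := Module.Finite.of_finite
  have h3 := Submodule.finrank_mono h2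
  rw [LinearMap.finrank_range_of_inj hF, finrank_box] at h3
  have h4 : Fintype.card ι * (D.dimV m + D.f * (i + c)) =
    Fintype.card ι * D.dimV m + Fintype.card ι * D.f * (i + c) := by ring
  omega

end OnePlace

namespace OnePlace
open WithZero

variable {k A K : Type*} [Field k] [CommRing A] [Field K] [Algebra k A] [Algebra A K]
    [Algebra k K]
    [IsScalarTower k A K] [Finite k] [IsDedekindDomain A] [FaithfulSMul A K]
    {B ι : Type*} [CommRing B] [IsDedekindDomain B] [Algebra A B] [Algebra k B] [IsScalarTower k A B]
    [Fintype ι] [Nonempty ι]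

theorem finite_codim_le (D : OnePlace k A K) (b : Module.Basis ι A B) (C : ℕ) :
    {I : Ideal B | I ≠ ⊥ ∧ Module.finrank k (B ⧸ I) ≤ C}.Finite := by
  have h1 : C < Fintype.card ι * D.dimV (D.j0 + (C + 1 : ℕ)) := by
    rw [D.finrank_V _ _ le_rfl]
    have h2 : 0 < Fintype.card ι := Fintype.card_pos
    have h3 := Nat.le_mul_of_pos_left (C + 1) D.f_pos
    have h4 := Nat.le_mul_of_pos_left (D.dimV D.j0 + D.f * (C + 1)) h2
    omega
  have hfin : (⋃ x ∈ {x : B | x ∈ D.box b (D.j0 + (C + 1 : ℕ)) ∧ x ≠ 0}, {I : Ideal B | x ∈ I}).Finite := by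
    refine Set.Finite.biUnion (Set.Finite.subset (D.finite_coe_box b _) fun x hx => hx.1) ?_
    intro x hx
    exact D.finite_ideals_mem_of_basis b hx.2
  refine hfin.subset ?_
  rintro I ⟨hI, hIC⟩
  obtain ⟨x, hx, hx0, hxv⟩ := D.exists_mem_ideal_box b hI (hIC.trans_lt h1)
  exact Set.mem_biUnion (x := x) ⟨hxv, hx0⟩ hx

theorem finrank_mul_of_basis (D : OnePlace k A K) (b : Module.Basis ι A B) {I J : Ideal B}
    (hI : I ≠ ⊥) (hJ : J ≠ ⊥) :
    Module.finrank k (B ⧸ (I * J)) = Module.finrank k (B ⧸ I) + Module.finrank k (B ⧸ J) := by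
  obtain ⟨s, rfl⟩ := HeightOneSpectrum.exists_prodI_eq hI
  obtain ⟨t, rfl⟩ := HeightOneSpectrum.exists_prodI_eq hJ
  have hf : ∀ I : Ideal B, I ≠ ⊥ → Module.Finite k (B ⧸ I) :=
    fun I hI => D.finite_quot_of_basis b hI
  rw [← HeightOneSpectrum.prodI_add, HeightOneSpectrum.finrank_prodI hf,
    HeightOneSpectrum.finrank_prodI hf, HeightOneSpectrum.finrank_prodI hf, Multiset.map_add,
    Multiset.sum_add]

/-- The number of ideals of codimension `m` is at most a constant times `q ^ m`. -/
theorem exists_card_ideals_le (D : OnePlace k A K) (b : Module.Basis ι A B) :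
    ∃ Q : ℕ, ∀ (m : ℕ) (S : Finset (Ideal B)), (∀ I ∈ S, I ≠ ⊥ ∧ Module.finrank k (B ⧸ I) = m) →
      S.card ≤ Q * Nat.card k ^ m := by
  classical
  obtain ⟨c, hc⟩ := D.finrank_quot_box_le b
  set r := Fintype.card ι with hr
  have hr0 : 0 < r := Fintype.card_pos
  have hf := D.f_pos
  set C := r * D.f * (D.j0 + 1 + c) with hC
  set 𝒞 := (D.finite_codim_le b C).toFinset
  refine ⟨𝒞.card * Nat.card k ^ (r * D.dimV D.j0 + r * D.f), fun m S hS => ?_⟩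
  set t := m / (r * D.f) + 1 with ht
  have hrf : 0 < r * D.f := Nat.mul_pos hr0 hf
  have ht1 : m < r * D.f * t := Nat.lt_mul_div_succ m hrf
  have ht2 : r * D.f * t ≤ m + r * D.f := by
    rw [ht, mul_add, mul_one]
    gcongr
    exact Nat.mul_div_le m _
  have hdim : D.dimV ((D.j0 + t : ℕ) : ℤ) = D.dimV D.j0 + D.f * t := by
    rw [Nat.cast_add, D.finrank_V _ _ le_rfl]
  have hrd : r * D.dimV ((D.j0 + t : ℕ) : ℤ) = r * D.dimV D.j0 + r * D.f * t := by
    rw [hdim]; ring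
  have key : ∀ I : Ideal B, ∃ p : Ideal B × B, I ∈ S → I ≠ ⊥ ∧ p.1 ∈ 𝒞 ∧
      p.2 ∈ D.box b ((D.j0 + t : ℕ) : ℤ) ∧ p.2 ≠ 0 ∧ I * p.1 = Ideal.span {p.2} := by
    intro I
    by_cases hIS : I ∈ S
    swap
    · exact ⟨(⊥, 0), fun h => absurd h hIS⟩
    obtain ⟨hI, hIm⟩ := hS I hIS
    obtain ⟨x, hxI, hx0, hx⟩ := D.exists_mem_ideal_box b hI (j := ((D.j0 + t : ℕ) : ℤ))
      (by rw [hIm, ← hr, hrd]; omega)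
    obtain ⟨J, hJ⟩ := Ideal.dvd_span_singleton.mpr hxI
    have hx0' : Ideal.span {x} ≠ ⊥ := by rwa [Ne, Ideal.span_singleton_eq_bot]
    have hJ0 : J ≠ ⊥ := by
      rintro rfl
      rw [Ideal.mul_bot] at hJ
      exact hx0' hJ
    have h1 := hc (D.j0 + t) x hx0 hx
    rw [hJ, D.finrank_mul_of_basis b hI hJ0, hIm] at h1
    refine ⟨(J, x), fun _ => ⟨hI, ?_, hx, hx0, hJ.symm⟩⟩
    rw [Set.Finite.mem_toFinset]
    refine ⟨hJ0, ?_⟩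
    have h2 : r * D.f * (D.j0 + t + c) + r * D.f = C + r * D.f * t := by rw [hC]; ring
    change Module.finrank k (B ⧸ J) ≤ C
    rw [hC] at h2 ⊢
    generalize r * D.f * (D.j0 + t + c) = x1 at *
    generalize r * D.f * (D.j0 + 1 + c) = x2 at *
    generalize r * D.f * t = x3 at *
    omega
  choose p hp using key
  let W : Finset B := (D.finite_coe_box b ((D.j0 + t : ℕ) : ℤ)).toFinset
  have hW : W.card ≤ Nat.card k ^ (r * D.dimV D.j0 + r * D.f) * Nat.card k ^ m := by
    have h1 : W.card = Nat.card k ^ (r * D.dimV ((D.j0 + t : ℕ) : ℤ)) := by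
      rw [← Set.ncard_eq_toFinset_card _ (D.finite_coe_box b _), hr, ← D.finrank_box b]
      have : Module.Finite k (D.box b ((D.j0 + t : ℕ) : ℤ)) := Module.Finite.of_finite
      exact Module.natCard_eq_pow_finrank
    rw [h1, hrd, ← pow_add]
    exact Nat.pow_le_pow_right Nat.card_pos (by omega)
  calc S.card ≤ (𝒞 ×ˢ W).card := by
        refine Finset.card_le_card_of_injOn p ?_ ?_
        · intro I hI
          obtain ⟨-, h1, h2, -⟩ := hp I hI
          exact Finset.mem_coe.mpr (Finset.mem_product.mpr ⟨h1, (Set.Finite.mem_toFinset _).mpr h2⟩)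
        · intro I hI J hJ hIJ
          obtain ⟨-, h1, -, -, h2⟩ := hp I hI
          obtain ⟨-, -, -, -, h4⟩ := hp J hJ
          rw [← hIJ, ← h2] at h4
          rw [Set.Finite.mem_toFinset] at h1
          exact (mul_right_cancel₀ h1.1 h4).symm
    _ ≤ 𝒞.card * (Nat.card k ^ (r * D.dimV D.j0 + r * D.f) * Nat.card k ^ m) := by
        rw [Finset.card_product]
        gcongr
    _ = _ := by ring

namespace Modulus
variable {D : OnePlace k A K} (R : D.Modulus)

theorem exists_card_ge : ∃ m₀ : ℕ, ∀ m : ℕ, m₀ ≤ m →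
    R.cst * (Nat.card k : ℝ) ^ (R.N * m) ≤ (R.finite_degS (R.N * m)).toFinset.card := by
  obtain ⟨m₀, h⟩ := R.exists_count
  refine ⟨m₀, fun m hm => ?_⟩
  have h1 := h (R.N * m) (hm.trans (Nat.le_mul_of_pos_left m R.N_pos)) 0
  rw [map_zero, if_pos (by simp)] at h1
  rw [← h1]
  norm_cast
  rw [← Set.ncard_eq_toFinset_card _ (R.finite_degS _)]
  exact Set.ncard_le_ncard (fun s hs => hs.1) (R.finite_degS _)

/-- A finite free Dedekind extension cannot have two primes of the same residue field over
every prime. -/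
theorem false_of_two_primes (b : Module.Basis ι A B) (P : Bool × R.Pt → HeightOneSpectrum B)
    (hP : Function.Injective P)
    (hdeg : ∀ x, Module.finrank k (B ⧸ (P x).asIdeal) = R.deg x.2) : False := by
  classical
  obtain ⟨Q, hQ⟩ := D.exists_card_ideals_le b
  obtain ⟨m₀, hm₀⟩ := R.exists_card_ge
  have hf : ∀ I : Ideal B, I ≠ ⊥ → Module.Finite k (B ⧸ I) :=
    fun I hI => D.finite_quot_of_basis b hI
  set q : ℝ := (Nat.card k : ℝ) with hq
  have hq0 : 0 < q := card_pos' k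
  have hcst : 0 < R.cst := zpow_pos hq0 _
  let S : ℕ → Finset (Multiset R.Pt) := fun m => (R.finite_degS (R.N * m)).toFinset
  have hS : ∀ m s, s ∈ S m ↔ R.degS s = R.N * m := fun m s => Set.Finite.mem_toFinset _
  let Φ : Multiset R.Pt × Multiset R.Pt → Ideal B := fun x =>
    HeightOneSpectrum.prodI ((x.1.map (Prod.mk true) + x.2.map (Prod.mk false)).map P)
  have hnone : ∀ s : Multiset R.Pt,
      Multiset.filterMap (fun _ : R.Pt => (none : Option R.Pt)) s = 0 := fun s =>
    Multiset.induction_on s rfl fun a s h => by rw [Multiset.filterMap_cons_none _ _ rfl, h]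
  have hΦ : Function.Injective Φ := by
    intro x y h
    have h1 := Multiset.map_injective hP (HeightOneSpectrum.prodI_injective h)
    refine Prod.ext ?_ ?_
    · have := congrArg (Multiset.filterMap fun z : Bool × R.Pt => if z.1 then some z.2 else none) h1
      simpa [Multiset.filterMap_add, Multiset.filterMap_map, Function.comp_def, hnone] using this
    · have := congrArg (Multiset.filterMap fun z : Bool × R.Pt => if z.1 then none else some z.2) h1
      simpa [Multiset.filterMap_add, Multiset.filterMap_map, Function.comp_def, hnone] using this
  have hΦd : ∀ x, Module.finrank k (B ⧸ Φ x) = R.degS x.1 + R.degS x.2 := by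
    intro x
    rw [HeightOneSpectrum.finrank_prodI hf, Multiset.map_map, Multiset.map_add, Multiset.map_map,
      Multiset.map_map, Multiset.sum_add]
    simp only [Function.comp_def, hdeg]
    rfl
  obtain ⟨n, hn⟩ := exists_nat_gt (Q / R.cst ^ 2)
  set t := 2 * m₀ + n with ht
  let T : Finset (Σ _ : ℕ, Multiset R.Pt × Multiset R.Pt) :=
    (Finset.range n).sigma fun i => S (m₀ + i) ×ˢ S (t - (m₀ + i))
  have hT : ∀ x ∈ T, x.1 < n ∧ R.degS x.2.1 = R.N * (m₀ + x.1) ∧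
      R.degS x.2.2 = R.N * (t - (m₀ + x.1)) := by
    rintro ⟨i, s, s'⟩ hx
    rw [Finset.mem_sigma, Finset.mem_product, hS, hS, Finset.mem_range] at hx
    exact hx
  have hcard : T.card ≤ Q * Nat.card k ^ (R.N * t) := by
    rw [← Finset.card_image_of_injOn (f := fun x => Φ x.2) (s := T)]
    · apply hQ
      intro I hI
      obtain ⟨x, hx, rfl⟩ := Finset.mem_image.mp hI
      refine ⟨HeightOneSpectrum.prodI_ne_bot _, ?_⟩
      obtain ⟨h1, h2, h3⟩ := hT x hx
      rw [hΦd, h2, h3, ← mul_add]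
      congr 1
      omega
    · intro x hx y hy hxy
      have h1 := hΦ hxy
      obtain ⟨-, h2, -⟩ := hT x hx
      obtain ⟨-, h3, -⟩ := hT y hy
      rw [h1, h3] at h2
      have h4 := Nat.eq_of_mul_eq_mul_left R.N_pos h2
      exact Sigma.ext (by omega) (heq_of_eq h1)
  have hlow : n * (R.cst ^ 2 * q ^ (R.N * t)) ≤ (T.card : ℝ) := by
    rw [Finset.card_sigma, Nat.cast_sum]
    calc n * (R.cst ^ 2 * q ^ (R.N * t)) = ∑ i ∈ Finset.range n, R.cst ^ 2 * q ^ (R.N * t) := by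
          rw [Finset.sum_const, Finset.card_range, nsmul_eq_mul]
      _ ≤ _ := by
          refine Finset.sum_le_sum fun i hi => ?_
          rw [Finset.mem_range] at hi
          rw [Finset.card_product, Nat.cast_mul]
          have h1 : R.cst ^ 2 * q ^ (R.N * t) = (R.cst * q ^ (R.N * (m₀ + i))) *
              (R.cst * q ^ (R.N * (t - (m₀ + i)))) := by
            rw [show R.N * t = R.N * (m₀ + i) + R.N * (t - (m₀ + i)) by
              rw [← mul_add]; congr 1; omega, pow_add]
            ring
          rw [h1]
          exact mul_le_mul (hm₀ _ (by omega)) (hm₀ _ (by omega)) (by positivity) (by positivity)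
  have hcard' : (T.card : ℝ) ≤ Q * q ^ (R.N * t) := by rw [hq]; exact_mod_cast hcard
  have h5 := hlow.trans hcard'
  rw [← mul_assoc] at h5
  have h6 := le_of_mul_le_mul_right h5 (by positivity)
  rw [div_lt_iff₀ (by positivity)] at hn
  linarith

end Modulus
end OnePlace

namespace AdjoinRoot

variable {k A K : Type*} [Field k] [CommRing A] [Field K] [Algebra k A] [Algebra A K]
    [Algebra k K] [IsScalarTower k A K] [IsDedekindDomain A] [IsFractionRing A K]
    {g : k[X]} [Fact (Irreducible (g.map (algebraMap k K)))]

theorem aeval_root_map : aeval (root (g.map (algebraMap k K))) g = 0 := by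
  rw [← aeval_map_algebraMap K, aeval_eq, mk_self]

theorem isSeparable_map (hs : g.Separable) :
    Algebra.IsSeparable K (AdjoinRoot (g.map (algebraMap k K))) := by
  have h0 : g.map (algebraMap k K) ≠ 0 := Irreducible.ne_zero Fact.out
  have h1 : IsSeparable K (root (g.map (algebraMap k K))) := by
    have h2 : minpoly K (root (g.map (algebraMap k K))) ∣ g.map (algebraMap k K) :=
      minpoly.dvd _ _ (by rw [aeval_eq, mk_self])
    exact (hs.map (f := algebraMap k K)).of_dvd h2
  have h2 := (IntermediateField.isSeparable_adjoin_simple_iff_isSeparable K _).mpr h1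
  rw [IntermediateField.adjoin_root_eq_top] at h2
  exact AlgEquiv.Algebra.isSeparable IntermediateField.topEquiv

variable (A) in
theorem isIntegral_aeval_root (hg : g.Monic) (b : k[X]) :
    IsIntegral A (aeval (root (g.map (algebraMap k K))) b) := by
  have h1 : IsIntegral k (root (g.map (algebraMap k K))) := ⟨g, hg, aeval_root_map⟩
  have h2 : IsIntegral k (aeval (root (g.map (algebraMap k K))) b) :=
    IsIntegral.of_mem_of_fg _ h1.fg_adjoin_singleton _ (aeval_mem_adjoin_singleton k _)
  exact h2.tower_top

theorem mem_adjoin_root_of_isIntegral (hg : g.Monic) (hs : g.Separable)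
    {z : AdjoinRoot (g.map (algebraMap k K))} (hz : IsIntegral A z) :
    z ∈ Algebra.adjoin A {root (g.map (algebraMap k K))} := by
  have hsep := isSeparable_map (K := K) hs
  have h0 : g.map (algebraMap k K) ≠ 0 := Irreducible.ne_zero Fact.out
  have : FiniteDimensional K (AdjoinRoot (g.map (algebraMap k K))) := (powerBasis h0).finite
  have hcl : IsIntegral A (powerBasis h0).gen := by
    have := isIntegral_aeval_root A (K := K) hg X
    simpa using this
  have h1 := Algebra.discr_mul_isIntegral_mem_adjoin K hcl hz
  obtain ⟨a, b, hab⟩ := hs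
  set θ := root (g.map (algebraMap k K)) with hθ
  have hmin : minpoly K θ = g.map (algebraMap k K) := by
    rw [hθ, minpoly_root h0, (hg.map _).leadingCoeff, inv_one, C_1, mul_one]
  have h2 : aeval θ b * aeval θ (derivative g) = 1 := by
    have := congrArg (aeval θ) hab
    simpa [aeval_root_map, hθ] using this
  have h3 : ∃ c : A, algebraMap A K c * Algebra.discr K (powerBasis h0).basis = 1 := by
    rw [Algebra.discr_powerBasis_eq_norm]
    rw [powerBasis_gen, ← hθ, hmin, derivative_map, aeval_map_algebraMap]
    obtain ⟨c, hc⟩ := IsIntegrallyClosed.isIntegral_iff.mp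
      (Algebra.isIntegral_norm K (isIntegral_aeval_root A (K := K) hg b))
    refine ⟨c * (-1) ^ (Module.finrank K (AdjoinRoot (g.map (algebraMap k K))) *
      (Module.finrank K (AdjoinRoot (g.map (algebraMap k K))) - 1) / 2), ?_⟩
    have h4 : Algebra.norm K (aeval θ b) * Algebra.norm K (aeval θ (derivative g)) = 1 := by
      rw [← map_mul, h2, map_one]
    have h5 : ∀ s x y : K, s * s = 1 → x * y = 1 → x * s * (s * y) = 1 :=
      fun s x y hs hxy => by linear_combination x * y * hs + hxy
    rw [map_mul, map_pow, map_neg, map_one, hc]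
    exact h5 _ _ _ (by rw [← mul_pow]; simp) h4
  obtain ⟨c, hc⟩ := h3
  have h4 := Subalgebra.smul_mem _ h1 c
  rwa [← algebraMap_smul K c, smul_smul, hc, one_smul, powerBasis_gen] at h4

theorem isDedekindDomain_adjoin (hg : g.Monic) (hs : g.Separable) :
    IsDedekindDomain (Algebra.adjoin A {root (g.map (algebraMap k K))}) := by
  have hsep := isSeparable_map (K := K) hs
  have h0 : g.map (algebraMap k K) ≠ 0 := Irreducible.ne_zero Fact.out
  have : FiniteDimensional K (AdjoinRoot (g.map (algebraMap k K))) := (powerBasis h0).finite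
  have : IsIntegralClosure (Algebra.adjoin A {root (g.map (algebraMap k K))}) A
      (AdjoinRoot (g.map (algebraMap k K))) := by
    refine ⟨Subtype.val_injective, fun {x} => ⟨fun hx => ⟨⟨x, mem_adjoin_root_of_isIntegral hg hs hx⟩, rfl⟩, ?_⟩⟩
    rintro ⟨y, rfl⟩
    have := isIntegral_aeval_root A (K := K) hg X
    rw [aeval_X] at this
    exact adjoin_le_integralClosure this y.2
  exact IsIntegralClosure.isDedekindDomain A K (AdjoinRoot (g.map (algebraMap k K))) _

theorem minpoly_root_map (hg : g.Monic) :
    minpoly A (root (g.map (algebraMap k K))) = g.map (algebraMap k A) := by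
  have h0 : g.map (algebraMap k K) ≠ 0 := Irreducible.ne_zero Fact.out
  have hcl : IsIntegral A (root (g.map (algebraMap k K))) := by
    have := isIntegral_aeval_root A (K := K) hg X
    simpa using this
  have h1 := minpoly.isIntegrallyClosed_eq_field_fractions' K hcl
  rw [minpoly_root h0, (hg.map _).leadingCoeff, inv_one, C_1, mul_one] at h1
  refine (Polynomial.map_injective _ (IsFractionRing.injective A K) ?_).symm
  rw [← h1, Polynomial.map_map, ← IsScalarTower.algebraMap_eq k A K]

end AdjoinRoot

namespace OnePlace
open WithZero

variable {k A K : Type*} [Field k] [CommRing A] [Field K] [Algebra k A] [Algebra A K]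
    [Algebra k K]
    [IsScalarTower k A K] [IsDedekindDomain A] [IsFractionRing A K]

theorem mem_range_of_isIntegral (D : OnePlace k A K) {x : K} (hx : IsIntegral k x) :
    x ∈ Set.range (algebraMap k K) := by
  obtain ⟨a, rfl⟩ := IsIntegrallyClosed.isIntegral_iff.mp (hx.tower_top (A := A))
  have h1 : D.v (algebraMap A K a) ≤ 1 := by
    have h2 : IsIntegral D.v.integer (algebraMap A K a) := by
      obtain ⟨p, hp, hpx⟩ := hx
      refine ⟨p.map ((algebraMap k K).codRestrict D.v.integer fun c => D.v_const c), hp.map _, ?_⟩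
      rw [eval₂_map]
      exact hpx
    exact (Valuation.integer.integers D.v).mem_of_integral h2
  obtain ⟨c, rfl⟩ := D.const a h1
  exact ⟨c, IsScalarTower.algebraMap_apply k A K c⟩

theorem irreducible_map (D : OnePlace k A K) {g : k[X]} (hg : g.Monic) (hi : Irreducible g) :
    Irreducible (g.map (algebraMap k K)) := by
  have hl : ∀ f : K[X], f.Monic → f ∣ g.map (algebraMap k K) →
      ∃ f' : k[X], f'.Monic ∧ f'.map (algebraMap k K) = f := by
    intro f hf hd
    have h1 := integralClosure.mem_lifts_of_monic_of_dvd_map K hg hf hd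
    have h2 : f ∈ lifts (algebraMap k K) := by
      rw [lifts_iff_coeff_lifts] at h1 ⊢
      intro n
      obtain ⟨y, hy⟩ := h1 n
      rw [← hy]
      exact D.mem_range_of_isIntegral y.2
    obtain ⟨f', h3, -, h4⟩ := lifts_and_degree_eq_and_monic h2 hf
    exact ⟨f', h4, h3⟩
  rw [(hg.map _).irreducible_iff_natDegree']
  rw [hg.irreducible_iff_natDegree'] at hi
  refine ⟨fun h => hi.1 (map_injective _ (algebraMap k K).injective (by rw [h, Polynomial.map_one])), ?_⟩
  intro f1 f2 h1 h2 h12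
  obtain ⟨f1, h1', rfl⟩ := hl f1 h1 (Dvd.intro _ h12)
  obtain ⟨f2, h2', rfl⟩ := hl f2 h2 (Dvd.intro_left _ h12)
  rw [← Polynomial.map_mul] at h12
  rw [natDegree_map, natDegree_map]
  exact hi.2 f1 f2 h1' h2' (map_injective _ (algebraMap k K).injective h12)


namespace Modulus
variable {D : OnePlace k A K} (R : D.Modulus) [Finite k]

/-- **Schmidt's theorem**, in the form: the degrees of primes have no common prime factor. -/
theorem exists_not_dvd_deg {r : ℕ} (hr : r.Prime) : ∃ p : R.Pt, ¬ r ∣ R.deg p := by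
  by_contra! hdvd
  obtain ⟨ℓ, hℓ⟩ := CharP.exists k
  have hℓp : Fact ℓ.Prime := ⟨CharP.char_is_prime k ℓ⟩
  have : NeZero r := ⟨hr.ne_zero⟩
  let E := FiniteField.Extension k ℓ r
  have hE : Module.finrank k E = r := FiniteField.finrank_extension k ℓ r
  let pE : PowerBasis k E := Field.powerBasisOfFiniteOfSeparable k E
  have hα : IsIntegral k pE.gen := Algebra.IsIntegral.isIntegral _
  let g := minpoly k pE.gen
  have hg : g.Monic := minpoly.monic hα
  have hs : g.Separable := Algebra.IsSeparable.isSeparable k pE.gen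
  have hi : Irreducible g := minpoly.irreducible hα
  have : Fact (Irreducible (g.map (algebraMap k K))) := ⟨D.irreducible_map hg hi⟩
  let θ := AdjoinRoot.root (g.map (algebraMap k K))
  have hθ : IsIntegral A θ := by
    have := AdjoinRoot.isIntegral_aeval_root A (K := K) hg X
    simpa using this
  have htf : Module.IsTorsionFree A (AdjoinRoot (g.map (algebraMap k K))) :=
    .trans_faithfulSMul A K _
  let B := Algebra.adjoin A {θ}
  have hB : IsDedekindDomain B := AdjoinRoot.isDedekindDomain_adjoin hg hs
  let pB : PowerBasis A B := Algebra.adjoin.powerBasis' hθ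
  have hmin : minpoly A pB.gen = g.map (algebraMap k A) := by
    rw [Algebra.adjoin.powerBasis'_gen]
    refine Eq.trans ?_ (AdjoinRoot.minpoly_root_map (K := K) hg)
    exact (minpoly.algebraMap_eq (B' := AdjoinRoot (g.map (algebraMap k K)))
      Subtype.val_injective _).symm
  have hAB : FaithfulSMul A B := by
    rw [faithfulSMul_iff_algebraMap_injective]
    intro a a' h
    have h1 := congrArg (algebraMap B (AdjoinRoot (g.map (algebraMap k K)))) h
    rw [← IsScalarTower.algebraMap_apply, ← IsScalarTower.algebraMap_apply] at h1
    exact FaithfulSMul.algebraMap_injective A _ h1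
  have : Nonempty (Fin pB.dim) := pB.basis.index_nonempty
  have hfin : ∀ p : R.Pt, Finite (A ⧸ p.1.asIdeal) := fun p => D.finite_quot_ideal p.1.ne_bot
  have hy : ∀ p : R.Pt, ∃ y : Bool → A ⧸ p.1.asIdeal, y true ≠ y false ∧ ∀ b, aeval (y b) g = 0 := by
    intro p
    let := Ideal.Quotient.field p.1.asIdeal
    have h1 := FiniteField.natCard_algHom_of_finrank_dvd (F := k) (K := E)
      (L := A ⧸ p.1.asIdeal) (by rw [hE]; exact hdvd p)
    rw [hE] at h1
    have h2 : Nontrivial (E →ₐ[k] A ⧸ p.1.asIdeal) :=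
      Finite.one_lt_card_iff_nontrivial.mp (by rw [h1]; exact hr.one_lt)
    obtain ⟨φ, ψ, hφψ⟩ := h2
    refine ⟨fun b => if b then φ pE.gen else ψ pE.gen, ?_, ?_⟩
    · exact fun h => hφψ (pE.algHom_ext h)
    · rintro (_ | _)
      · exact (aeval_algHom_apply ψ pE.gen g).trans (by rw [minpoly.aeval, map_zero])
      · exact (aeval_algHom_apply φ pE.gen g).trans (by rw [minpoly.aeval, map_zero])
  choose y hy1 hy2 using hy
  let ψ : ∀ x : Bool × R.Pt, B →ₐ[A] A ⧸ x.2.1.asIdeal := fun x =>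
    pB.lift (y x.2 x.1) (by rw [hmin, aeval_map_algebraMap]; exact hy2 x.2 x.1)
  have hψs : ∀ x, Function.Surjective (ψ x) := by
    intro x z
    obtain ⟨a, rfl⟩ := Ideal.Quotient.mk_surjective z
    exact ⟨algebraMap A B a, (ψ x).commutes a⟩
  have hcomap : ∀ x, (RingHom.ker (ψ x)).comap (algebraMap A B) = x.2.1.asIdeal := by
    intro x
    ext a
    rw [Ideal.mem_comap, RingHom.mem_ker, (ψ x).commutes]
    exact Ideal.Quotient.eq_zero_iff_mem
  let P : Bool × R.Pt → HeightOneSpectrum B := fun x =>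
    ⟨RingHom.ker (ψ x), RingHom.ker_isPrime _, fun h => by
      have h1 := hcomap x
      rw [h, ← RingHom.ker_eq_comap_bot, (RingHom.injective_iff_ker_eq_bot _).mp
        (FaithfulSMul.algebraMap_injective A B)] at h1
      exact x.2.1.ne_bot h1.symm⟩
  refine R.false_of_two_primes pB.basis P ?_ ?_
  · rintro ⟨b, p⟩ ⟨b', p'⟩ h
    have h1 : RingHom.ker (ψ (b, p)) = RingHom.ker (ψ (b', p')) := congrArg HeightOneSpectrum.asIdeal h
    have h2 : p.1.asIdeal = p'.1.asIdeal := by rw [← hcomap (b, p), h1, hcomap (b', p')]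
    obtain rfl : p = p' := Subtype.ext (HeightOneSpectrum.ext h2)
    have h3 : y p b = y p b' := by
      obtain ⟨a, ha⟩ := Ideal.Quotient.mk_surjective (y p b)
      have h4 : pB.gen - algebraMap A B a ∈ RingHom.ker (ψ (b, p)) := by
        rw [RingHom.mem_ker, map_sub, (ψ (b, p)).commutes, PowerBasis.lift_gen]
        exact sub_eq_zero.mpr ha.symm
      rw [h1, RingHom.mem_ker, map_sub, (ψ (b', p)).commutes, PowerBasis.lift_gen] at h4
      exact ha.symm.trans (sub_eq_zero.mp h4).symm
    rcases b with _ | _ <;> rcases b' with _ | _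
    · rfl
    · exact absurd h3.symm (hy1 p)
    · exact absurd h3 (hy1 p)
    · rfl
  · intro x
    exact LinearEquiv.finrank_eq
      (((Ideal.quotientKerAlgEquivOfSurjective (hψs x)).restrictScalars k).toLinearEquiv)

end Modulus
end OnePlace

theorem Nat.Prime.exists_not_dvd_geomSum {ℓ : ℕ} (hℓ : ℓ.Prime) (q : ℕ) :
    ∃ r : ℕ, r.Prime ∧ ∀ m, ¬ r ∣ m → ¬ ℓ ∣ ∑ i ∈ Finset.range m, q ^ i := by
  have : Fact ℓ.Prime := ⟨hℓ⟩
  by_cases hq : (q : ZMod ℓ) = 1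
  · refine ⟨ℓ, hℓ, fun m hm h => hm ?_⟩
    rw [← ZMod.natCast_eq_zero_iff] at h ⊢
    simpa [hq] using h
  · refine ⟨(orderOf (q : ZMod ℓ)).minFac, Nat.minFac_prime (by rwa [Ne, orderOf_eq_one_iff]),
      fun m hm h => hm ((Nat.minFac_dvd _).trans (orderOf_dvd_of_pow_eq_one ?_))⟩
    have h1 := geom_sum_mul (q : ZMod ℓ) m
    rw [← ZMod.natCast_eq_zero_iff] at h
    push_cast at h
    rw [h, zero_mul] at h1
    exact (sub_eq_zero.mp h1.symm)

namespace OnePlace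
open WithZero

variable {k A K : Type*} [Field k] [CommRing A] [Field K] [Algebra k A] [Algebra A K]
    [Algebra k K]
    [IsScalarTower k A K] [IsDedekindDomain A] [IsFractionRing A K] [Finite k]

namespace Modulus
variable {D : OnePlace k A K} (R : D.Modulus)

theorem geomSum_card (m : ℕ) :
    ∑ i ∈ Finset.range m, Nat.card k ^ i = (Nat.card k ^ m - 1) / (Nat.card k - 1) :=
  Nat.geomSum_eq Finite.one_lt_card m

theorem natCard_quot (p : R.Pt) : Nat.card (A ⧸ p.1.asIdeal) = Nat.card k ^ R.deg p := by
  have := D.module_finite_quot_ideal p.1.ne_bot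
  exact Module.natCard_eq_pow_finrank

theorem pow_sub_one_mem_of_rho_eq_one {p : R.Pt} (hp : R.rho {p} = 1) :
    R.w ^ (∑ i ∈ Finset.range (R.deg p), Nat.card k ^ i) - 1 ∈ p.1.asIdeal := by
  let := Ideal.Quotient.field p.1.asIdeal
  have := D.module_finite_quot_ideal p.1.ne_bot
  have hf : Finite (A ⧸ p.1.asIdeal) := D.finite_quot_ideal p.1.ne_bot
  have h1 : Algebra.norm k (Ideal.Quotient.mk p.1.asIdeal R.w) = 1 := by
    rw [rho, pr_singleton] at hp
    exact hp
  have h2 := FiniteField.algebraMap_norm_eq_pow (K := k) (x := Ideal.Quotient.mk p.1.asIdeal R.w)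
  rw [h1, R.natCard_quot, ← geomSum_card] at h2
  rw [← Ideal.Quotient.eq_zero_iff_mem, map_sub, map_pow, map_one]
  exact sub_eq_zero.mpr (h2.symm.trans (map_one _))

theorem pow_sub_one_mem {p : R.Pt} {z : A} (hz : z ∉ p.1.asIdeal) :
    z ^ ((Nat.card k - 1) * ∑ i ∈ Finset.range (R.deg p), Nat.card k ^ i) - 1 ∈ p.1.asIdeal := by
  let := Ideal.Quotient.field p.1.asIdeal
  have hf : Finite (A ⧸ p.1.asIdeal) := D.finite_quot_ideal p.1.ne_bot
  have := Fintype.ofFinite (A ⧸ p.1.asIdeal)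
  have h1 : Ideal.Quotient.mk p.1.asIdeal z ≠ 0 := by rwa [Ne, Ideal.Quotient.eq_zero_iff_mem]
  have h2 := FiniteField.pow_card_sub_one_eq_one _ h1
  rw [← Nat.card_eq_fintype_card, R.natCard_quot] at h2
  rw [← Ideal.Quotient.eq_zero_iff_mem, map_sub, map_pow, map_one, geomSum_card,
    Nat.mul_div_cancel' (by simpa only [one_pow] using Nat.sub_dvd_pow_sub_pow (Nat.card k) 1 _)]
  exact sub_eq_zero.mpr h2

end Modulus

theorem exists_congr_of_prime (D : OnePlace k A K) {w : A} {e : ℕ} (hw : D.va w = exp (e : ℤ))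
    (he : 0 < e) (hcop : e.Coprime (Nat.card k - 1)) {a : A} (ha : IsCoprime a w) {ℓ : ℕ}
    (hℓ : ℓ.Prime) :
    ∃ (a' : A) (n : ℕ), a' - a ∈ Ideal.span {w ^ 2} ∧ a' ≠ 0 ∧ ¬ ℓ ∣ n ∧ a' ∣ w ^ n - 1 ∧
      ∀ z, IsCoprime z a' → a' ∣ z ^ ((Nat.card k - 1) * n) - 1 := by
  obtain ⟨r, hr, hrl⟩ := hℓ.exists_not_dvd_geomSum (Nat.card k)
  have hq : 0 < Nat.card k - 1 := Nat.sub_pos_of_lt Finite.one_lt_card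
  let R : D.Modulus :=
    { w := w, e := e, M := (Nat.card k - 1) * r, hw := hw, he := he, hM := Nat.mul_pos hq hr.pos }
  have hM : Nat.card k - 1 ∣ R.M := Dvd.intro _ rfl
  have hrN : r ∣ R.N := Dvd.dvd.mul_left (Dvd.intro_left _ rfl) _
  set t := R.M * (3 + D.j0) with ht
  have hte : 3 * R.e + D.j0 ≤ R.e * t := by
    have h1 : 3 + D.j0 ≤ t := Nat.le_mul_of_pos_left _ R.hM
    have h2 : D.j0 ≤ R.e * D.j0 := Nat.le_mul_of_pos_left _ R.he
    calc 3 * R.e + D.j0 ≤ R.e * (3 + D.j0) := by rw [mul_add]; omega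
      _ ≤ _ := Nat.mul_le_mul_left _ h1
  have hdeg : ∀ x : A, D.va x = exp ((R.e * t : ℕ) : ℤ) → ∀ s, R.pr s = Ideal.span {x} →
      ((R.degS s : ℕ) : ZMod R.N) = 0 := by
    intro x hx s hs
    rw [← R.finrank_pr, hs, D.finrank_quot hx, ZMod.natCast_eq_zero_iff, ht, Modulus.N]
    exact ⟨3 + D.j0, by ring⟩
  have hcopx : ∀ b x : A, IsCoprime b w → x - b ∈ Ideal.span {w ^ 2} → IsCoprime x w := by
    intro b x hb hx
    obtain ⟨c, hc⟩ := Ideal.mem_span_singleton.mp hx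
    rw [show x = b + w * (w * c) by linear_combination hc]
    exact IsCoprime.add_mul_left_left hb _
  obtain ⟨h, hh⟩ := R.exists_not_dvd_deg hr
  obtain ⟨x₀, hx₀a, hx₀v, hx₀n⟩ := R.exists_quotNorm_eq hcop ha (one_ne_zero (α := k)) hte
  obtain ⟨x₂, hx₂a, hx₂v, hx₂n⟩ := R.exists_quotNorm_eq hcop (isCoprime_one_left (x := R.w))
    (inv_ne_zero (R.rho_ne_zero {h})) hte
  obtain ⟨s₀, hs₀⟩ := R.exists_pr_eq_span (D.ne_zero_of_va hx₀v) (hcopx _ _ ha hx₀a)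
  obtain ⟨s₂, hs₂⟩ := R.exists_pr_eq_span (D.ne_zero_of_va hx₂v)
    (hcopx _ _ isCoprime_one_left hx₂a)
  obtain ⟨p₁, hp₁, -⟩ := R.exists_prime_of_class (R.clOf ({h} + s₂)) 0
  obtain ⟨p₂, hp₂, hp₁₂⟩ := R.exists_prime_of_class (R.clOf s₀ - R.clOf {p₁}) (R.deg p₁ + 1)
  have hp : R.clOf ({p₁} + {p₂}) = R.clOf s₀ := by rw [map_add, hp₂]; abel
  have hρ₁ : R.rho {p₁} = 1 := by
    rw [R.rho_congr hM hp₁, R.rho_add, Modulus.rho, Modulus.rho, hs₂, hx₂n]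
    exact mul_inv_cancel₀ (R.rho_ne_zero {h})
  have hρ₂ : R.rho {p₂} = 1 := by
    have h1 := R.rho_congr hM hp
    rw [R.rho_add, hρ₁, one_mul] at h1
    rw [h1, Modulus.rho, hs₀, hx₀n]
  have hd₁ : (R.deg p₁ : ZMod R.N) = R.deg h := by
    have h1 := congrArg R.degCl hp₁
    rw [R.degCl_clOf, R.degCl_clOf, R.degS_add, R.degS_singleton, R.degS_singleton, Nat.cast_add,
      hdeg x₂ hx₂v s₂ hs₂, add_zero] at h1
    exact h1
  have hd₂ : ((R.deg p₁ + R.deg p₂ : ℕ) : ZMod R.N) = 0 := by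
    have h1 := congrArg R.degCl hp
    rw [R.degCl_clOf, R.degCl_clOf, R.degS_add, R.degS_singleton, R.degS_singleton,
      hdeg x₀ hx₀v s₀ hs₀] at h1
    exact h1
  have hr₁ : ¬ r ∣ R.deg p₁ := by
    rw [ZMod.natCast_eq_natCast_iff] at hd₁
    rwa [(hd₁.of_dvd hrN).dvd_iff dvd_rfl]
  have hr₂ : ¬ r ∣ R.deg p₂ := by
    rw [ZMod.natCast_eq_zero_iff] at hd₂
    exact fun h2 => hr₁ ((Nat.dvd_add_left h2).mp (hrN.trans hd₂))
  obtain ⟨x, hx, x', hx', hxx⟩ := R.clOf_eq_clOf.mp hp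
  rw [R.pr_add, R.pr_singleton, R.pr_singleton, hs₀, Ideal.span_singleton_mul_span_singleton] at hxx
  have hx0 := Modulus.ne_zero_of_mem_ray hx
  obtain ⟨z, hz⟩ : x ∣ x' * x₀ := by
    rw [← Ideal.mem_span_singleton]
    refine Ideal.mul_le_left (J := p₁.1.asIdeal * p₂.1.asIdeal) ?_
    rw [hxx]
    exact Ideal.mem_span_singleton_self _
  rw [hz, ← Ideal.span_singleton_mul_span_singleton] at hxx
  have hpz : p₁.1.asIdeal * p₂.1.asIdeal = Ideal.span {z} :=
    mul_left_cancel₀ (by rwa [Ne, Ideal.zero_eq_bot, Ideal.span_singleton_eq_bot]) hxx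
  have hne : p₁.1.asIdeal ≠ p₂.1.asIdeal := by
    intro h
    have h1 : R.deg p₁ = R.deg p₂ := by rw [Modulus.deg, h]; rfl
    omega
  have hmem : ∀ y : A, y ∈ p₁.1.asIdeal → y ∈ p₂.1.asIdeal → z ∣ y := by
    intro y h1 h2
    rw [← Ideal.mem_span_singleton, ← hpz]
    rw [← Ideal.inf_eq_mul_of_isCoprime]
    · exact ⟨h1, h2⟩
    · rw [Ideal.isCoprime_iff_sup_eq]
      exact p₁.1.isMaximal.coprime_of_ne p₂.1.isMaximal hne
  have hz0 : z ∈ p₁.1.asIdeal * p₂.1.asIdeal := by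
    rw [hpz]
    exact Ideal.mem_span_singleton_self z
  have hz1 : z ∈ p₁.1.asIdeal := Ideal.mul_le_left hz0
  have hz2 : z ∈ p₂.1.asIdeal := Ideal.mul_le_right hz0
  have hpow : ∀ (I : Ideal A) (y : A) (m n : ℕ), y ^ m - 1 ∈ I → m ∣ n → y ^ n - 1 ∈ I := by
    rintro I y m _ h ⟨n, rfl⟩
    exact I.mem_of_dvd (by simpa only [pow_mul, one_pow] using sub_dvd_pow_sub_pow (y ^ m) 1 n) h
  refine ⟨z, (∑ i ∈ Finset.range (R.deg p₁), Nat.card k ^ i) *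
    ∑ i ∈ Finset.range (R.deg p₂), Nat.card k ^ i, ?_, ?_, ?_, ?_, ?_⟩
  · obtain ⟨_, hx1, -⟩ := hx
    obtain ⟨_, hx1', -⟩ := hx'
    obtain ⟨c, hc⟩ := Ideal.mem_span_singleton.mp hx1
    obtain ⟨c', hc'⟩ := Ideal.mem_span_singleton.mp hx1'
    obtain ⟨c₀, hc₀⟩ := Ideal.mem_span_singleton.mp hx₀a
    refine Ideal.mem_span_singleton.mpr ⟨c' * x₀ + c₀ - c * z, ?_⟩
    change x - 1 = w ^ 2 * c at hc
    change x' - 1 = w ^ 2 * c' at hc'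
    change x₀ - a = w ^ 2 * c₀ at hc₀
    linear_combination x₀ * hc' + hc₀ - z * hc - hz
  · rintro rfl
    have h1 : p₁.1.asIdeal * p₂.1.asIdeal = ⊥ := by rw [hpz]; simp
    rcases Ideal.mul_eq_bot.mp h1 with h | h
    · exact p₁.1.ne_bot h
    · exact p₂.1.ne_bot h
  · rw [hℓ.dvd_mul]
    rintro (h | h)
    · exact hrl _ hr₁ h
    · exact hrl _ hr₂ h
  · exact hmem _ (hpow _ _ _ _ (R.pow_sub_one_mem_of_rho_eq_one hρ₁) (Dvd.intro _ rfl))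
      (hpow _ _ _ _ (R.pow_sub_one_mem_of_rho_eq_one hρ₂) (Dvd.intro_left _ rfl))
  · intro y hy
    have hn : ∀ p : R.Pt, z ∈ p.1.asIdeal → y ∉ p.1.asIdeal := by
      intro p hp hyp
      obtain ⟨c, d, hcd⟩ := hy
      refine p.1.isPrime.ne_top ((Ideal.eq_top_iff_one _).mpr ?_)
      rw [← hcd]
      exact add_mem (Ideal.mul_mem_left _ _ hyp) (Ideal.mul_mem_left _ _ hp)
    refine hmem _ (hpow _ _ _ _ (R.pow_sub_one_mem (hn p₁ hz1)) ?_)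
      (hpow _ _ _ _ (R.pow_sub_one_mem (hn p₂ hz2)) ?_)
    · exact mul_dvd_mul_left _ (Dvd.intro _ rfl)
    · exact mul_dvd_mul_left _ (Dvd.intro_left _ rfl)

end OnePlace

theorem Finite.exists_pow_isIdempotentElem {M : Type*} [Monoid M] [Finite M] (r : M) :
    ∃ m : ℕ, 0 < m ∧ IsIdempotentElem (r ^ m) := by
  obtain ⟨a, d, hd, h⟩ : ∃ a d : ℕ, 0 < d ∧ r ^ (a + d) = r ^ a := by
    obtain ⟨i, j, hij, h⟩ := Finite.exists_ne_map_eq_of_infinite (fun n : ℕ => r ^ n)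
    beta_reduce at h
    rcases lt_or_gt_of_ne hij with hlt | hlt
    · exact ⟨i, j - i, by omega, by rw [Nat.add_sub_cancel' hlt.le, h]⟩
    · exact ⟨j, i - j, by omega, by rw [Nat.add_sub_cancel' hlt.le, h]⟩
  have hper : ∀ n j : ℕ, a ≤ j → r ^ (j + n * d) = r ^ j := by
    intro n
    induction n with
    | zero => intro j _; simp
    | succ n ih =>
      intro j hj
      obtain ⟨c, rfl⟩ := Nat.exists_eq_add_of_le' hj
      rw [show c + a + (n + 1) * d = c + (a + d) + n * d by ring, ih _ (by omega), pow_add, h,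
        pow_add]
  refine ⟨(a + 1) * d, by positivity, ?_⟩
  rw [IsIdempotentElem, ← pow_add]
  exact hper _ _ (by nlinarith)

/-- Units lift along surjective homomorphisms from finite commutative rings. -/
theorem Finite.exists_isUnit_map_eq {R S : Type*} [CommRing R] [CommRing S] [Finite R] (φ : R →+* S)
    (hφ : Function.Surjective φ) {u : S} (hu : IsUnit u) : ∃ r, IsUnit r ∧ φ r = u := by
  have : Finite S := Finite.of_surjective φ hφ
  obtain ⟨r, rfl⟩ := hφ u
  obtain ⟨n, hn, hnr⟩ : ∃ n : ℕ, 0 < n ∧ (φ r) ^ n = 1 := by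
    have h := hu.isOfFinOrder
    exact ⟨orderOf (φ r), h.orderOf_pos, pow_orderOf_eq_one _⟩
  obtain ⟨m, hm, hmr⟩ := Finite.exists_pow_isIdempotentElem (r ^ n)
  set e := (r ^ n) ^ m with he
  have hee : e * e = e := hmr
  have hφe : φ e = 1 := by rw [he, map_pow, map_pow, hnr, one_pow]
  have hnm : 0 < n * m := Nat.mul_pos hn hm
  have hre : r * r ^ (n * m - 1) = e := by
    rw [← pow_succ', Nat.sub_add_cancel hnm, he, pow_mul]
  refine ⟨r * e + (1 - e), ?_, ?_⟩
  · refine IsUnit.of_mul_eq_one (r ^ (n * m - 1) * e + (1 - e)) ?_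
    generalize r ^ (n * m - 1) = r' at hre
    generalize e = f at hee hre
    linear_combination (f * f) * hre + (f + 2 - r - r') * hee
  · rw [map_add, map_mul, map_sub, hφe, map_one, mul_one, sub_self, add_zero]

namespace OnePlace
open WithZero

variable {k A₀ F : Type*} [Field k] [CommRing A₀] [Field F] [Algebra k A₀] [Algebra A₀ F]
    [Algebra k F]
    [IsScalarTower k A₀ F] [IsDedekindDomain A₀] [IsFractionRing A₀ F] [Finite k]
    {A : Type*} [CommRing A] [IsDomain A] [Algebra A₀ A] [Algebra A F] [FaithfulSMul A F]
    [IsScalarTower A₀ A F]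

section

theorem exists_algebraMap_mul_eq (D : OnePlace k A₀ F) (y : A) : ∃ s t : A₀, s ≠ 0 ∧ algebraMap A₀ A s * y = algebraMap A₀ A t := by
  obtain ⟨t, s, hs, h⟩ := IsFractionRing.div_surjective A₀ (algebraMap A F y)
  have hs0 : algebraMap A₀ F s ≠ 0 := by
    rw [Ne, FaithfulSMul.algebraMap_eq_zero_iff]
    exact nonZeroDivisors.ne_zero hs
  refine ⟨s, t, nonZeroDivisors.ne_zero hs, FaithfulSMul.algebraMap_injective A F ?_⟩
  rw [map_mul, ← IsScalarTower.algebraMap_apply, ← IsScalarTower.algebraMap_apply, ← h]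
  field_simp

theorem exists_dvd_algebraMap (D : OnePlace k A₀ F) {a : A} (ha : a ≠ 0) : ∃ t : A₀, t ≠ 0 ∧ a ∣ algebraMap A₀ A t := by
  obtain ⟨s, t, hs, h⟩ := exists_algebraMap_mul_eq D a
  refine ⟨t, ?_, Dvd.intro_left _ h⟩
  rintro rfl
  rw [map_zero] at h
  have h1 : algebraMap A₀ F s = 0 := by
    rw [IsScalarTower.algebraMap_apply A₀ A F, (mul_eq_zero.mp h).resolve_right ha, map_zero]
  exact hs ((FaithfulSMul.algebraMap_eq_zero_iff A₀ F).mp h1)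

/-- An overring of a Dedekind domain is the sum of the domain and any nonzero principal ideal. -/
theorem exists_dvd_sub_algebraMap (D : OnePlace k A₀ F) {a : A} (ha : a ≠ 0) (y : A) :
    ∃ s : A₀, a ∣ y - algebraMap A₀ A s := by
  let I : Ideal A₀ := 
    { carrier := {s | ∃ t, algebraMap A₀ A s * y = algebraMap A₀ A t}
      add_mem' := by
        rintro s s' ⟨t, ht⟩ ⟨t', ht'⟩
        exact ⟨t + t', by rw [map_add, map_add, add_mul, ht, ht']⟩
      zero_mem' := ⟨0, by simp⟩
      smul_mem' := by
        rintro c s ⟨t, ht⟩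
        exact ⟨c * t, by rw [smul_eq_mul, map_mul, map_mul, mul_assoc, ht]⟩ }
  let J : Ideal A₀ := (Ideal.span {a}).comap (algebraMap A₀ A)
  have hIJ : I ⊔ J = ⊤ := by
    by_contra hne
    obtain ⟨P, hP, hle⟩ := Ideal.exists_le_maximal _ hne
    have hIP : I ≤ P := le_sup_left.trans hle
    have hJP : J ≤ P := le_sup_right.trans hle
    have hP0 : P ≠ ⊥ := by
      rintro rfl
      obtain ⟨t, ht, h⟩ := exists_dvd_algebraMap D ha
      exact ht (hJP (Ideal.mem_span_singleton.mpr h))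
    let p : HeightOneSpectrum A₀ := ⟨P, hP.isPrime, hP0⟩
    let v := p.valuation F
    have hcl : ∀ z : A, v (algebraMap A F z) ≤ 1 → ∃ σ ∈ P.primeCompl, ∃ γ, 
        algebraMap A₀ A σ * z = algebraMap A₀ A γ := by
      intro z hz
      obtain ⟨γ, σ, h⟩ := p.exists_primeCompl_mul_eq_of_integer _ hz
      refine ⟨σ, σ.2, γ, FaithfulSMul.algebraMap_injective A F ?_⟩
      rw [map_mul, ← IsScalarTower.algebraMap_apply, ← IsScalarTower.algebraMap_apply, ← h,
        mul_comm]
    rcases le_or_gt (v (algebraMap A F y)) 1 with hy | hy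
    · obtain ⟨σ, hσ, γ, h⟩ := hcl y hy
      exact hσ (hIP ⟨γ, h⟩)
    · have ha' : algebraMap A F a ≠ 0 := (FaithfulSMul.algebraMap_eq_zero_iff A F).not.mpr ha
      have hva : v (algebraMap A F a) ≠ 0 := (Valuation.ne_zero_iff v).mpr ha'
      obtain ⟨N, hN⟩ := MulArchimedean.arch (v (algebraMap A F a))⁻¹ hy
      have hy0 : algebraMap A F y ≠ 0 := by
        intro h
        rw [h, map_zero] at hy
        exact not_lt_zero hy
      have h1 : 1 ≤ v (algebraMap A F (a * y ^ N)) := by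
        rw [map_mul, map_mul, map_pow, map_pow]
        calc 1 = v (algebraMap A F a) * (v (algebraMap A F a))⁻¹ := (mul_inv_cancel₀ hva).symm
          _ ≤ _ := by gcongr
      have h2 : v (algebraMap A F (a * y ^ N))⁻¹ ≤ 1 := by
        rw [map_inv₀]
        exact inv_le_one_of_one_le₀ h1
      obtain ⟨γ, σ, h⟩ := p.exists_primeCompl_mul_eq_of_integer _ h2
      refine σ.2 (hJP (Ideal.mem_span_singleton.mpr ?_))
      refine ⟨y ^ N * algebraMap A₀ A γ, FaithfulSMul.algebraMap_injective A F ?_⟩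
      rw [map_mul, map_mul, ← IsScalarTower.algebraMap_apply, ← IsScalarTower.algebraMap_apply,
        ← h, map_mul, map_pow]
      field_simp
  obtain ⟨s, hs, j, hj, hsj⟩ := Submodule.mem_sup.mp (hIJ ▸ Submodule.mem_top : (1 : A₀) ∈ I ⊔ J)
  obtain ⟨t, ht⟩ := hs
  refine ⟨t, ?_⟩
  have h1 : y - algebraMap A₀ A t = algebraMap A₀ A j * y := by
    have := congrArg (algebraMap A₀ A) hsj
    rw [map_add, map_one] at this
    linear_combination ht - y * this
  rw [h1]
  exact (Ideal.mem_span_singleton.mp hj).mul_right y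

end
end OnePlace

namespace OnePlace
open WithZero

variable {k A₀ F : Type*} [Field k] [CommRing A₀] [Field F] [Algebra k A₀] [Algebra A₀ F]
    [Algebra k F]
    [IsScalarTower k A₀ F] [IsDedekindDomain A₀] [IsFractionRing A₀ F] [Finite k]

theorem exists_coprime_pole (D : OnePlace k A₀ F) {I : Ideal A₀} (hI : I ≠ ⊥) (a₀ : A₀) :
    ∃ (x : A₀) (e : ℕ), x - a₀ ∈ I ∧ D.va x = exp (e : ℤ) ∧ 0 < e ∧
      e.Coprime (Nat.card k - 1) := by
  obtain ⟨b, hb, hb0⟩ := Submodule.exists_mem_ne_zero_of_ne_bot hI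
  obtain ⟨i, hi⟩ := D.exists_va_eq hb0
  obtain ⟨ϖ, hϖ⟩ := D.unif
  have hq : 1 ≤ Nat.card k - 1 := by
    have := Finite.one_lt_card (α := k)
    omega
  set n : ℕ := 1 + (Nat.card k - 1) * (i + D.j0) with hn
  have hlt : i + D.j0 < n := by nlinarith
  obtain ⟨x, hx, hvx⟩ := D.approx_ideal hb hi a₀ (ϖ⁻¹ ^ n)
  have hz : D.v (ϖ⁻¹ ^ n) = exp (n : ℤ) := by
    rw [map_pow, map_inv₀, hϖ, ← exp_neg, neg_neg, ← exp_nsmul, nsmul_eq_mul, mul_one]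
  refine ⟨x, n, hx, ?_, by omega, ?_⟩
  · rw [D.v.map_sub_swap] at hvx
    rw [va_apply, ← hz]
    have : algebraMap A₀ F x = ϖ⁻¹ ^ n + (algebraMap A₀ F x - ϖ⁻¹ ^ n) := by ring
    rw [this]
    refine Valuation.map_add_eq_of_lt_left _ (hvx.trans_lt ?_)
    rw [hz]
    exact exp_lt_exp.mpr (by exact_mod_cast hlt)
  · rw [hn, Nat.coprime_add_mul_left_left]
    exact Nat.coprime_one_left _

variable {A : Type*} [CommRing A] [IsDomain A] [Algebra A₀ A] [Algebra A F] [FaithfulSMul A F]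
    [IsScalarTower A₀ A F]

theorem comap_span_ne_bot (D : OnePlace k A₀ F) {a : A} (ha : a ≠ 0) :
    (Ideal.span {a}).comap (algebraMap A₀ A) ≠ ⊥ := by
  obtain ⟨t, ht, h⟩ := exists_dvd_algebraMap D ha
  intro hb
  have : t ∈ (Ideal.span {a}).comap (algebraMap A₀ A) := Ideal.mem_span_singleton.mpr h
  rw [hb] at this
  exact ht this

theorem surjective_mk_comp (D : OnePlace k A₀ F) {a : A} (ha : a ≠ 0) :
    Function.Surjective ((Ideal.Quotient.mk (Ideal.span {a})).comp (algebraMap A₀ A)) := by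
  intro y
  obtain ⟨y, rfl⟩ := Ideal.Quotient.mk_surjective y
  obtain ⟨s, hs⟩ := exists_dvd_sub_algebraMap D ha y
  exact ⟨s, (Ideal.Quotient.eq.mpr (Ideal.mem_span_singleton.mpr hs)).symm⟩

theorem finite_quot_overring (D : OnePlace k A₀ F) {a : A} (ha : a ≠ 0) :
    Finite (A ⧸ Ideal.span {a}) := by
  have := D.finite_quot_ideal (comap_span_ne_bot D ha)
  refine Finite.of_surjective (Ideal.quotientMap (Ideal.span {a}) (algebraMap A₀ A) le_rfl) ?_
  intro y
  obtain ⟨s, hs⟩ := surjective_mk_comp D ha y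
  exact ⟨Ideal.Quotient.mk _ s, hs⟩

theorem exists_coprime_lift (D : OnePlace k A₀ F) {b : A₀} (hb : b ≠ 0) {c : A} (hc : c ≠ 0)
    (hcb : c ∣ algebraMap A₀ A b) {y : A} (hy : IsCoprime y c) :
    ∃ y₀, IsCoprime y₀ b ∧ c ∣ y - algebraMap A₀ A y₀ := by
  have hle : Ideal.span {b} ≤ (Ideal.span {c}).comap (algebraMap A₀ A) := by
    rw [Ideal.span_singleton_le_iff_mem]
    exact Ideal.mem_span_singleton.mpr hcb
  have : Finite (A₀ ⧸ Ideal.span {b}) := D.finite_quot_ideal (by simpa using hb)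
  have hu : IsUnit (Ideal.Quotient.mk (Ideal.span {c}) y) := by
    obtain ⟨s, t, h⟩ := hy
    refine IsUnit.of_mul_eq_one (Ideal.Quotient.mk _ s) ?_
    rw [← map_mul, ← map_one (Ideal.Quotient.mk _), Ideal.Quotient.eq, Ideal.mem_span_singleton]
    exact ⟨-t, by linear_combination h⟩
  obtain ⟨r, hr, hry⟩ := Finite.exists_isUnit_map_eq
    (Ideal.quotientMap (Ideal.span {c}) (algebraMap A₀ A) hle) (fun y => by
      obtain ⟨s, hs⟩ := surjective_mk_comp D hc y
      exact ⟨Ideal.Quotient.mk _ s, hs⟩) hu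
  obtain ⟨y₀, rfl⟩ := Ideal.Quotient.mk_surjective r
  refine ⟨y₀, ?_, ?_⟩
  · obtain ⟨r', hr'⟩ := hr.exists_right_inv
    obtain ⟨s, rfl⟩ := Ideal.Quotient.mk_surjective r'
    rw [← map_mul, ← map_one (Ideal.Quotient.mk _), Ideal.Quotient.eq,
      Ideal.mem_span_singleton] at hr'
    obtain ⟨t, ht⟩ := hr'
    exact ⟨s, -t, by linear_combination ht⟩
  · rw [Ideal.quotientMap_mk, eq_comm, Ideal.Quotient.eq, Ideal.mem_span_singleton] at hry
    exact hry

theorem algebraMap_overring_ne_zero (D : OnePlace k A₀ F) {b : A₀} (hb : b ≠ 0) :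
    algebraMap A₀ A b ≠ 0 := by
  intro h
  refine hb ((FaithfulSMul.algebraMap_eq_zero_iff A₀ F).mp ?_)
  rw [IsScalarTower.algebraMap_apply A₀ A F, h, map_zero]

theorem exists_dvd_sq_pow_sub_one (D : OnePlace k A₀ F) (a x : A) (hax : IsCoprime a x) (l : ℕ)
    (hl : l.Prime) : ∃ (s t : A) (n : ℕ), ¬ l ∣ n ∧
      a + t * (x + s * a) ^ 2 ∣ (x + s * a) ^ n - 1 := by
  rcases eq_or_ne a 0 with rfl | ha
  · obtain ⟨y, hy⟩ := (isCoprime_zero_left.mp hax).exists_right_inv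
    refine ⟨0, y ^ 2, 1, hl.one_lt.not_ge ∘ Nat.le_of_dvd one_pos, ?_⟩
    have : (0 : A) + y ^ 2 * (x + 0 * 0) ^ 2 = 1 := by
      linear_combination (x * y + 1) * hy
    rw [this]
    exact one_dvd _
  · obtain ⟨s₀, hs₀⟩ := exists_dvd_sub_algebraMap D ha x
    obtain ⟨w, e, hwa, hwe, he, hcop⟩ := D.exists_coprime_pole (comap_span_ne_bot D ha) s₀
    have hw0 : w ≠ 0 := D.ne_zero_of_va hwe
    obtain ⟨s, hs⟩ : a ∣ algebraMap A₀ A w - x := by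
      have h1 := Ideal.mem_span_singleton.mp hwa
      rw [map_sub] at h1
      have := dvd_sub h1 hs₀
      rwa [sub_sub_sub_cancel_right] at this
    have hxs : x + s * a = algebraMap A₀ A w := by linear_combination -hs
    have hw0' := algebraMap_overring_ne_zero (A := A) D hw0
    have hcop' : IsCoprime a (algebraMap A₀ A w) := by
      rw [← hxs]
      exact IsCoprime.add_mul_right_right hax s
    obtain ⟨a₁, ha₁, haa⟩ := exists_coprime_lift D (pow_ne_zero 2 hw0) (pow_ne_zero 2 hw0')
      (by rw [map_pow]) (hcop'.pow_right (n := 2))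
    obtain ⟨a', n, ha', ha'0, hn, hdvd, -⟩ := D.exists_congr_of_prime hwe he hcop
      ((IsCoprime.pow_right_iff two_pos).mp ha₁) hl
    obtain ⟨t₁, ht₁⟩ := haa
    obtain ⟨t₂, ht₂⟩ := Ideal.mem_span_singleton.mp ha'
    have ht₂' := congrArg (algebraMap A₀ A) ht₂
    rw [map_sub, map_mul, map_pow] at ht₂'
    refine ⟨s, algebraMap A₀ A t₂ - t₁, n, hn, ?_⟩
    rw [hxs, show a + (algebraMap A₀ A t₂ - t₁) * algebraMap A₀ A w ^ 2 = algebraMap A₀ A a' by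
      linear_combination ht₁ - ht₂', ← map_pow, ← map_one (algebraMap A₀ A), ← map_sub]
    exact map_dvd _ hdvd

theorem exists_dvd_unit_pow_sub_one (D : OnePlace k A₀ F) (u : Aˣ) (a B : A) (haB : IsCoprime a B)
    (hB : B ≠ 0) (l : ℕ) (hl : l.Prime) :
    ∃ (t : A) (n : ℕ), ¬ l ∣ n ∧ a + t * B ∣ (u : A) ^ ((Nat.card k - 1) * n) - 1 := by
  obtain ⟨w, e, hwB, hwe, he, hcop⟩ := D.exists_coprime_pole (comap_span_ne_bot D hB) 0
  rw [sub_zero] at hwB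
  have hw0 : w ≠ 0 := D.ne_zero_of_va hwe
  have hBw := Ideal.mem_span_singleton.mp hwB
  obtain ⟨a₁, ha₁, haa⟩ := exists_coprime_lift D hw0 hB hBw haB
  obtain ⟨a', n, ha', ha'0, hn, -, hdvd⟩ := D.exists_congr_of_prime hwe he hcop ha₁ hl
  obtain ⟨z, hz, huz⟩ := exists_coprime_lift D ha'0
    (algebraMap_overring_ne_zero (A := A) D ha'0) dvd_rfl
    (y := (u : A)) ⟨((u⁻¹ : Aˣ) : A), 0, by simp⟩
  obtain ⟨t₁, ht₁⟩ := haa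
  obtain ⟨t₂, ht₂⟩ := Ideal.mem_span_singleton.mp ha'
  obtain ⟨t₃, ht₃⟩ := hBw
  have ht₂' := congrArg (algebraMap A₀ A) ht₂
  rw [map_sub, map_mul, map_pow, ht₃] at ht₂'
  refine ⟨B * t₃ ^ 2 * algebraMap A₀ A t₂ - t₁, n, hn, ?_⟩
  rw [show a + (B * t₃ ^ 2 * algebraMap A₀ A t₂ - t₁) * B = algebraMap A₀ A a' by
    linear_combination ht₁ - ht₂']
  have h1 := map_dvd (algebraMap A₀ A) (hdvd z hz)
  rw [map_sub, map_pow, map_one] at h1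
  have h2 := huz.trans (sub_dvd_pow_sub_pow (u : A) (algebraMap A₀ A z) ((Nat.card k - 1) * n))
  rw [← sub_add_sub_cancel _ (algebraMap A₀ A z ^ ((Nat.card k - 1) * n))]
  exact dvd_add h2 h1

theorem exists_unit_pow_ne_one (D : OnePlace k A₀ F) (hU : Infinite Aˣ) :
    ∃ u : Aˣ, ∀ n : ℕ, 0 < n → u ^ n ≠ 1 := by
  by_contra! h
  have hmem : ∀ u : Aˣ, algebraMap A F u ∈ Set.range (algebraMap k F) := by
    intro u
    obtain ⟨n, hn, hun⟩ := h u
    have hcl : IsIntegral k (algebraMap A F u) := by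
      refine ⟨X ^ n - 1, monic_X_pow_sub_C 1 hn.ne', ?_⟩
      rw [eval₂_sub, eval₂_X_pow, eval₂_one, ← map_pow, ← Units.val_pow_eq_pow_val, hun]
      simp
    obtain ⟨c, hc⟩ := D.mem_range_of_isIntegral hcl
    exact ⟨c, hc⟩
  have hfin : (Set.range (algebraMap k F)).Finite := Set.finite_range _
  have hinj : Function.Injective (fun u : Aˣ => algebraMap A F u) :=
    (FaithfulSMul.algebraMap_injective A F).comp Units.val_injective
  have : Finite Aˣ := by
    have := hfin.to_subtype
    exact Finite.of_injective (fun u : Aˣ => (⟨_, hmem u⟩ : Set.range (algebraMap k F)))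
      (fun u u' h => hinj (congrArg Subtype.val h))
  exact not_finite Aˣ

theorem finite_abelianization {k A₀ F A : Type} [Field k] [CommRing A₀] [Field F] [Algebra k A₀]
    [Algebra A₀ F] [Algebra k F] [IsScalarTower k A₀ F] [IsDedekindDomain A₀] [IsFractionRing A₀ F]
    [Finite k] (D : OnePlace k A₀ F) [CommRing A] [IsDomain A] [Algebra A₀ A] [Algebra A F]
    [FaithfulSMul A F] [IsScalarTower A₀ A F] (hU : Infinite Aˣ) :
    Finite (Abelianization (Matrix.SpecialLinearGroup (Fin 2) A)) ∧
      ∀ x : Abelianization (Matrix.SpecialLinearGroup (Fin 2) A), x ^ 6 = 1 := by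
  obtain ⟨u, hu⟩ := exists_unit_pow_ne_one D hU
  obtain ⟨p, hp⟩ := CharP.exists k
  have : Fact p.Prime := ⟨(CharP.char_is_prime_or_zero k p).resolve_right (CharP.char_ne_zero_of_finite k p)⟩
  have hF : CharP F p := charP_of_injective_algebraMap (algebraMap k F).injective p
  have hA : CharP A p := (RingHom.charP_iff (algebraMap A F) (FaithfulSMul.algebraMap_injective A F) p).mpr hF
  refine SLTwo.abelianization_of_trivial (u := u) (p := p) ?_ (fun a ha => finite_quot_overring D ha) ?_
  · intro h
    refine hu 2 two_pos (Units.ext ?_)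
    rw [Units.val_pow_eq_pow_val, sub_eq_zero.mp h, Units.val_one]
  · intro Q _ φ hφU hφL
    have hq : 0 < Nat.card k - 1 := by
      have := Finite.one_lt_card (α := k)
      omega
    exact SLTwo.phi_trivial hφU hφL (m := Nat.card k - 1)
      (fun a B h hB l hl => exists_dvd_unit_pow_sub_one D u a B h hB l hl) hq hu
      (fun a ha => finite_quot_overring D ha) (fun a x h l hl => exists_dvd_sq_pow_sub_one D a x h l hl)

end OnePlace

namespace OnePlace
open WithZero

section
variable {W F : Type*} [CommRing W] [IsDedekindDomain W] [Field F] [Algebra W F]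
  [IsFractionRing W F]

theorem mem_range_iff_valuation_le_one (x : F) :
    x ∈ Set.range (algebraMap W F) ↔ ∀ Q : HeightOneSpectrum W, Q.valuation F x ≤ 1 := by
  constructor
  · rintro ⟨w, rfl⟩ Q
    exact Q.valuation_le_one w
  · exact HeightOneSpectrum.mem_integers_of_valuation_le_one F x

/-- Weak approximation at one place, keeping integrality at all the others. -/
theorem exists_sub_valuation_le_one (P : HeightOneSpectrum W) (z : F) :
    ∃ z', P.valuation F (z - z') ≤ 1 ∧
      ∀ Q : HeightOneSpectrum W, Q ≠ P → Q.valuation F z' ≤ 1 := by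
  obtain ⟨x, y, hy, rfl⟩ := IsFractionRing.div_surjective W z
  have hy0 : y ≠ 0 := nonZeroDivisors.ne_zero hy
  have hy0' : algebraMap W F y ≠ 0 := (FaithfulSMul.algebraMap_eq_zero_iff W F).not.mpr hy0
  obtain ⟨m, hm⟩ : ∃ m : ℕ, P.intValuation y = exp (-(m : ℤ)) :=
    ⟨_, P.intValuation_if_neg hy0⟩
  have hdvd : P.asIdeal ^ m ∣ Ideal.span {y} := 
    (P.intValuation_le_pow_iff_dvd y m).mp hm.le
  obtain ⟨J, hJ⟩ := hdvd
  have hJP : ¬ J ≤ P.asIdeal := by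
    intro h
    have h1 : P.asIdeal ^ (m + 1) ∣ Ideal.span {y} := by
      rw [hJ, pow_succ]
      exact mul_dvd_mul_left _ (Ideal.dvd_iff_le.mpr h)
    have h2 := (P.intValuation_le_pow_iff_dvd y (m + 1)).mpr h1
    rw [hm, exp_le_exp] at h2
    push_cast at h2
    omega
  have hcop : IsCoprime J (P.asIdeal ^ m) := by
    refine IsCoprime.pow_right ?_
    rw [Ideal.isCoprime_iff_sup_eq]
    by_contra hne
    exact hJP (le_sup_left.trans ((P.isMaximal.eq_of_le hne le_sup_right).ge))
  obtain ⟨e, he, i, hi, hei⟩ := Submodule.mem_sup.mp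
    (Ideal.isCoprime_iff_sup_eq.mp hcop ▸ Submodule.mem_top : (1 : W) ∈ J ⊔ P.asIdeal ^ m)
  refine ⟨algebraMap W F e * (algebraMap W F x / algebraMap W F y), ?_, ?_⟩
  · have h1 : algebraMap W F x / algebraMap W F y -
        algebraMap W F e * (algebraMap W F x / algebraMap W F y) =
        algebraMap W F x * (algebraMap W F i / algebraMap W F y) := by
      have := congrArg (algebraMap W F) hei
      rw [map_add, map_one] at this
      field_simp
      linear_combination algebraMap W F x * (-this)
    rw [h1, map_mul]
    refine mul_le_one' (P.valuation_le_one x) ?_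
    rw [map_div₀, P.valuation_of_algebraMap, P.valuation_of_algebraMap, hm]
    refine div_le_one_of_le₀ ?_ zero_le
    exact (P.intValuation_le_pow_iff_mem i m).mpr hi
  · intro Q hQ
    obtain ⟨π, hπ, hπQ⟩ : ∃ π ∈ P.asIdeal ^ m, π ∉ Q.asIdeal := by
      by_contra! h
      have h1 : P.asIdeal ≤ Q.asIdeal := Q.isPrime.le_of_pow_le h
      exact hQ (HeightOneSpectrum.ext (P.isMaximal.eq_of_le Q.isPrime.ne_top h1).symm)
    have h1 : π * e ∈ Ideal.span {y} := hJ ▸ Ideal.mul_mem_mul hπ he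
    obtain ⟨c, hc⟩ := Ideal.mem_span_singleton.mp h1
    have hπ0 : π ≠ 0 := fun h => hπQ (h ▸ zero_mem _)
    have hvπ : Q.valuation F (algebraMap W F π) = 1 := by
      rw [Q.valuation_of_algebraMap]
      exact Q.intValuation_eq_one_iff.mpr hπQ
    have h2 : algebraMap W F π * (algebraMap W F e * (algebraMap W F x / algebraMap W F y)) =
        algebraMap W F (c * x) := by
      have := congrArg (algebraMap W F) hc
      rw [map_mul, map_mul] at this
      rw [map_mul]
      field_simp
      linear_combination algebraMap W F x * this
    have h3 := congrArg (Q.valuation F) h2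
    rw [map_mul, hvπ, one_mul] at h3
    rw [h3]
    exact Q.valuation_le_one _

variable (O : Subring F) (P : HeightOneSpectrum W)

/-- Elements of `O` with poles only at `P`. -/
def onePlaceRing : Subring F where
  carrier := {x | x ∈ O ∧ ∀ Q : HeightOneSpectrum W, Q ≠ P → Q.valuation F x ≤ 1}
  mul_mem' := fun ⟨ha, ha'⟩ ⟨hb, hb'⟩ => ⟨mul_mem ha hb, fun Q hQ => by
    rw [map_mul]; exact mul_le_one' (ha' Q hQ) (hb' Q hQ)⟩
  one_mem' := ⟨one_mem _, fun Q _ => by rw [map_one]⟩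
  add_mem' := fun ⟨ha, ha'⟩ ⟨hb, hb'⟩ => ⟨add_mem ha hb, fun Q hQ =>
    ((Q.valuation F).map_add _ _).trans (max_le (ha' Q hQ) (hb' Q hQ))⟩
  zero_mem' := ⟨zero_mem _, fun Q _ => by rw [map_zero]; exact zero_le⟩
  neg_mem' := fun ⟨ha, ha'⟩ => ⟨neg_mem ha, fun Q hQ => by rw [Valuation.map_neg]; exact ha' Q hQ⟩

variable {O P} {s : F}

theorem s_le {s : F} (hs : ∀ Q : HeightOneSpectrum W, Q.valuation F s ≤ exp (-1))
    (Q : HeightOneSpectrum W) (N : ℕ) : Q.valuation F (s ^ N) ≤ exp (-(N : ℤ)) := by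
  rw [map_pow]
  refine (pow_le_pow_left₀ zero_le (hs Q) N).trans_eq ?_
  rw [← exp_nsmul]
  simp

theorem s_le_one {s : F} (hs : ∀ Q : HeightOneSpectrum W, Q.valuation F s ≤ exp (-1))
    (Q : HeightOneSpectrum W) (N : ℕ) : Q.valuation F (s ^ N) ≤ 1 :=
  (s_le hs Q N).trans (exp_le_exp.mpr (by omega) |>.trans_eq exp_zero)

theorem finite_onePlaceRing_le (hs : ∀ Q : HeightOneSpectrum W, Q.valuation F s ≤ exp (-1))
    (hfin : ∀ N : ℕ, {x ∈ O | s ^ N * x ∈ Set.range (algebraMap W F)}.Finite) (j : ℤ) :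
    {x ∈ onePlaceRing O P | P.valuation F x ≤ exp j}.Finite := by
  refine (hfin j.toNat).subset ?_
  rintro x ⟨⟨hxO, hx⟩, hxj⟩
  refine ⟨hxO, (mem_range_iff_valuation_le_one _).mpr fun Q => ?_⟩
  rw [map_mul]
  rcases eq_or_ne Q P with rfl | hQ
  · refine (mul_le_mul' (s_le hs Q _) hxj).trans ?_
    rw [← exp_add, ← exp_zero, exp_le_exp]
    omega
  · exact mul_le_one' (s_le_one hs Q _) (hx Q hQ)

theorem exists_approx (hs : ∀ Q : HeightOneSpectrum W, Q.valuation F s ≤ exp (-1))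
    (hsum : ∀ N : ℕ, ∃ S : Set F, S.Finite ∧ ∀ x, ∃ b ∈ S, ∃ o ∈ O, ∃ w : W,
      x - b - o = s ^ N * algebraMap W F w) :
    ∃ j0 : ℕ, ∀ z, ∃ a ∈ onePlaceRing O P, P.valuation F (z - a) ≤ exp (j0 : ℤ) := by
  classical
  obtain ⟨S, hS, h⟩ := hsum 0
  -- `G b z`: the element `z`, regular away from `P`, is congruent to `b`
  let G : F → F → Prop := fun b z => (∀ Q : HeightOneSpectrum W, Q ≠ P → Q.valuation F z ≤ 1) ∧
    ∃ o ∈ O, ∃ w : W, z - b - o = algebraMap W F w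
  have hpole : ∀ z : F, ∃ j : ℕ, P.valuation F z ≤ exp (j : ℤ) := by
    intro z
    rcases eq_or_ne z 0 with rfl | hz
    · exact ⟨0, by rw [map_zero]; exact zero_le⟩
    · refine ⟨(log (P.valuation F z)).toNat, ?_⟩
      have hz' : P.valuation F z ≠ 0 := (Valuation.ne_zero_iff _).mpr hz
      conv_lhs => rw [← exp_log hz']
      exact exp_le_exp.mpr (Int.self_le_toNat _)
  have hrep : ∀ b, ∃ j : ℕ, (∃ z, G b z) → ∃ z, G b z ∧ P.valuation F z ≤ exp (j : ℤ) := by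
    intro b
    by_cases hb : ∃ z, G b z
    · obtain ⟨z, hz⟩ := hb
      obtain ⟨j, hj⟩ := hpole z
      exact ⟨j, fun _ => ⟨z, hz, hj⟩⟩
    · exact ⟨0, fun h => absurd h hb⟩
  choose j hj using hrep
  refine ⟨hS.toFinset.sup j, fun z => ?_⟩
  obtain ⟨z', hz', hzQ⟩ := exists_sub_valuation_le_one P z
  obtain ⟨b, hb, o, ho, w, how⟩ := h z'
  rw [pow_zero, one_mul] at how
  obtain ⟨y, ⟨hyQ, o', ho', w', how'⟩, hy⟩ := hj b ⟨z', hzQ, o, ho, w, how⟩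
  have hdiff : o - o' = z' - y - algebraMap W F (w - w') := by
    rw [map_sub, ← how, ← how']
    ring
  refine ⟨o - o', ⟨sub_mem ho ho', fun Q hQ => ?_⟩, ?_⟩
  · rw [hdiff]
    refine ((Q.valuation F).map_sub _ _).trans (max_le ?_ (Q.valuation_le_one _))
    exact ((Q.valuation F).map_sub _ _).trans (max_le (hzQ Q hQ) (hyQ Q hQ))
  · have hle : exp ((j b : ℕ) : ℤ) ≤ exp ((hS.toFinset.sup j : ℕ) : ℤ) := by
      rw [exp_le_exp]
      exact_mod_cast Finset.le_sup (f := j) (hS.mem_toFinset.mpr hb)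
    have h1 : (1 : ℤᵐ⁰) ≤ exp ((hS.toFinset.sup j : ℕ) : ℤ) := by
      rw [← exp_zero, exp_le_exp]
      omega
    rw [hdiff, show z - (z' - y - algebraMap W F (w - w')) =
      (z - z') + (y + algebraMap W F (w - w')) by ring]
    refine ((P.valuation F).map_add _ _).trans (max_le (hz'.trans h1) ?_)
    exact ((P.valuation F).map_add _ _).trans (max_le (hy.trans hle)
      ((P.valuation_le_one _).trans h1))

/-- There are nonzero elements of the one-place ring with zeros of high order at all the other
places of `W`. -/
theorem exists_zeros (hs : ∀ Q : HeightOneSpectrum W, Q.valuation F s ≤ exp (-1))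
    (hsum : ∀ N : ℕ, ∃ S : Set F, S.Finite ∧ ∀ x, ∃ b ∈ S, ∃ o ∈ O, ∃ w : W,
      x - b - o = s ^ N * algebraMap W F w) (hs0 : s ≠ 0) (N : ℕ) :
    ∃ a ∈ O, a ≠ 0 ∧ ∀ Q : HeightOneSpectrum W, Q ≠ P →
      Q.valuation F a ≤ Q.valuation F (s ^ N) := by
  obtain ⟨S, hS, h⟩ := hsum N
  obtain ⟨ϖ, hϖ⟩ := P.valuation_exists_uniformizer F
  have hex : ∀ i : ℕ, ∃ z, P.valuation F z = exp ((i : ℤ) + 1) ∧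
      ∀ Q : HeightOneSpectrum W, Q ≠ P → Q.valuation F z ≤ 1 := by
    intro i
    obtain ⟨z, hz, hzQ⟩ := exists_sub_valuation_le_one P (ϖ⁻¹ ^ (i + 1))
    refine ⟨z, ?_, hzQ⟩
    have hv : P.valuation F (ϖ⁻¹ ^ (i + 1)) = exp ((i : ℤ) + 1) := by
      rw [map_pow, map_inv₀, hϖ, ← exp_neg, neg_neg, ← exp_nsmul, nsmul_eq_mul, mul_one]
      push_cast
      rfl
    rw [← hv, show z = ϖ⁻¹ ^ (i + 1) + (z - ϖ⁻¹ ^ (i + 1)) by ring]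
    refine Valuation.map_add_eq_of_lt_left _ ?_
    rw [Valuation.map_sub_swap, hv]
    refine hz.trans_lt ?_
    rw [← exp_zero, exp_lt_exp]
    omega
  choose z hz hzQ using hex
  choose b hb o ho w hw using fun i : ℕ => h (s ^ N * z i)
  have := hS.to_subtype
  obtain ⟨i, j, hij, hbij⟩ : ∃ i j : ℕ, i < j ∧ b i = b j := by
    obtain ⟨i, j, hij, h⟩ := Finite.exists_ne_map_eq_of_infinite (fun i : ℕ => (⟨b i, hb i⟩ : S))
    have h' : b i = b j := congrArg Subtype.val h
    rcases lt_or_gt_of_ne hij with hlt | hlt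
    · exact ⟨i, j, hlt, h'⟩
    · exact ⟨j, i, hlt, h'.symm⟩
  have ha : o j - o i = s ^ N * (z j - (z i + algebraMap W F (w j - w i))) := by
    rw [map_sub]
    linear_combination hw i - hw j + hbij
  refine ⟨o j - o i, sub_mem (ho j) (ho i), ?_, fun Q hQ => ?_⟩
  · rw [ha]
    refine mul_ne_zero (pow_ne_zero _ hs0) (sub_ne_zero.mpr fun h => ?_)
    have h1 : P.valuation F (z i + algebraMap W F (w j - w i)) < exp ((j : ℤ) + 1) := by
      refine ((P.valuation F).map_add _ _).trans_lt (max_lt ?_ ?_)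
      · rw [hz, exp_lt_exp]
        omega
      · refine (P.valuation_le_one _).trans_lt ?_
        rw [← exp_zero, exp_lt_exp]
        omega
    rw [← h, hz] at h1
    exact lt_irrefl _ h1
  · rw [ha, map_mul]
    refine mul_le_of_le_one_right' (((Q.valuation F).map_sub _ _).trans (max_le (hzQ j Q hQ) ?_))
    exact ((Q.valuation F).map_add _ _).trans (max_le (hzQ i Q hQ) (Q.valuation_le_one _))
end
end OnePlace

theorem IsDedekindDomain.of_finite_quotient (R K : Type*) [CommRing R] [IsDomain R] [Field K]
    [Algebra R K] [IsFractionRing R K] (hfin : ∀ x : R, x ≠ 0 → Finite (R ⧸ Ideal.span {x}))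
    (hcl : ∀ x : K, IsIntegral R x → x ∈ Set.range (algebraMap R K)) : IsDedekindDomain R := by
  have hN : IsNoetherianRing R := by
    refine ⟨fun I => ?_⟩
    rcases eq_or_ne I ⊥ with rfl | hI
    · exact Submodule.fg_bot
    obtain ⟨x, hx, hx0⟩ := Submodule.exists_mem_ne_zero_of_ne_bot hI
    have := hfin x hx0
    refine Submodule.fg_of_fg_map_of_fg_inf_ker (Ideal.span {x}).mkQ ?_ ?_
    · exact ⟨(Set.toFinite ((I.map (Ideal.span {x}).mkQ : Set (R ⧸ Ideal.span {x})))).toFinset, by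
        rw [Set.Finite.coe_toFinset, Submodule.span_eq]⟩
    · rw [Submodule.ker_mkQ, inf_eq_right.mpr ((I.span_singleton_le_iff_mem x).mpr hx)]
      exact ⟨{x}, by simp [Ideal.span]⟩
  have hD : Ring.DimensionLEOne R := by
    refine ⟨fun {p} hp hpp => ?_⟩
    obtain ⟨x, hx, hx0⟩ := Submodule.exists_mem_ne_zero_of_ne_bot hp
    have := hfin x hx0
    have : Finite (R ⧸ p) := Finite.of_surjective _
      (Ideal.Quotient.factor_surjective ((p.span_singleton_le_iff_mem).mpr hx))
    exact Ideal.Quotient.maximal_of_isField p (Finite.isDomain_to_isField _)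
  have hI : IsIntegrallyClosed R := (isIntegrallyClosed_iff K).mpr fun {x} hx => hcl x hx
  exact { }

namespace OnePlace
open WithZero

variable {W F : Type*} [CommRing W] [IsDedekindDomain W] [Field F] [Algebra W F]
  [IsFractionRing W F] {O : Subring F} {P : HeightOneSpectrum W} {s : F}

/-- The field of constants. -/
def constField (O : Subring F) (P : HeightOneSpectrum W)
    (h : {x ∈ onePlaceRing O P | P.valuation F x ≤ exp 0}.Finite) : Subfield F where
  carrier := {x | x ∈ onePlaceRing O P ∧ P.valuation F x ≤ 1}
  mul_mem' := fun ⟨ha, ha'⟩ ⟨hb, hb'⟩ => ⟨mul_mem ha hb, by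
    rw [map_mul]; exact mul_le_one' ha' hb'⟩
  one_mem' := ⟨one_mem _, by rw [map_one]⟩
  add_mem' := fun ⟨ha, ha'⟩ ⟨hb, hb'⟩ => ⟨add_mem ha hb,
    ((P.valuation F).map_add _ _).trans (max_le ha' hb')⟩
  zero_mem' := ⟨zero_mem _, by rw [map_zero]; exact zero_le⟩
  neg_mem' := fun ⟨ha, ha'⟩ => ⟨neg_mem ha, by rw [Valuation.map_neg]; exact ha'⟩
  inv_mem' := by
    rintro x ⟨hx, hx'⟩
    rcases eq_or_ne x 0 with rfl | hx0
    · rw [inv_zero]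
      exact ⟨zero_mem _, by rw [map_zero]; exact zero_le⟩
    have hpow : ∀ n : ℕ, x ^ n ∈ {x ∈ onePlaceRing O P | P.valuation F x ≤ exp 0} := fun n =>
      ⟨pow_mem hx n, by rw [map_pow, exp_zero]; exact pow_le_one' hx' n⟩
    have := h.to_subtype
    obtain ⟨i, j, hij, h⟩ := Finite.exists_ne_map_eq_of_infinite
      (fun n : ℕ => (⟨x ^ n, hpow n⟩ : {x ∈ onePlaceRing O P | P.valuation F x ≤ exp 0}))
    replace h : x ^ i = x ^ j := congrArg Subtype.val h
    have key : ∀ i d : ℕ, x ^ i = x ^ (i + (d + 1)) → x⁻¹ = x ^ d := by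
      intro i d h
      rw [pow_add, eq_comm, mul_eq_left₀ (pow_ne_zero _ hx0), pow_succ] at h
      exact inv_eq_of_mul_eq_one_left h
    obtain ⟨d, hd⟩ : ∃ d : ℕ, x⁻¹ = x ^ d := by
      rcases lt_or_gt_of_ne hij with hlt | hlt
      · exact ⟨j - i - 1, key i _ (by rw [h]; congr 1; omega)⟩
      · exact ⟨i - j - 1, key j _ (by rw [← h]; congr 1; omega)⟩
    rw [hd]
    have := hpow d
    rw [exp_zero] at this
    exact this

theorem isFractionRing_onePlaceRing (hs : ∀ Q : HeightOneSpectrum W, Q.valuation F s ≤ exp (-1))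
    (hsum : ∀ N : ℕ, ∃ S : Set F, S.Finite ∧ ∀ x, ∃ b ∈ S, ∃ o ∈ O, ∃ w : W,
      x - b - o = s ^ N * algebraMap W F w) (hs0 : s ≠ 0)
    (hW : ∀ x, ∃ N : ℕ, s ^ N * x ∈ Set.range (algebraMap W F))
    (hO : ∀ x, ∃ y ∈ O, y ≠ 0 ∧ x * y ∈ O) :
    IsFractionRing (onePlaceRing O P) F := by
  refine IsFractionRing.of_field _ _ fun x => ?_
  obtain ⟨y, hy, hy0, hxy⟩ := hO x
  obtain ⟨N₁, h₁⟩ := hW y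
  obtain ⟨N₂, h₂⟩ := hW (x * y)
  obtain ⟨a, haO, ha0, ha⟩ := exists_zeros (P := P) hs hsum hs0 (N₁ + N₂)
  rw [mem_range_iff_valuation_le_one] at h₁ h₂
  refine ⟨⟨a * (x * y), mul_mem haO hxy, fun Q hQ => ?_⟩, ⟨a * y, mul_mem haO hy, fun Q hQ => ?_⟩,
    ?_⟩
  · rw [map_mul]
    refine (mul_le_mul_left (ha Q hQ) _).trans ?_
    rw [← map_mul, pow_add, mul_assoc, map_mul]
    exact mul_le_one' (s_le_one hs Q _) (h₂ Q)
  · rw [map_mul]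
    refine (mul_le_mul_left (ha Q hQ) _).trans ?_
    rw [← map_mul, add_comm, pow_add, mul_assoc, map_mul]
    exact mul_le_one' (s_le_one hs Q _) (h₁ Q)
  · change x = (a * (x * y)) / (a * y)
    field_simp

theorem isDedekindDomain_onePlaceRing [IsFractionRing (onePlaceRing O P) F]
    (hs : ∀ Q : HeightOneSpectrum W, Q.valuation F s ≤ exp (-1))
    (hfin : ∀ N : ℕ, {x ∈ O | s ^ N * x ∈ Set.range (algebraMap W F)}.Finite)
    (hsum : ∀ N : ℕ, ∃ S : Set F, S.Finite ∧ ∀ x, ∃ b ∈ S, ∃ o ∈ O, ∃ w : W,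
      x - b - o = s ^ N * algebraMap W F w)
    (hcl : ∀ x, IsIntegral O x → x ∈ O) :
    IsDedekindDomain (onePlaceRing O P) := by
  refine IsDedekindDomain.of_finite_quotient _ F ?_ ?_
  · intro x hx
    have hx0 : (x : F) ≠ 0 := fun h => hx (Subtype.ext h)
    obtain ⟨j0, happ⟩ := exists_approx (P := P) hs hsum
    have hv : P.valuation F (x : F) ≠ 0 := (Valuation.ne_zero_iff _).mpr hx0
    have hfinite := finite_onePlaceRing_le (P := P) hs hfin ((j0 : ℤ) + log (P.valuation F (x : F)))
    have := hfinite.to_subtype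
    refine Finite.of_surjective (fun y : {y ∈ onePlaceRing O P | P.valuation F y ≤
      exp ((j0 : ℤ) + log (P.valuation F (x : F)))} =>
        Ideal.Quotient.mk (Ideal.span {x}) ⟨y.1, y.2.1⟩) fun z => ?_
    obtain ⟨z, rfl⟩ := Ideal.Quotient.mk_surjective z
    obtain ⟨a, ha, haz⟩ := happ (z / x)
    refine ⟨⟨z - x * a, sub_mem z.2 (mul_mem x.2 ha), ?_⟩, ?_⟩
    · rw [show (z : F) - x * a = (z / x - a) * x by field_simp, map_mul, exp_add, exp_log hv]
      exact mul_le_mul_left haz _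
    · rw [Ideal.Quotient.eq, Ideal.mem_span_singleton]
      exact ⟨-⟨a, ha⟩, Subtype.ext (by push_cast; ring)⟩
  · intro x hx
    obtain ⟨p, hp, hpx⟩ := hx
    refine ⟨⟨x, hcl x ?_, fun Q hQ => ?_⟩, rfl⟩
    · have hle : onePlaceRing O P ≤ O := fun y hy => hy.1
      refine ⟨p.map (Subring.inclusion hle), hp.map _, ?_⟩
      rw [eval₂_map]
      exact hpx
    · have hle : onePlaceRing O P ≤ (Q.valuation F).integer := fun y hy => hy.2 Q hQ
      refine (Valuation.integer.integers (Q.valuation F)).mem_of_integral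
        (x := x) ⟨p.map (Subring.inclusion hle), hp.map _, ?_⟩
      rw [eval₂_map]
      exact hpx

end OnePlace

open OnePlace WithZero in
/-- The main theorem in terms of lattices: `O` is the ring of functions regular at the finite
places, `W` the one of functions regular at infinity, and `s` the inverse of the variable. -/
theorem finite_abelianization_of_lattices {W F : Type} [CommRing W] [IsDedekindDomain W] [Field F]
    [Algebra W F] [IsFractionRing W F] (O : Subring F) (P : HeightOneSpectrum W) {s : F}
    (hs0 : s ≠ 0) (hs : ∀ Q : HeightOneSpectrum W, Q.valuation F s ≤ exp (-1))
    (hfin : ∀ N : ℕ, {x ∈ O | s ^ N * x ∈ Set.range (algebraMap W F)}.Finite)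
    (hsum : ∀ N : ℕ, ∃ S : Set F, S.Finite ∧ ∀ x, ∃ b ∈ S, ∃ o ∈ O, ∃ w : W,
      x - b - o = s ^ N * algebraMap W F w)
    (hcl : ∀ x, IsIntegral O x → x ∈ O)
    (hW : ∀ x, ∃ N : ℕ, s ^ N * x ∈ Set.range (algebraMap W F))
    (hO : ∀ x, ∃ y ∈ O, y ≠ 0 ∧ x * y ∈ O)
    {A : Type} [CommRing A] [IsDomain A] [Algebra A F] [FaithfulSMul A F] (j : O →+* A)
    (hj : ∀ x, algebraMap A F (j x) = x) (hU : Infinite Aˣ) :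
    Finite (Abelianization (Matrix.SpecialLinearGroup (Fin 2) A)) ∧
      ∀ x : Abelianization (Matrix.SpecialLinearGroup (Fin 2) A), x ^ 6 = 1 := by
  have hfr : IsFractionRing (onePlaceRing O P) F := isFractionRing_onePlaceRing hs hsum hs0 hW hO
  have hded : IsDedekindDomain (onePlaceRing O P) :=
    isDedekindDomain_onePlaceRing hs hfin hsum hcl
  have hk := finite_onePlaceRing_le (P := P) hs hfin 0
  let k := constField O P hk
  have hkfin : Finite k := by
    refine Set.Finite.to_subtype (hk.subset fun x hx => ⟨hx.1, ?_⟩)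
    rw [exp_zero]
    exact hx.2
  letI : Algebra k (onePlaceRing O P) :=
    (k.subtype.codRestrict (onePlaceRing O P) fun x => x.2.1).toAlgebra
  have : IsScalarTower k (onePlaceRing O P) F := IsScalarTower.of_algebraMap_eq fun x => rfl
  have hle : onePlaceRing O P ≤ O := fun x hx => hx.1
  letI : Algebra (onePlaceRing O P) A := (j.comp (Subring.inclusion hle)).toAlgebra
  have : IsScalarTower (onePlaceRing O P) A F := IsScalarTower.of_algebraMap_eq fun x =>
    (hj (Subring.inclusion hle x)).symm
  obtain ⟨j0, happ⟩ := exists_approx (P := P) hs hsum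
  let D : OnePlace k (onePlaceRing O P) F :=
    { v := P.valuation F
      v_const := fun c => c.2.2
      const := fun a ha => ⟨⟨a, a.2, ha⟩, rfl⟩
      unif := P.valuation_exists_uniformizer F
      j0 := j0
      approx := fun z => by
        obtain ⟨a, ha, h⟩ := happ z
        exact ⟨⟨a, ha⟩, h⟩
      fin := fun i => by
        refine ((finite_onePlaceRing_le (P := P) hs hfin i).preimage
          (Subtype.val_injective.injOn)).subset fun a ha => ⟨a.2, ha⟩ }
  exact D.finite_abelianization hU

namespace RatFunc
open WithZero

variable (k : Type*) [Field k] [DecidableEq (RatFunc k)]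

theorem exists_sub_polynomial_le_one (x : RatFunc k) :
    ∃ p : k[X], inftyValuation k (x - algebraMap k[X] (RatFunc k) p) ≤ 1 := by
  obtain ⟨n, d, hd, rfl⟩ := IsFractionRing.div_surjective k[X] x
  have hd0 : d ≠ 0 := nonZeroDivisors.ne_zero hd
  have hd0' : algebraMap k[X] (RatFunc k) d ≠ 0 :=
    (FaithfulSMul.algebraMap_eq_zero_iff _ _).not.mpr hd0
  refine ⟨n / d, ?_⟩
  have h := congrArg (algebraMap k[X] (RatFunc k)) (EuclideanDomain.div_add_mod n d)
  rw [map_add, map_mul] at h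
  have h1 : algebraMap k[X] (RatFunc k) n / algebraMap k[X] (RatFunc k) d -
      algebraMap k[X] (RatFunc k) (n / d) =
      algebraMap k[X] (RatFunc k) (n % d) / algebraMap k[X] (RatFunc k) d := by
    field_simp
    linear_combination -h
  rw [h1, map_div₀]
  refine div_le_one_of_le₀ ?_ zero_le
  rcases eq_or_ne (n % d) 0 with h0 | h0
  · rw [h0, map_zero, map_zero]
    exact zero_le
  · change inftyValuationDef k _ ≤ inftyValuationDef k _
    rw [inftyValuation.polynomial k h0, inftyValuation.polynomial k hd0, exp_le_exp]
    exact_mod_cast natDegree_le_natDegree (EuclideanDomain.mod_lt n hd0).le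

theorem finite_polynomial_le [Finite k] (N : ℕ) :
    {p : k[X] | inftyValuation k (algebraMap k[X] (RatFunc k) p) ≤ exp (N : ℤ)}.Finite := by
  have : Module.Finite k (degreeLT k (N + 1)) := Module.Finite.equiv (degreeLTEquiv k (N + 1)).symm
  have : Finite (degreeLT k (N + 1)) := Module.finite_of_finite k
  refine (Set.toFinite (degreeLT k (N + 1) : Set k[X])).subset fun p hp => ?_
  rw [SetLike.mem_coe, mem_degreeLT]
  rcases eq_or_ne p 0 with rfl | h0
  · simp
  · have hp' : inftyValuationDef k (algebraMap k[X] (RatFunc k) p) ≤ exp (N : ℤ) := hp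
    rw [inftyValuation.polynomial k h0, exp_le_exp] at hp'
    rw [degree_eq_natDegree h0]
    have : p.natDegree < N + 1 := by omega
    exact_mod_cast this

theorem inftyValuation_X_inv_pow (N : ℕ) :
    inftyValuation k ((X : RatFunc k)⁻¹ ^ N) = exp (-(N : ℤ)) := by
  rw [map_pow, map_inv₀, inftyValuation.X, ← exp_neg, ← exp_nsmul]
  simp

theorem exists_finite_add_polynomial [Finite k] (N : ℕ) :
    ∃ S : Set (RatFunc k), S.Finite ∧ ∀ x, ∃ b ∈ S, ∃ p : k[X],
      inftyValuation k (x - b - algebraMap k[X] (RatFunc k) p) ≤ exp (-(N : ℤ)) := by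
  refine ⟨_, (finite_polynomial_le k N).image
    fun p => algebraMap k[X] (RatFunc k) p * X⁻¹ ^ N, fun x => ?_⟩
  obtain ⟨p, hp⟩ := exists_sub_polynomial_le_one k (x * X ^ N)
  have hdm := congrArg (algebraMap k[X] (RatFunc k)) (EuclideanDomain.div_add_mod p (Polynomial.X ^ N))
  rw [map_add, map_mul, map_pow, algebraMap_X] at hdm
  refine ⟨_, ⟨p % Polynomial.X ^ N, ?_, rfl⟩, p / Polynomial.X ^ N, ?_⟩
  · change inftyValuationDef k _ ≤ _
    rcases eq_or_ne (p % Polynomial.X ^ N) 0 with h0 | h0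
    · rw [h0, map_zero]
      change inftyValuation k 0 ≤ _
      rw [map_zero]
      exact zero_le
    · rw [inftyValuation.polynomial k h0, exp_le_exp]
      have := natDegree_le_natDegree
        (EuclideanDomain.mod_lt p (pow_ne_zero N (Polynomial.X_ne_zero (R := k)))).le
      rw [natDegree_X_pow] at this
      exact_mod_cast this
  · have hX : (X : RatFunc k) ^ N ≠ 0 := pow_ne_zero _ X_ne_zero
    have : x - algebraMap k[X] (RatFunc k) (p % Polynomial.X ^ N) * X⁻¹ ^ N -
        algebraMap k[X] (RatFunc k) (p / Polynomial.X ^ N) =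
        (x * X ^ N - algebraMap k[X] (RatFunc k) p) * X⁻¹ ^ N := by
      rw [inv_pow]
      field_simp
      linear_combination -hdm
    rw [this, map_mul, inftyValuation_X_inv_pow]
    exact mul_le_of_le_one_left' hp

end RatFunc

namespace RatFunc
open WithZero

section
variable (k F : Type*) [Field k] [DecidableEq (RatFunc k)] [Field F] [Algebra (RatFunc k) F]

/-- The ring of functions regular at all the infinite places. -/
noncomputable abbrev infinityIntegers := integralClosure (inftyValuation k).valuationSubring F

/-- The inverse of the variable. -/
noncomputable abbrev invX : F := algebraMap (RatFunc k) F RatFunc.X⁻¹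

variable {k F}

theorem algebraMap_mem_infinityIntegers {x : RatFunc k} (hx : inftyValuation k x ≤ 1) :
    algebraMap (RatFunc k) F x ∈ infinityIntegers k F :=
  isIntegral_algebraMap (R := (inftyValuation k).valuationSubring) (A := F) (x := ⟨x, hx⟩)

variable (k F) in
theorem invX_mem : invX k F ∈ infinityIntegers k F := by
  refine algebraMap_mem_infinityIntegers ?_
  have := inftyValuation_X_inv_pow k 1
  rw [pow_one] at this
  rw [this, ← exp_zero, exp_le_exp]
  decide

theorem mem_of_isIntegral {x : RatFunc k}
    (hx : IsIntegral (inftyValuation k).valuationSubring x) : inftyValuation k x ≤ 1 := by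
  obtain ⟨y, rfl⟩ := IsIntegrallyClosed.isIntegral_iff.mp hx
  exact y.2

variable [FunctionField k F]

theorem exists_invX_pow_mul_mem (x : F) : ∃ N : ℕ, invX k F ^ N * x ∈ infinityIntegers k F := by
  have hx : IsAlgebraic (inftyValuation k).valuationSubring x :=
    (IsFractionRing.isAlgebraic_iff (inftyValuation k).valuationSubring (RatFunc k) F).mpr
      (Algebra.IsAlgebraic.isAlgebraic x)
  obtain ⟨y, hy0, hy⟩ := hx.exists_integral_multiple
  have hy0' : (y : RatFunc k) ≠ 0 := fun h => hy0 (Subtype.ext h)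
  have hv : inftyValuation k (y : RatFunc k) ≠ 0 := (Valuation.ne_zero_iff _).mpr hy0'
  refine ⟨(-log (inftyValuation k (y : RatFunc k))).toNat, ?_⟩
  have h1 : inftyValuation k (RatFunc.X⁻¹ ^ (-log (inftyValuation k (y : RatFunc k))).toNat *
      (y : RatFunc k)⁻¹) ≤ 1 := by
    rw [map_mul, inftyValuation_X_inv_pow, map_inv₀]
    refine mul_inv_le_one_of_le₀ ?_ zero_le
    conv_rhs => rw [← exp_log hv]
    rw [exp_le_exp]
    omega
  have h2 := mul_mem (algebraMap_mem_infinityIntegers (F := F) h1) hy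
  have h3 : algebraMap (RatFunc k) F y ≠ 0 := (_root_.map_ne_zero _).mpr hy0'
  have h4 : y • x = algebraMap (RatFunc k) F y * x := by
    rw [Algebra.smul_def]
    rfl
  rw [h4, map_mul, map_pow, map_inv₀ _ (y : RatFunc k)] at h2
  rwa [mul_assoc, inv_mul_cancel_left₀ h3] at h2

theorem exists_invX_pow_mul_mem_of_finite {ι : Type*} [Finite ι] (b : ι → F) :
    ∃ N : ℕ, ∀ i, invX k F ^ N * b i ∈ infinityIntegers k F := by
  have := Fintype.ofFinite ι
  choose N hN using fun i => exists_invX_pow_mul_mem (k := k) (b i)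
  refine ⟨Finset.univ.sup N, fun i => ?_⟩
  rw [← Nat.sub_add_cancel (Finset.le_sup (Finset.mem_univ i) : N i ≤ _), pow_add, mul_assoc]
  exact mul_mem (pow_mem (invX_mem k F) _) (hN i)

variable [Algebra k[X] F] [IsScalarTower k[X] (RatFunc k) F]

theorem finite_integers_inter [Finite k] [Algebra.IsSeparable (RatFunc k) F] (N : ℕ) :
    {x ∈ FunctionField.ringOfIntegers k F | invX k F ^ N * x ∈ infinityIntegers k F}.Finite := by
  obtain ⟨s, b, hb⟩ := FiniteDimensional.exists_is_basis_integral k[X] (RatFunc k) F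
  obtain ⟨c, hc⟩ := exists_invX_pow_mul_mem_of_finite (k := k) b
  let T := algebraMap k[X] (RatFunc k) ''
    {p : k[X] | inftyValuation k (algebraMap k[X] (RatFunc k) p) ≤ exp ((N + c : ℕ) : ℤ)}
  have hT : T.Finite := (finite_polynomial_le k _).image _
  refine Set.Finite.of_injOn (f := fun (x : F) (i : s) => Algebra.trace (RatFunc k) F (x * b i))
    (t := Set.pi Set.univ fun _ => T) ?_ ?_ (Set.Finite.pi fun _ => hT)
  · rintro x ⟨hxO, hx⟩ i -
    have h1 : IsIntegral k[X] (Algebra.trace (RatFunc k) F (x * b i)) :=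
      Algebra.isIntegral_trace (IsIntegral.mul hxO (hb i))
    obtain ⟨p, hp⟩ := IsIntegrallyClosed.isIntegral_iff.mp h1
    refine ⟨p, ?_, hp⟩
    have h2 : IsIntegral (inftyValuation k).valuationSubring
        (algebraMap (RatFunc k) F (RatFunc.X⁻¹ ^ (N + c)) * (x * b i)) := by
      have := IsIntegral.mul hx (hc i)
      rwa [show invX k F ^ N * x * (invX k F ^ c * b i) =
        algebraMap (RatFunc k) F (RatFunc.X⁻¹ ^ (N + c)) * (x * b i) by
          rw [map_pow, pow_add]
          ring] at this
    have h3 := mem_of_isIntegral (Algebra.isIntegral_trace (L := RatFunc k) h2)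
    rw [← Algebra.smul_def, map_smul, smul_eq_mul, map_mul, inftyValuation_X_inv_pow, ← hp] at h3
    rw [Set.mem_ofPred_eq]
    calc _ = exp ((N + c : ℕ) : ℤ) * (exp (-((N + c : ℕ) : ℤ)) * _) := by
          rw [← mul_assoc, ← exp_add, add_neg_cancel, exp_zero, one_mul]
      _ ≤ exp ((N + c : ℕ) : ℤ) * 1 := by gcongr
      _ = _ := mul_one _
  · intro x _ y _ hxy
    rw [← sub_eq_zero]
    refine (traceForm_nondegenerate (RatFunc k) F).1 _ fun z => ?_
    have : Algebra.traceForm (RatFunc k) F (x - y) = 0 := by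
      refine b.ext fun i => ?_
      have := congrFun hxy i
      rw [Algebra.traceForm_apply, sub_mul, map_sub, LinearMap.zero_apply, sub_eq_zero]
      exact this
    rw [this, LinearMap.zero_apply]

theorem exists_finite_add_integers [Finite k] (N : ℕ) :
    ∃ S : Set F, S.Finite ∧ ∀ x, ∃ b ∈ S, ∃ o ∈ FunctionField.ringOfIntegers k F,
      ∃ w : infinityIntegers k F, x - b - o = invX k F ^ N * w := by
  obtain ⟨s, b, hb⟩ := FiniteDimensional.exists_is_basis_integral k[X] (RatFunc k) F
  obtain ⟨c, hc⟩ := exists_invX_pow_mul_mem_of_finite (k := k) b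
  obtain ⟨S, hS, h⟩ := exists_finite_add_polynomial k (N + c)
  choose β hβ p hp using h
  refine ⟨_, (Set.Finite.pi (ι := s) fun _ => hS).image fun r => ∑ i, r i • b i, fun x => ?_⟩
  let r := b.repr x
  have hX : (RatFunc.X : RatFunc k) ≠ 0 := RatFunc.X_ne_zero
  let ρ := fun i => r i - β (r i) - algebraMap k[X] (RatFunc k) (p (r i))
  have hmem : ∑ i, algebraMap (RatFunc k) F (ρ i * RatFunc.X ^ (N + c)) *
      (invX k F ^ c * b i) ∈ infinityIntegers k F := by
    refine sum_mem fun i _ => mul_mem (algebraMap_mem_infinityIntegers ?_) (hc i)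
    rw [map_mul, map_pow, RatFunc.inftyValuation.X, ← exp_nsmul]
    calc _ ≤ exp (-((N + c : ℕ) : ℤ)) * exp ((N + c) • 1) := by
          gcongr
          exact hp _
      _ = 1 := by
          rw [← exp_add, ← exp_zero]
          simp
  refine ⟨_, ⟨fun i => β (r i), fun i _ => hβ _, rfl⟩, ∑ i, algebraMap k[X] F (p (r i)) * b i,
    sum_mem fun i _ => mul_mem (Subalgebra.algebraMap_mem _ _) (hb i), ⟨_, hmem⟩, ?_⟩
  rw [Finset.mul_sum]
  conv_lhs => rw [← b.sum_repr x]
  rw [← Finset.sum_sub_distrib, ← Finset.sum_sub_distrib]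
  refine Finset.sum_congr rfl fun i _ => ?_
  have hX' : algebraMap (RatFunc k) F RatFunc.X ≠ 0 := (_root_.map_ne_zero _).mpr hX
  rw [Algebra.smul_def, Algebra.smul_def, IsScalarTower.algebraMap_apply k[X] (RatFunc k) F,
    ← sub_mul, ← sub_mul, ← map_sub, ← map_sub, map_mul, map_pow, invX, map_inv₀]
  change algebraMap (RatFunc k) F (ρ i) * b i = _
  have h : (algebraMap (RatFunc k) F RatFunc.X)⁻¹ ^ N *
      algebraMap (RatFunc k) F RatFunc.X ^ (N + c) *
      (algebraMap (RatFunc k) F RatFunc.X)⁻¹ ^ c = 1 := by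
    rw [pow_add, ← mul_assoc, ← mul_pow, inv_mul_cancel₀ hX', one_pow, one_mul, ← mul_pow,
      mul_inv_cancel₀ hX', one_pow]
  linear_combination (-(algebraMap (RatFunc k) F (ρ i) * b i)) * h

end

end RatFunc

namespace RatFunc
open WithZero

section
variable {k F : Type*} [Field k] [DecidableEq (RatFunc k)] [Field F] [Algebra (RatFunc k) F]

theorem invX_ne_zero : invX k F ≠ 0 :=
  (_root_.map_ne_zero _).mpr (inv_ne_zero RatFunc.X_ne_zero)

theorem not_isUnit_invX : ¬ IsUnit (⟨invX k F, invX_mem k F⟩ : infinityIntegers k F) := by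
  intro h
  obtain ⟨y, hy⟩ := h.exists_right_inv
  have h1 : invX k F * y = 1 := congrArg Subtype.val hy
  have h2 : (y : F) = algebraMap (RatFunc k) F RatFunc.X := by
    rw [← mul_right_inj' (invX_ne_zero (k := k) (F := F)), h1, ← map_mul,
      inv_mul_cancel₀ RatFunc.X_ne_zero, map_one]
  have h3 : IsIntegral (inftyValuation k).valuationSubring (RatFunc.X : RatFunc k) := by
    have := y.2
    rw [h2] at this
    exact (isIntegral_algebraMap_iff (algebraMap (RatFunc k) F).injective).mp this
  have h4 := mem_of_isIntegral h3
  rw [RatFunc.inftyValuation.X, ← exp_zero, exp_le_exp] at h4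
  exact absurd h4 (by decide)

theorem invX_mem_of_isMaximal (Q : Ideal (infinityIntegers k F)) [Q.IsMaximal] :
    (⟨invX k F, invX_mem k F⟩ : infinityIntegers k F) ∈ Q := by
  have hQ : (Q.comap (algebraMap (inftyValuation k).valuationSubring
      (infinityIntegers k F))).IsMaximal :=
    Ideal.isMaximal_comap_of_isIntegral_of_isMaximal Q
  have hX : inftyValuation k (RatFunc.X⁻¹ : RatFunc k) < 1 := by
    have := inftyValuation_X_inv_pow k 1
    rw [pow_one] at this
    rw [this, ← exp_zero, exp_lt_exp]
    decide
  have h : (⟨RatFunc.X⁻¹, hX.le⟩ : (inftyValuation k).valuationSubring) ∈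
      IsLocalRing.maximalIdeal (inftyValuation k).valuationSubring := by
    rw [IsLocalRing.mem_maximalIdeal, mem_nonunits_iff]
    intro hu
    obtain ⟨y, hy⟩ := hu.exists_right_inv
    have h1 := congrArg (fun z => inftyValuation k z.val) hy
    have h2 : inftyValuation k (RatFunc.X⁻¹ : RatFunc k) * inftyValuation k (y : RatFunc k) = 1 := by
      rw [← map_mul, ← map_one (inftyValuation k)]
      exact h1
    exact (mul_lt_one_of_lt_of_le hX y.2).ne h2
  rw [← IsLocalRing.eq_maximalIdeal hQ] at h
  exact h

theorem valuation_invX_le [IsDedekindDomain (infinityIntegers k F)]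
    [IsFractionRing (infinityIntegers k F) F] (Q : HeightOneSpectrum (infinityIntegers k F)) :
    Q.valuation F (invX k F) ≤ exp (-1) := by
  have := Q.isMaximal
  have h : Q.valuation F (algebraMap (infinityIntegers k F) F ⟨invX k F, invX_mem k F⟩) < 1 :=
    (HeightOneSpectrum.valuation_lt_one_iff_mem Q _).mpr (invX_mem_of_isMaximal Q.asIdeal)
  change Q.valuation F (invX k F) < 1 at h
  have h0 : Q.valuation F (invX k F) ≠ 0 := (Valuation.ne_zero_iff _).mpr invX_ne_zero
  rw [← exp_log h0, ← exp_zero, exp_lt_exp] at h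
  rw [← exp_log h0, exp_le_exp]
  omega

end

end RatFunc

theorem FunctionField.exists_mul_mem_ringOfIntegers {k F : Type*} [Field k] [Field F]
    [Algebra k[X] F] [Algebra (RatFunc k) F] [IsScalarTower k[X] (RatFunc k) F]
    [FunctionField k F] (x : F) :
    ∃ y ∈ ringOfIntegers k F, y ≠ 0 ∧ x * y ∈ ringOfIntegers k F := by
  obtain ⟨a, b, hb, rfl⟩ := IsFractionRing.div_surjective (ringOfIntegers k F) x
  have hb0 : (b : F) ≠ 0 := fun h => nonZeroDivisors.ne_zero hb (Subtype.ext h)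
  refine ⟨b, b.2, hb0, ?_⟩
  change (a : F) / b * b ∈ _
  rw [div_mul_cancel₀ _ hb0]
  exact a.2

theorem FunctionField.mem_ringOfIntegers_of_isIntegral {k F : Type*} [Field k] [Field F]
    [Algebra k[X] F] [Algebra (RatFunc k) F] [IsScalarTower k[X] (RatFunc k) F]
    [FunctionField k F] {x : F} (hx : IsIntegral (ringOfIntegers k F) x) :
    x ∈ ringOfIntegers k F := by
  obtain ⟨y, rfl⟩ := IsIntegrallyClosed.isIntegral_iff.mp hx
  exact y.2

theorem sl2_abelianization_finite_exponent_dvd_six_function_field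
    (Fq F : Type) [Field Fq] [Fintype Fq] [Field F]
    [Algebra Fq[X] F] [Algebra (RatFunc Fq) F] [IsScalarTower Fq[X] (RatFunc Fq) F]
    [FunctionField Fq F] [Algebra.IsSeparable (RatFunc Fq) F]
    -- `T` is the set of finite places in `S`; since `S` contains all the infinite places,
    -- the ring of `S`-integers is exactly the ring of `T`-integers of the Dedekind domain
    -- `O_F` (the integral closure of `Fq[t]` in `F`).
    (T : Finset (HeightOneSpectrum (FunctionField.ringOfIntegers Fq F)))
    (A : Subalgebra (FunctionField.ringOfIntegers Fq F) F)
    (hA : A = (T : Set (HeightOneSpectrum (FunctionField.ringOfIntegers Fq F))).integer F)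
    (hU : Infinite (↥A)ˣ) :
    Finite (Abelianization (Matrix.SpecialLinearGroup (Fin 2) ↥A)) ∧
      ∀ x : Abelianization (Matrix.SpecialLinearGroup (Fin 2) ↥A), x ^ 6 = 1 := by
  classical
  have : IsDedekindDomain (RatFunc.infinityIntegers Fq F) :=
    integralClosure.isDedekindDomain (RatFunc.inftyValuation Fq).valuationSubring (RatFunc Fq) F
  have : IsFractionRing (RatFunc.infinityIntegers Fq F) F :=
    integralClosure.isFractionRing_of_finite_extension (RatFunc Fq) F
  obtain ⟨M, hM, hsM⟩ := exists_max_ideal_of_mem_nonunits (RatFunc.not_isUnit_invX (k := Fq) (F := F))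
  have hs0 : RatFunc.invX Fq F ≠ 0 := RatFunc.invX_ne_zero
  let P : HeightOneSpectrum (RatFunc.infinityIntegers Fq F) := ⟨M, hM.isPrime, by
    rintro rfl
    exact hs0 (congrArg Subtype.val (Ideal.mem_bot.mp hsM))⟩
  refine finite_abelianization_of_lattices (W := RatFunc.infinityIntegers Fq F) (F := F)
    (FunctionField.ringOfIntegers Fq F).toSubring P hs0 (fun Q => ?_) (fun N => ?_) (fun N => ?_)
    (fun x hx => ?_) (fun x => ?_) (fun x => ?_)
    (algebraMap (FunctionField.ringOfIntegers Fq F) A) (fun x => rfl) hU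
  · exact RatFunc.valuation_invX_le Q
  · refine (RatFunc.finite_integers_inter (k := Fq) (F := F) N).subset ?_
    rintro x ⟨hx, w, hw⟩
    refine ⟨hx, ?_⟩
    rw [← hw]
    exact w.2
  · exact RatFunc.exists_finite_add_integers N
  · exact FunctionField.mem_ringOfIntegers_of_isIntegral hx
  · obtain ⟨N, hN⟩ := RatFunc.exists_invX_pow_mul_mem (k := Fq) x
    exact ⟨N, ⟨_, hN⟩, rfl⟩
  · exact FunctionField.exists_mul_mem_ringOfIntegers x
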